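/- Let a, b, c and (l_ij), (m_ij) and F be as in the generalized Monge–Ampère setup. If the normalization ∫_{𝕋²}(e^F − ab + c²) = 0 holds, then there exists a smooth biperiodic function p : ℝ² → ℝ satisfying the generalized Monge–Ampère equation (GMA) and the ellipticity condition (E) at every point. -/

import Mathlib

open MeasureTheory

/-- Partial derivative in the first variable. -/
noncomputable def pdx (p : ℝ × ℝ → ℝ) (z : ℝ × ℝ) : ℝ := fderiv ℝ p z (1, 0)

/-- Partial derivative in the second variable. -/
noncomputable def pdy (p : ℝ × ℝ → ℝ) (z : ℝ × ℝ) : ℝ := fderiv ℝ p z (0, 1)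

/-- A function `ℝ² → ℝ` is biperiodic if it has period 1 in each variable. -/
def Biperiodic (p : ℝ × ℝ → ℝ) : Prop :=
  ∀ x y : ℝ, p (x + 1, y) = p (x, y) ∧ p (x, y + 1) = p (x, y)

/-- The integral over the torus `𝕋² = ℝ²/ℤ²` of (the descent of) a biperiodic function. -/
noncomputable def torusInt (f : ℝ × ℝ → ℝ) : ℝ := ∫ x in (0:ℝ)..1, ∫ y in (0:ℝ)..1, f (x, y)

set_option linter.all false

namespace GMA

/-! ### Part A : weights and the sequence space -/

abbrev Ix := ℤ × ℤ

noncomputable abbrev HH := lp (fun _ : Ix => ℂ) 2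

noncomputable def w (n : Ix) : ℝ := 1 + (n.1 : ℝ) ^ 2 + (n.2 : ℝ) ^ 2

lemma one_le_w (n : Ix) : 1 ≤ w n := by unfold w; nlinarith [sq_nonneg (n.1 : ℝ), sq_nonneg (n.2 : ℝ)]
lemma w_pos (n : Ix) : 0 < w n := lt_of_lt_of_le one_pos (one_le_w n)
lemma w_ne (n : Ix) : w n ≠ 0 := (w_pos n).ne'
lemma w_neg (n : Ix) : w (-n) = w n := by simp [w]
lemma w_zero : w 0 = 1 := by simp [w]

lemma w_add_le (m k : Ix) : w (m + k) ≤ 2 * (w m + w k) := by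
  simp only [w, Prod.fst_add, Prod.snd_add, Int.cast_add]
  nlinarith [sq_nonneg ((m.1 : ℝ) - k.1), sq_nonneg ((m.2 : ℝ) - k.2)]

lemma w_sub_le (m k : Ix) (ε : ℝ) (hε : 0 < ε) :
    |w (m + k) - w k| ≤ (1 + ε⁻¹) * w m + ε * w k := by
  have e : w (m + k) - w k = (m.1 : ℝ) ^ 2 + (m.2 : ℝ) ^ 2 + 2 * (m.1 * k.1 + m.2 * k.2) := by
    simp only [w, Prod.fst_add, Prod.snd_add, Int.cast_add]; ring
  rw [e]
  have h1 : ∀ s t : ℝ, |2 * (s * t)| ≤ ε⁻¹ * s ^ 2 + ε * t ^ 2 := by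
    intro s t
    have hh : ε⁻¹ * s ^ 2 + ε * t ^ 2 - 2 * (s * t) = ε⁻¹ * (s - ε * t) ^ 2 := by field_simp; ring
    have hh' : ε⁻¹ * s ^ 2 + ε * t ^ 2 + 2 * (s * t) = ε⁻¹ * (s + ε * t) ^ 2 := by field_simp; ring
    have p1 : 0 ≤ ε⁻¹ * (s - ε * t) ^ 2 := by positivity
    have p2 : 0 ≤ ε⁻¹ * (s + ε * t) ^ 2 := by positivity
    rw [abs_le]; constructor <;> linarith
  have a1 := h1 m.1 k.1
  have a2 := h1 m.2 k.2
  rw [abs_le] at a1 a2 ⊢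
  have hi : 0 < ε⁻¹ := inv_pos.mpr hε
  unfold w
  have q1 := sq_nonneg (m.1 : ℝ)
  have q2 := sq_nonneg (m.2 : ℝ)
  constructor <;> nlinarith [mul_nonneg hi.le q1]

lemma summable_int_inv : Summable (fun n : ℤ => (1 + (n : ℝ) ^ 2)⁻¹) := by
  have h : Summable (fun n : ℤ => |(n : ℝ)| ^ (-(2 : ℝ))) :=
    Real.summable_abs_int_rpow (by norm_num)
  have h2 : Summable (fun n : ℤ => (Set.indicator {0} (fun _ => (1 : ℝ)) n : ℝ)) := by
    apply summable_of_hasFiniteSupport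
    refine (Set.finite_singleton (0 : ℤ)).subset ?_
    intro n hn
    by_contra h0
    simp [Set.indicator] at hn
    exact h0 hn
  refine Summable.of_nonneg_of_le (fun n => by positivity) (fun n => ?_) (h.add h2)
  by_cases h0 : n = 0
  · subst h0; simp
  · have hp : 0 < (n : ℝ) ^ 2 := by positivity
    have : |(n : ℝ)| ^ (-(2 : ℝ)) = ((n : ℝ) ^ 2)⁻¹ := by
      rw [Real.rpow_neg (abs_nonneg _)]
      norm_num
    rw [this]
    simp only [Set.indicator, Set.mem_singleton_iff, h0, if_false, add_zero]
    apply inv_anti₀ hp; linarith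

lemma summable_w : Summable (fun n : Ix => ((w n)⁻¹) ^ 2) := by
  have h := Summable.mul_of_nonneg summable_int_inv summable_int_inv
    (fun n => by positivity) (fun n => by positivity)
  refine Summable.of_nonneg_of_le (fun n => by positivity) (fun n => ?_) h
  rw [← mul_inv, inv_pow]
  apply inv_anti₀ (by positivity)
  unfold w
  nlinarith [sq_nonneg (n.1 : ℝ), sq_nonneg (n.2 : ℝ), mul_nonneg (sq_nonneg (n.1 : ℝ)) (sq_nonneg (n.2 : ℝ))]

lemma memSq {f : Ix → ℂ} (h : Summable fun n => ‖f n‖ ^ 2) : Memℓp f 2 := by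
  apply memℓp_gen
  simpa using h

noncomputable def mk2 (f : Ix → ℂ) (h : Summable fun n => ‖f n‖ ^ 2) : HH := ⟨f, memSq h⟩

@[simp] lemma mk2_apply (f : Ix → ℂ) (h) (n : Ix) : (mk2 f h : Ix → ℂ) n = f n := rfl

lemma sqSummable (x : HH) : Summable fun n => ‖x n‖ ^ 2 := by
  have := (lp.memℓp x).summable (by norm_num)
  simpa using this

lemma nsq (x : HH) : ‖x‖ ^ 2 = ∑' n, ‖x n‖ ^ 2 := by
  have := lp.norm_rpow_eq_tsum (p := 2) (by norm_num) x
  simpa using this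

lemma HH_le (x : HH) (n : Ix) : ‖x n‖ ≤ ‖x‖ := lp.norm_apply_le_norm (by norm_num) x n

lemma HH_ext {x y : HH} (h : ∀ n, x n = y n) : x = y := lp.ext (funext h)

lemma norm_le_of_le {x y : HH} (h : ∀ n, ‖x n‖ ≤ ‖y n‖) : ‖x‖ ≤ ‖y‖ :=
  lp.norm_mono (by norm_num) h

lemma norm_le_mul_of_le {x y : HH} {C : ℝ} (hC : 0 ≤ C) (h : ∀ n, ‖x n‖ ≤ C * ‖y n‖) : ‖x‖ ≤ C * ‖y‖ := by
  have : ‖x‖ ≤ ‖(C : ℂ) • y‖ := norm_le_of_le (fun n => by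
    rw [lp.coeFn_smul, Pi.smul_apply, norm_smul]
    simpa [abs_of_nonneg hC] using h n)
  refine this.trans_eq ?_
  rw [norm_smul]; simp [abs_of_nonneg hC]

lemma summable_dom {f g : Ix → ℂ} (hg : Summable fun n => ‖g n‖ ^ 2) {C : ℝ}
    (h : ∀ n, ‖f n‖ ≤ C * ‖g n‖) : Summable fun n => ‖f n‖ ^ 2 := by
  refine Summable.of_nonneg_of_le (fun n => by positivity) (fun n => ?_) (hg.mul_left (C ^ 2))
  rw [← mul_pow]
  exact pow_le_pow_left₀ (norm_nonneg _) (h n) 2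

/-- diagonal operator -/
noncomputable def dg (φ : Ix → ℂ) (C : ℝ) (h : ∀ n, ‖φ n‖ ≤ C) : HH →L[ℂ] HH :=
  LinearMap.mkContinuous
    { toFun := fun x => mk2 (fun n => φ n * x n) (summable_dom (sqSummable x) (C := C) (fun n => by
        rw [norm_mul]; exact mul_le_mul_of_nonneg_right (h n) (norm_nonneg _)))
      map_add' := fun x y => HH_ext (fun n => by simp [mul_add])
      map_smul' := fun c x => HH_ext (fun n => by simp; ring) } C (fun x => by
        apply norm_le_mul_of_le ((norm_nonneg _).trans (h 0))
        intro n
        simp only [LinearMap.coe_mk, AddHom.coe_mk, mk2_apply, norm_mul]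
        exact mul_le_mul_of_nonneg_right (h n) (norm_nonneg _))

@[simp] lemma dg_apply (φ C h) (x : HH) (n : Ix) : dg φ C h x n = φ n * x n := rfl

lemma dg_norm_le (φ C h) (x : HH) : ‖dg φ C h x‖ ≤ C * ‖x‖ := by
  apply norm_le_mul_of_le ((norm_nonneg _).trans (h 0))
  intro n
  simp only [dg_apply, norm_mul]
  exact mul_le_mul_of_nonneg_right (h n) (norm_nonneg _)

/-- Cauchy–Schwarz -/
lemma cs_summable {f g : Ix → ℝ} (hf : Summable fun n => f n ^ 2) (hg : Summable fun n => g n ^ 2) :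
    Summable fun n => |f n * g n| := by
  refine Summable.of_nonneg_of_le (fun n => abs_nonneg _) (fun n => ?_) (hf.add hg)
  rw [abs_le]
  constructor <;> nlinarith [sq_nonneg (f n - g n), sq_nonneg (f n + g n)]

lemma cs_le {f g : Ix → ℝ} (hf : Summable fun n => f n ^ 2) (hg : Summable fun n => g n ^ 2) :
    (∑' n, f n * g n) ≤ Real.sqrt (∑' n, f n ^ 2) * Real.sqrt (∑' n, g n ^ 2) := by
  have hs := cs_summable hf hg
  refine hs.of_abs.tsum_le_of_sum_le ?_
  intro s
  refine (Real.sum_mul_le_sqrt_mul_sqrt s f g).trans ?_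
  gcongr
  · exact hf.sum_le_tsum s (fun n _ => sq_nonneg _)
  · exact hg.sum_le_tsum s (fun n _ => sq_nonneg _)

/-- weighted l1 norm -/
noncomputable def l1 (x : HH) : ℝ := ∑' n, (w n)⁻¹ * ‖x n‖

noncomputable def Sw : ℝ := Real.sqrt (∑' n : Ix, ((w n)⁻¹) ^ 2)

lemma Sw_nonneg : 0 ≤ Sw := Real.sqrt_nonneg _

lemma l1_summable (x : HH) : Summable fun n => (w n)⁻¹ * ‖x n‖ :=
  (cs_summable summable_w (sqSummable x)).of_abs

lemma l1_nonneg (x : HH) : 0 ≤ l1 x := tsum_nonneg (fun n => by have := w_pos n; positivity)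

lemma l1_le (x : HH) : l1 x ≤ Sw * ‖x‖ := by
  have := cs_le summable_w (sqSummable x)
  rw [← nsq, Real.sqrt_sq (norm_nonneg _)] at this
  exact this

/-- coordinate functional -/
noncomputable def cd (n : Ix) : HH →L[ℂ] ℂ := lp.evalCLM ℂ (fun _ : Ix => ℂ) 2 n

lemma cd_apply (n : Ix) (x : HH) : cd n x = x n := rfl

/-- shift -/
noncomputable def sh (m : Ix) (y : HH) : HH :=
  mk2 (fun n => (‖y (n - m)‖ : ℂ)) (by
    have := ((Equiv.subRight m).summable_iff (f := fun n => ‖y n‖ ^ 2)).2 (sqSummable y)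
    simpa [Function.comp_def] using this)

lemma sh_apply (m : Ix) (y : HH) (n : Ix) : sh m y n = (‖y (n - m)‖ : ℂ) := rfl

lemma sh_norm (m : Ix) (y : HH) : ‖sh m y‖ = ‖y‖ := by
  have h : ‖sh m y‖ ^ 2 = ‖y‖ ^ 2 := by
    rw [nsq, nsq, ← (Equiv.subRight m).tsum_eq (f := fun n => ‖y n‖ ^ 2)]
    simp [sh_apply]
  exact (pow_left_inj₀ (norm_nonneg _) (norm_nonneg _) (by norm_num)).1 h

lemma young (a : Ix → ℝ) (ha : ∀ m, 0 ≤ a m) (hs : Summable a) (y : HH) :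
    ∃ z : HH, ‖z‖ ≤ (∑' m, a m) * ‖y‖ ∧ ∀ n, HasSum (fun m => a m * ‖y (n - m)‖) ‖z n‖ := by
  have hn : ∀ m, ‖((a m : ℂ)) • sh m y‖ = a m * ‖y‖ := by
    intro m; rw [norm_smul, sh_norm]; simp [abs_of_nonneg (ha m)]
  have hs2 : Summable fun m => ‖((a m : ℂ)) • sh m y‖ := by
    simp only [hn]; exact hs.mul_right _
  refine ⟨∑' m, ((a m : ℂ)) • sh m y, ?_, ?_⟩
  · refine (norm_tsum_le_tsum_norm hs2).trans_eq ?_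
    simp only [hn]; exact tsum_mul_right
  · intro n
    have h1 := hs2.of_norm.hasSum
    have h2 := h1.mapL (cd n)
    have h3 : HasSum (fun m => ((a m * ‖y (n - m)‖ : ℝ) : ℂ)) ((∑' m, ((a m : ℂ)) • sh m y : HH) n) := by
      rw [cd_apply] at h2
      convert h2 using 2 with m
      rw [cd_apply, lp.coeFn_smul, Pi.smul_apply, sh_apply, smul_eq_mul]
      push_cast; rfl
    have h4 : ((∑' m, ((a m : ℂ)) • sh m y : HH) n) = ((∑' m, a m * ‖y (n - m)‖ : ℝ) : ℂ) := by
      rw [← h3.tsum_eq, Complex.ofReal_tsum]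
    have h5 : 0 ≤ ∑' m, a m * ‖y (n - m)‖ := tsum_nonneg (fun m => mul_nonneg (ha m) (norm_nonneg _))
    rw [h4] at h3 ⊢
    rw [Complex.norm_real, Real.norm_of_nonneg h5]
    exact_mod_cast h3


/-- admissible kernels -/
structure Ker where
  K : Ix → Ix → ℂ
  c1 : ℝ
  c2 : ℝ
  h1 : 0 ≤ c1
  h2 : 0 ≤ c2
  hK : ∀ m k, ‖K m k‖ ≤ c1 * (w m)⁻¹ + c2 * (w k)⁻¹

lemma ker_dom (K : Ker) (x y : HH) : ∃ z : HH, ‖z‖ ≤ K.c1 * l1 x * ‖y‖ + K.c2 * ‖x‖ * l1 y ∧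
    ∀ n, Summable (fun m => ‖K.K m (n - m) * x m * y (n - m)‖) ∧
      ∑' m, ‖K.K m (n - m) * x m * y (n - m)‖ ≤ ‖z n‖ := by
  have i0 : ∀ n, 0 ≤ (w n)⁻¹ := fun n => (inv_pos.2 (w_pos n)).le
  obtain ⟨z1, hz1, hz1'⟩ := young (fun m => K.c1 * ((w m)⁻¹ * ‖x m‖))
    (fun m => mul_nonneg K.h1 (mul_nonneg (i0 m) (norm_nonneg _))) ((l1_summable x).mul_left _) y
  obtain ⟨z2, hz2, hz2'⟩ := young (fun m => K.c2 * ((w m)⁻¹ * ‖y m‖))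
    (fun m => mul_nonneg K.h2 (mul_nonneg (i0 m) (norm_nonneg _))) ((l1_summable y).mul_left _) x
  rw [tsum_mul_left] at hz1 hz2
  have hb : ∀ n m, ‖K.K m (n - m) * x m * y (n - m)‖ ≤
      K.c1 * ((w m)⁻¹ * ‖x m‖) * ‖y (n - m)‖ + K.c2 * ((w (n - m))⁻¹ * ‖y (n - m)‖) * ‖x m‖ := by
    intro n m
    rw [norm_mul, norm_mul]
    have := mul_le_mul_of_nonneg_right (mul_le_mul_of_nonneg_right (K.hK m (n - m)) (norm_nonneg (x m)))
      (norm_nonneg (y (n - m)))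
    linarith
  have hz2'' : ∀ n, HasSum (fun m => K.c2 * ((w (n - m))⁻¹ * ‖y (n - m)‖) * ‖x m‖) ‖z2 n‖ := by
    intro n
    have := (Equiv.subLeft n).hasSum_iff.2 (hz2' n)
    simpa [Function.comp_def] using this
  have hd : ∀ n, HasSum (fun m => K.c1 * ((w m)⁻¹ * ‖x m‖) * ‖y (n - m)‖ +
      K.c2 * ((w (n - m))⁻¹ * ‖y (n - m)‖) * ‖x m‖) (‖z1 n‖ + ‖z2 n‖) :=
    fun n => (hz1' n).add (hz2'' n)
  have hsum : ∀ n, Summable (fun m => ‖K.K m (n - m) * x m * y (n - m)‖) := fun n =>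
    Summable.of_nonneg_of_le (fun m => norm_nonneg _) (hb n) (hd n).summable
  let za : HH := mk2 (fun n => (‖z1 n‖ : ℂ)) (by simpa using sqSummable z1)
  let zb : HH := mk2 (fun n => (‖z2 n‖ : ℂ)) (by simpa using sqSummable z2)
  have hza : ‖za‖ ≤ ‖z1‖ := norm_le_of_le (fun n => by simp [za])
  have hzb : ‖zb‖ ≤ ‖z2‖ := norm_le_of_le (fun n => by simp [zb])
  refine ⟨za + zb, ?_, fun n => ⟨hsum n, ?_⟩⟩
  · refine (norm_add_le _ _).trans ((add_le_add hza hzb).trans ((add_le_add hz1 hz2).trans ?_))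
    rw [← l1, ← l1]; linarith
  · refine ((hsum n).tsum_le_tsum (hb n) (hd n).summable).trans ?_
    rw [(hd n).tsum_eq, lp.coeFn_add, Pi.add_apply]
    simp only [za, zb, mk2_apply]
    rw [← Complex.ofReal_add, Complex.norm_real]
    exact le_abs_self _

lemma ker_summable (K : Ker) (x y : HH) (n : Ix) : Summable (fun m => K.K m (n - m) * x m * y (n - m)) := by
  obtain ⟨z, -, h⟩ := ker_dom K x y
  exact (h n).1.of_norm

noncomputable def TKf (K : Ker) (x y : HH) : HH :=
  mk2 (fun n => ∑' m, K.K m (n - m) * x m * y (n - m)) (by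
    obtain ⟨z, -, h⟩ := ker_dom K x y
    refine summable_dom (sqSummable z) (C := 1) (fun n => ?_)
    rw [one_mul]
    exact (norm_tsum_le_tsum_norm (h n).1).trans (h n).2)

lemma TKf_norm (K : Ker) (x y : HH) : ‖TKf K x y‖ ≤ K.c1 * l1 x * ‖y‖ + K.c2 * ‖x‖ * l1 y := by
  obtain ⟨z, hz, h⟩ := ker_dom K x y
  refine le_trans (norm_le_of_le (fun n => ?_)) hz
  exact (norm_tsum_le_tsum_norm (h n).1).trans (h n).2

lemma TKf_norm' (K : Ker) (x y : HH) : ‖TKf K x y‖ ≤ ((K.c1 + K.c2) * Sw) * ‖x‖ * ‖y‖ := by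
  refine (TKf_norm K x y).trans ?_
  have a := mul_le_mul_of_nonneg_right (mul_le_mul_of_nonneg_left (l1_le x) K.h1) (norm_nonneg y)
  have b := mul_le_mul_of_nonneg_left (l1_le y) (mul_nonneg K.h2 (norm_nonneg x))
  linarith

/-- the bilinear operator with kernel `K` -/
noncomputable def TK (K : Ker) : HH →L[ℂ] HH →L[ℂ] HH :=
  LinearMap.mkContinuous₂ (LinearMap.mk₂ ℂ (TKf K)
    (fun x x' y => HH_ext (fun n => by
      simp only [TKf, mk2_apply, lp.coeFn_add, Pi.add_apply]
      rw [← (ker_summable K x y n).tsum_add (ker_summable K x' y n)]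
      exact tsum_congr (fun m => by ring)))
    (fun c x y => HH_ext (fun n => by
      simp only [TKf, mk2_apply, lp.coeFn_smul, Pi.smul_apply, smul_eq_mul]
      rw [← tsum_mul_left]
      exact tsum_congr (fun m => by ring)))
    (fun x y y' => HH_ext (fun n => by
      simp only [TKf, mk2_apply, lp.coeFn_add, Pi.add_apply]
      rw [← (ker_summable K x y n).tsum_add (ker_summable K x y' n)]
      exact tsum_congr (fun m => by ring)))
    (fun c x y => HH_ext (fun n => by
      simp only [TKf, mk2_apply, lp.coeFn_smul, Pi.smul_apply, smul_eq_mul]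
      rw [← tsum_mul_left]
      exact tsum_congr (fun m => by ring)))) ((K.c1 + K.c2) * Sw) (fun x y => TKf_norm' K x y)

lemma TK_apply (K : Ker) (x y : HH) (n : Ix) :
    TK K x y n = ∑' m, K.K m (n - m) * x m * y (n - m) := rfl

lemma TK_norm (K : Ker) (x y : HH) : ‖TK K x y‖ ≤ K.c1 * l1 x * ‖y‖ + K.c2 * ‖x‖ * l1 y :=
  TKf_norm K x y

lemma TK_norm' (K : Ker) (x y : HH) : ‖TK K x y‖ ≤ ((K.c1 + K.c2) * Sw) * ‖x‖ * ‖y‖ :=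
  TKf_norm' K x y

/-- real sequences -/
def Re (a : Ix → ℂ) : Prop := ∀ n, a (-n) = (starRingEnd ℂ) (a n)

/-- translation -/
noncomputable def ex (n : Ix) (z : ℝ × ℝ) : ℂ := Complex.exp (((2 * Real.pi * (n.1 * z.1 + n.2 * z.2) : ℝ) : ℂ) * Complex.I)

lemma ex_norm (n z) : ‖ex n z‖ = 1 := Complex.norm_exp_ofReal_mul_I _

lemma ex_add (m k z) : ex (m + k) z = ex m z * ex k z := by
  unfold ex; rw [← Complex.exp_add]; congr 1; push_cast; simp; ring

lemma ex_add_right (m z z') : ex m (z + z') = ex m z * ex m z' := by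
  unfold ex; rw [← Complex.exp_add]; congr 1; push_cast; simp; ring

lemma ex_zero (z) : ex 0 z = 1 := by simp [ex]

lemma ex_zero_right (n) : ex n 0 = 1 := by simp [ex]

lemma ex_neg (n z) : ex (-n) z = (starRingEnd ℂ) (ex n z) := by
  unfold ex; rw [← Complex.exp_conj]; congr 1
  rw [map_mul, Complex.conj_ofReal, Complex.conj_I]; push_cast; simp; ring

noncomputable def tr (z : ℝ × ℝ) : HH →L[ℂ] HH := dg (fun n => ex n z) 1 (fun n => (ex_norm n z).le)

lemma tr_apply (z) (x : HH) (n) : tr z x n = ex n z * x n := rfl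

lemma TK_tr (K : Ker) (x y : HH) (z) : TK K (tr z x) (tr z y) = tr z (TK K x y) := by
  refine HH_ext (fun n => ?_)
  rw [tr_apply, TK_apply, TK_apply, ← tsum_mul_left]
  refine tsum_congr (fun m => ?_)
  rw [tr_apply, tr_apply]
  have : ex n z = ex m z * ex (n - m) z := by rw [← ex_add]; congr 1; abel
  rw [this]; ring

/-- reflection-conjugation, a real-linear isometry -/
noncomputable def rc (x : HH) : HH :=
  mk2 (fun n => (starRingEnd ℂ) (x (-n))) (by
    have := ((Equiv.neg Ix).summable_iff (f := fun n => ‖x n‖ ^ 2)).2 (sqSummable x)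
    simpa [Function.comp_def] using this)

lemma rc_apply (x : HH) (n) : rc x n = (starRingEnd ℂ) (x (-n)) := rfl

lemma rc_norm (x : HH) : ‖rc x‖ = ‖x‖ := by
  have h : ‖rc x‖ ^ 2 = ‖x‖ ^ 2 := by
    rw [nsq, nsq, ← (Equiv.neg Ix).tsum_eq (f := fun n => ‖x n‖ ^ 2)]
    simp [rc_apply]
  exact (pow_left_inj₀ (norm_nonneg _) (norm_nonneg _) (by norm_num)).1 h

lemma rc_add (x y : HH) : rc (x + y) = rc x + rc y := HH_ext (fun n => by simp [rc_apply])
lemma rc_sub (x y : HH) : rc (x - y) = rc x - rc y := HH_ext (fun n => by simp [rc_apply])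

lemma rc_cont : Continuous rc := by
  apply LipschitzWith.continuous (K := 1)
  apply LipschitzWith.of_dist_le_mul
  intro x y
  rw [dist_eq_norm, dist_eq_norm, ← rc_sub, rc_norm]; simp

lemma rc_eq_iff (x : HH) : rc x = x ↔ Re x := by
  constructor
  · intro h n
    have := congrArg (fun y : HH => (starRingEnd ℂ) (y n)) h
    simpa [rc_apply] using this
  · intro h
    refine HH_ext (fun n => ?_)
    rw [rc_apply, h n]; simp

lemma TK_rc (K : Ker) (hr : ∀ m k, K.K (-m) (-k) = (starRingEnd ℂ) (K.K m k)) (x y : HH) :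
    TK K (rc x) (rc y) = rc (TK K x y) := by
  refine HH_ext (fun n => ?_)
  rw [rc_apply, TK_apply, TK_apply, Complex.conj_tsum, ← (Equiv.neg Ix).tsum_eq]
  refine tsum_congr (fun m => ?_)
  simp only [Equiv.neg_apply, rc_apply, map_mul, neg_neg]
  have e : n - -m = -(-n - m) := by abel
  rw [e, hr, neg_neg]

end GMA

namespace GMA

/-! ### Part B : evaluation of Fourier series -/

def Sm (a : Ix → ℂ) : Prop := Summable (fun n => ‖a n‖)

noncomputable def ev (a : Ix → ℂ) (z : ℝ × ℝ) : ℂ := ∑' n, a n * ex n z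

lemma Sm.ev {a : Ix → ℂ} (h : Sm a) (z : ℝ × ℝ) : Summable (fun n => a n * ex n z) := by
  apply Summable.of_norm
  simpa [ex_norm, Sm] using h

lemma Sm.add {a b : Ix → ℂ} (ha : Sm a) (hb : Sm b) : Sm (fun n => a n + b n) :=
  Summable.of_nonneg_of_le (fun n => norm_nonneg _) (fun n => norm_add_le _ _) (Summable.add ha hb)

lemma Sm.sub {a b : Ix → ℂ} (ha : Sm a) (hb : Sm b) : Sm (fun n => a n - b n) :=
  Summable.of_nonneg_of_le (fun n => norm_nonneg _) (fun n => norm_sub_le _ _) (Summable.add ha hb)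

lemma Sm.smul {a : Ix → ℂ} (ha : Sm a) (c : ℂ) : Sm (fun n => c * a n) := by
  unfold Sm; simp only [norm_mul]; exact Summable.mul_left _ ha

lemma Sm.dom {a b : Ix → ℂ} (ha : Sm a) {C : ℝ} (h : ∀ n, ‖b n‖ ≤ C * ‖a n‖) : Sm b :=
  Summable.of_nonneg_of_le (fun n => norm_nonneg _) h (Summable.mul_left C ha)

lemma ev_add {a b : Ix → ℂ} (ha : Sm a) (hb : Sm b) (z) : ev (fun n => a n + b n) z = ev a z + ev b z := by
  unfold ev; rw [← (ha.ev z).tsum_add (hb.ev z)]; exact tsum_congr (fun n => by ring)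

lemma ev_sub {a b : Ix → ℂ} (ha : Sm a) (hb : Sm b) (z) : ev (fun n => a n - b n) z = ev a z - ev b z := by
  unfold ev; rw [← (ha.ev z).tsum_sub (hb.ev z)]; exact tsum_congr (fun n => by ring)

lemma ev_smul (a : Ix → ℂ) (c : ℂ) (z) : ev (fun n => c * a n) z = c * ev a z := by
  unfold ev; rw [← tsum_mul_left]; exact tsum_congr (fun n => by ring)

lemma ev_norm_le {a : Ix → ℂ} (ha : Sm a) (z) : ‖ev a z‖ ≤ ∑' n, ‖a n‖ := by
  have h : Summable fun n => ‖a n * ex n z‖ := by simpa [ex_norm, Sm] using ha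
  refine (norm_tsum_le_tsum_norm h).trans_eq ?_
  simp [ex_norm]

lemma ex_cont (n) : Continuous (ex n) := by unfold ex; fun_prop

lemma ev_cont {a : Ix → ℂ} (ha : Sm a) : Continuous (ev a) := by
  unfold ev
  refine continuous_tsum (u := fun n => ‖a n‖) (fun n => (ex_cont n).const_mul _) ha (fun n z => ?_)
  simp [ex_norm]

lemma ex_int (n : Ix) (z : ℝ × ℝ) (k : Ix) : ex n (z.1 + k.1, z.2 + k.2) = ex n z := by
  unfold ex
  rw [Complex.exp_eq_exp_iff_exists_int]
  refine ⟨n.1 * k.1 + n.2 * k.2, ?_⟩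
  push_cast; ring

lemma ev_per (a : Ix → ℂ) (z : ℝ × ℝ) (k : Ix) : ev a (z.1 + k.1, z.2 + k.2) = ev a z := by
  unfold ev; simp only [ex_int]

lemma ev_real {a : Ix → ℂ} (h : Re a) (z) : (starRingEnd ℂ) (ev a z) = ev a z := by
  unfold ev
  rw [Complex.conj_tsum, ← (Equiv.neg Ix).tsum_eq]
  refine tsum_congr (fun n => ?_)
  simp only [Equiv.neg_apply, map_mul, ex_neg]
  rw [h n]; simp

lemma ev_im {a : Ix → ℂ} (h : Re a) (z) : (ev a z).im = 0 := Complex.conj_eq_iff_im.1 (ev_real h z)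

lemma ev_re {a : Ix → ℂ} (h : Re a) (z) : (((ev a z).re : ℝ) : ℂ) = ev a z :=
  Complex.conj_eq_iff_re.1 (ev_real h z)

/-- convolution -/
noncomputable def cv (a b : Ix → ℂ) (n : Ix) : ℂ := ∑' m, a m * b (n - m)

def shEquiv : Ix × Ix ≃ Ix × Ix where
  toFun p := (p.1 + p.2, p.1)
  invFun p := (p.2, p.1 - p.2)
  left_inv p := by simp
  right_inv p := by simp

lemma cv_prod {a b : Ix → ℂ} (ha : Sm a) (hb : Sm b) :
    Summable (fun p : Ix × Ix => ‖a p.2 * b (p.1 - p.2)‖) := by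
  have h := Summable.mul_norm ha hb
  rw [← shEquiv.summable_iff]
  simpa [Function.comp_def, shEquiv] using h

lemma Sm.cv {a b : Ix → ℂ} (ha : Sm a) (hb : Sm b) : Sm (cv a b) := by
  have h := cv_prod ha hb
  refine Summable.of_nonneg_of_le (fun n => norm_nonneg _) (fun n => ?_) h.prod
  exact norm_tsum_le_tsum_norm (h.prod_factor n)

lemma Sm.cv_terms {a b : Ix → ℂ} (ha : Sm a) (hb : Sm b) (n) : Summable (fun m => a m * b (n - m)) :=
  ((cv_prod ha hb).prod_factor n).of_norm

lemma ev_cv {a b : Ix → ℂ} (ha : Sm a) (hb : Sm b) (z) : ev (cv a b) z = ev a z * ev b z := by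
  have ha' : Sm (fun n => a n * ex n z) := by simpa [Sm, ex_norm] using ha
  have hb' : Sm (fun n => b n * ex n z) := by simpa [Sm, ex_norm] using hb
  unfold ev
  rw [tsum_mul_tsum_of_summable_norm ha' hb', ← shEquiv.symm.tsum_eq]
  have h := cv_prod ha' hb'
  have h' : Summable (fun c : Ix × Ix => a (shEquiv.symm c).1 * ex (shEquiv.symm c).1 z * (b (shEquiv.symm c).2 * ex (shEquiv.symm c).2 z)) := by
    simpa [shEquiv] using h.of_norm
  rw [h'.tsum_prod]
  refine tsum_congr (fun n => ?_)
  unfold cv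
  rw [← tsum_mul_right]
  refine tsum_congr (fun m => ?_)
  simp only [shEquiv, Equiv.coe_fn_symm_mk]
  have : ex n z = ex m z * ex (n - m) z := by rw [← ex_add]; congr 1; abel
  rw [this]; ring

/-! integration -/

noncomputable def mu : Measure (ℝ × ℝ) := volume.restrict (Set.Ioc (0:ℝ) 1 ×ˢ Set.Ioc (0:ℝ) 1)

instance : IsProbabilityMeasure mu := ⟨by
  unfold mu
  rw [Measure.restrict_apply_univ, Measure.volume_eq_prod, Measure.prod_prod]; simp⟩

lemma mu_int {E : Type*} [NormedAddCommGroup E] {f : ℝ × ℝ → E} (hf : Continuous f) : Integrable f mu := by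
  unfold mu
  have h : IntegrableOn f (Set.Icc (0:ℝ) 1 ×ˢ Set.Icc (0:ℝ) 1) volume :=
    hf.continuousOn.integrableOn_compact (isCompact_Icc.prod isCompact_Icc)
  exact h.mono_set (Set.prod_mono Set.Ioc_subset_Icc_self Set.Ioc_subset_Icc_self)

lemma mu_eq {E : Type*} [NormedAddCommGroup E] [NormedSpace ℝ E] {f : ℝ × ℝ → E} (hf : Continuous f) :
    ∫ z, f z ∂mu = ∫ x in (0:ℝ)..1, ∫ y in (0:ℝ)..1, f (x, y) := by
  have := mu_int hf
  unfold mu at this ⊢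
  rw [Measure.volume_eq_prod] at this ⊢
  rw [setIntegral_prod _ this, intervalIntegral.integral_of_le zero_le_one]
  simp only [intervalIntegral.integral_of_le zero_le_one]

lemma int_exp (n : ℤ) : ∫ x in (0:ℝ)..1, Complex.exp (((2 * Real.pi * (n * x) : ℝ) : ℂ) * Complex.I) = if n = 0 then 1 else 0 := by
  by_cases h : n = 0
  · simp [h]
  · rw [if_neg h]
    have hc : (2 * Real.pi * n * Complex.I : ℂ) ≠ 0 := by
      simp [h, Real.pi_ne_zero]
    have := integral_exp_mul_complex (a := 0) (b := 1) hc
    have e : ∀ x : ℝ, Complex.exp (((2 * Real.pi * (n * x) : ℝ) : ℂ) * Complex.I) =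
        Complex.exp (2 * Real.pi * n * Complex.I * x) := fun x => by
      congr 1; push_cast; ring
    simp only [e]
    rw [this]
    have : Complex.exp (2 * Real.pi * n * Complex.I * (1:ℝ)) = 1 := by
      rw [Complex.exp_eq_one_iff]; exact ⟨n, by push_cast; ring⟩
    rw [this]; simp

lemma int_ex (n : Ix) : ∫ z, ex n z ∂mu = if n = 0 then 1 else 0 := by
  rw [mu_eq (ex_cont n)]
  have e : ∀ x y : ℝ, ex n (x, y) = Complex.exp (((2 * Real.pi * (n.1 * x) : ℝ) : ℂ) * Complex.I) *
      Complex.exp (((2 * Real.pi * (n.2 * y) : ℝ) : ℂ) * Complex.I) := fun x y => by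
    unfold ex; rw [← Complex.exp_add]; congr 1; push_cast; ring
  simp only [e, intervalIntegral.integral_const_mul, intervalIntegral.integral_mul_const, int_exp]
  rcases n with ⟨n1, n2⟩
  by_cases h1 : n1 = 0 <;> by_cases h2 : n2 = 0 <;> simp [h1, h2]

lemma int_ev {a : Ix → ℂ} (ha : Sm a) : ∫ z, ev a z ∂mu = a 0 := by
  unfold ev
  rw [← integral_tsum_of_summable_integral_norm]
  · simp only [integral_const_mul, int_ex]
    rw [tsum_eq_single 0 (fun n hn => by simp [hn])]
    simp
  · intro n; exact mu_int ((ex_cont n).const_mul _)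
  · simpa [ex_norm, Sm] using ha

noncomputable def cj (a : Ix → ℂ) (n : Ix) : ℂ := (starRingEnd ℂ) (a (-n))

lemma Sm.cj {a : Ix → ℂ} (ha : Sm a) : Sm (cj a) := by
  have := ((Equiv.neg Ix).summable_iff (f := fun n => ‖a n‖)).2 ha
  simpa [Function.comp_def, Sm, GMA.cj] using this

lemma ev_cj (a : Ix → ℂ) (z) : ev (cj a) z = (starRingEnd ℂ) (ev a z) := by
  unfold ev
  rw [Complex.conj_tsum, ← (Equiv.neg Ix).tsum_eq]
  refine tsum_congr (fun n => ?_)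
  simp only [Equiv.neg_apply, map_mul, ex_neg, cj, neg_neg]

lemma parseval2 {a b : Ix → ℂ} (ha : Sm a) (hb : Sm b) :
    ∫ z, ev a z * (starRingEnd ℂ) (ev b z) ∂mu = ∑' n, a n * (starRingEnd ℂ) (b n) := by
  have : ∀ z, ev a z * (starRingEnd ℂ) (ev b z) = ev (cv a (cj b)) z := fun z => by
    rw [ev_cv ha hb.cj, ev_cj]
  simp only [this]
  rw [int_ev (ha.cv hb.cj)]
  simp [cv, cj]

lemma parseval {a : Ix → ℂ} (ha : Sm a) : ∫ z, ‖ev a z‖ ^ 2 ∂mu = ∑' n, ‖a n‖ ^ 2 := by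
  have h := parseval2 ha ha
  simp only [Complex.mul_conj, Complex.normSq_eq_norm_sq] at h
  rw [integral_complex_ofReal, ← Complex.ofReal_tsum] at h
  exact_mod_cast h

lemma parseval_re {a b : Ix → ℂ} (ha : Sm a) (hb : Sm b) :
    ∫ z, (ev a z * (starRingEnd ℂ) (ev b z)).re ∂mu = ∑' n, (a n * (starRingEnd ℂ) (b n)).re := by
  have h := parseval2 ha hb
  have hs : Summable (fun n => a n * (starRingEnd ℂ) (b n)) := by
    have := ha.cv_terms hb.cj 0
    simpa [cj] using this
  have hi : Integrable (fun z => ev a z * (starRingEnd ℂ) (ev b z)) mu :=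
    mu_int ((ev_cont ha).mul (Complex.continuous_conj.comp (ev_cont hb)))
  have := congrArg Complex.re h
  rw [Complex.re_tsum hs] at this
  rw [← this]
  exact integral_re hi

lemma Sm.sq {a : Ix → ℂ} (ha : Sm a) : Summable (fun n => ‖a n‖ ^ 2) := by
  have := ha.cv_terms ha.cj 0
  have h2 := this.norm
  simpa [GMA.cj, pow_two] using h2

/-! rapid sequences -/

def Rapid (a : Ix → ℂ) : Prop := ∀ k : ℕ, ∃ C : ℝ, ∀ n, w n ^ k * ‖a n‖ ≤ C

lemma Rapid.mul {a : Ix → ℂ} (ha : Rapid a) {φ : Ix → ℂ} {C : ℝ} {j : ℕ} (hφ : ∀ n, ‖φ n‖ ≤ C * w n ^ j) :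
    Rapid (fun n => φ n * a n) := by
  intro k
  obtain ⟨D, hD⟩ := ha (k + j)
  have hC : 0 ≤ C := by
    have := (norm_nonneg _).trans (hφ 0); simpa [w_zero] using this
  refine ⟨C * D, fun n => ?_⟩
  rw [norm_mul]
  calc w n ^ k * (‖φ n‖ * ‖a n‖) ≤ w n ^ k * (C * w n ^ j * ‖a n‖) := by
        have := w_pos n; gcongr; exact hφ n
    _ = C * (w n ^ (k + j) * ‖a n‖) := by ring
    _ ≤ C * D := by gcongr; exact hD n

lemma Rapid.add {a b : Ix → ℂ} (ha : Rapid a) (hb : Rapid b) : Rapid (fun n => a n + b n) := by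
  intro k
  obtain ⟨D, hD⟩ := ha k
  obtain ⟨E, hE⟩ := hb k
  refine ⟨D + E, fun n => ?_⟩
  have := mul_le_mul_of_nonneg_left (norm_add_le (a n) (b n)) (pow_pos (w_pos n) k).le
  linarith [hD n, hE n]

lemma Rapid.smul {a : Ix → ℂ} (ha : Rapid a) (c : ℂ) : Rapid (fun n => c * a n) :=
  ha.mul (φ := fun _ => c) (C := ‖c‖) (j := 0) (fun n => by simp)

lemma Rapid.Sm {a : Ix → ℂ} (ha : Rapid a) : Sm a := by
  obtain ⟨D, hD⟩ := ha 2
  refine Summable.of_nonneg_of_le (fun n => norm_nonneg _) (fun n => ?_) (summable_w.mul_left D)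
  have h := w_pos n
  rw [inv_pow, ← div_eq_mul_inv, le_div_iff₀ (by positivity), mul_comm]
  exact hD n

noncomputable def d1 (n : Ix) : ℂ := 2 * Real.pi * n.1 * Complex.I
noncomputable def d2 (n : Ix) : ℂ := 2 * Real.pi * n.2 * Complex.I

lemma abs_le_w1 (n : Ix) : |(n.1 : ℝ)| ≤ w n := by
  rw [abs_le]; unfold w
  constructor <;> nlinarith [sq_nonneg ((n.1 : ℝ) - 1), sq_nonneg ((n.1 : ℝ) + 1), sq_nonneg (n.2 : ℝ)]
lemma abs_le_w2 (n : Ix) : |(n.2 : ℝ)| ≤ w n := by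
  rw [abs_le]; unfold w
  constructor <;> nlinarith [sq_nonneg ((n.2 : ℝ) - 1), sq_nonneg ((n.2 : ℝ) + 1), sq_nonneg (n.1 : ℝ)]

lemma d1_norm (n) : ‖d1 n‖ = 2 * Real.pi * |(n.1 : ℝ)| := by
  simp [d1, abs_of_pos Real.pi_pos, Complex.norm_intCast]
lemma d2_norm (n) : ‖d2 n‖ = 2 * Real.pi * |(n.2 : ℝ)| := by
  simp [d2, abs_of_pos Real.pi_pos, Complex.norm_intCast]

lemma d1_le (n) : ‖d1 n‖ ≤ 2 * Real.pi * w n ^ 1 := by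
  rw [d1_norm, pow_one]; have := Real.pi_pos; gcongr; exact abs_le_w1 n
lemma d2_le (n) : ‖d2 n‖ ≤ 2 * Real.pi * w n ^ 1 := by
  rw [d2_norm, pow_one]; have := Real.pi_pos; gcongr; exact abs_le_w2 n

lemma d1_neg (n) : d1 (-n) = (starRingEnd ℂ) (d1 n) := by simp [d1, Complex.conj_ofNat]
lemma d2_neg (n) : d2 (-n) = (starRingEnd ℂ) (d2 n) := by simp [d2, Complex.conj_ofNat]

lemma Re.mul {φ a : Ix → ℂ} (hφ : Re φ) (ha : Re a) : Re (fun n => φ n * a n) := fun n => by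
  simp [hφ n, ha n]

noncomputable def exL (n : Ix) (z : ℝ × ℝ) : ℝ × ℝ →L[ℝ] ℂ :=
  (ContinuousLinearMap.fst ℝ ℝ ℝ).smulRight (d1 n * ex n z) + (ContinuousLinearMap.snd ℝ ℝ ℝ).smulRight (d2 n * ex n z)

lemma ex_fderiv (n : Ix) (z : ℝ × ℝ) : HasFDerivAt (ex n) (exL n z) z := by
  have h1 : HasFDerivAt (fun z : ℝ × ℝ => (2 * Real.pi * (n.1 * z.1 + n.2 * z.2) : ℝ))
      ((2 * Real.pi) • ((n.1 : ℝ) • ContinuousLinearMap.fst ℝ ℝ ℝ + (n.2 : ℝ) • ContinuousLinearMap.snd ℝ ℝ ℝ)) z :=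
    ((hasFDerivAt_fst.const_mul _).add (hasFDerivAt_snd.const_mul _)).const_mul _
  have h2 := (Complex.ofRealCLM.hasFDerivAt.comp z h1)
  have h3 := (h2.mul_const Complex.I).cexp
  refine h3.congr_fderiv ?_
  ext <;> simp [exL, d1, d2, ex] <;> ring

lemma hasFDerivAt_ev {a : Ix → ℂ} (ha : Rapid a) (z : ℝ × ℝ) :
    HasFDerivAt (ev a) ((ContinuousLinearMap.fst ℝ ℝ ℝ).smulRight (ev (fun n => d1 n * a n) z) +
      (ContinuousLinearMap.snd ℝ ℝ ℝ).smulRight (ev (fun n => d2 n * a n) z)) z := by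
  have s1 := (ha.mul d1_le).Sm
  have s2 := (ha.mul d2_le).Sm
  have hb : ∀ n z, ‖a n • exL n z‖ ≤ ‖d1 n * a n‖ + ‖d2 n * a n‖ := by
    intro n z
    rw [norm_smul]
    have : ‖exL n z‖ ≤ ‖d1 n‖ + ‖d2 n‖ := by
      refine (norm_add_le _ _).trans (add_le_add ?_ ?_)
      · rw [ContinuousLinearMap.norm_smulRight_apply, norm_mul, ex_norm, mul_one]
        exact mul_le_of_le_one_left (norm_nonneg _) (ContinuousLinearMap.norm_fst_le _ _ _)
      · rw [ContinuousLinearMap.norm_smulRight_apply, norm_mul, ex_norm, mul_one]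
        exact mul_le_of_le_one_left (norm_nonneg _) (ContinuousLinearMap.norm_snd_le _ _ _)
    rw [norm_mul, norm_mul]
    nlinarith [norm_nonneg (a n)]
  have hs : Summable (fun n => ‖d1 n * a n‖ + ‖d2 n * a n‖) := Summable.add s1 s2
  have h := hasFDerivAt_tsum (𝕜 := ℝ) (f := fun n z => a n * ex n z) (f' := fun n z => a n • exL n z) hs
    (fun n z => (ex_fderiv n z).const_mul _) hb (x₀ := 0) (ha.Sm.ev 0) z
  refine h.congr_fderiv ?_
  have hs2 : Summable (fun n => a n • exL n z) :=
    Summable.of_norm_bounded hs (fun n => hb n z)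
  ext
  all_goals
    simp only [ContinuousLinearMap.comp_apply, add_apply]
    rw [← ContinuousLinearMap.apply_apply (𝕜 := ℝ) _ (∑' n, a n • exL n z), ContinuousLinearMap.map_tsum _ hs2]
    simp [exL, ev]
    exact tsum_congr (fun n => by ring)

lemma contDiff_ev_nat (k : ℕ) : ∀ {a : Ix → ℂ}, Rapid a → ContDiff ℝ k (ev a) := by
  induction k with
  | zero => intro a ha; exact_mod_cast contDiff_zero.2 (ev_cont ha.Sm)
  | succ k ih =>
    intro a ha
    have : ((k + 1 : ℕ) : WithTop ℕ∞) = (k : WithTop ℕ∞) + 1 := by push_cast; rfl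
    rw [this, contDiff_succ_iff_fderiv]
    refine ⟨fun z => (hasFDerivAt_ev ha z).differentiableAt, by simp, ?_⟩
    have e : fderiv ℝ (ev a) = fun z => (ContinuousLinearMap.fst ℝ ℝ ℝ).smulRight (ev (fun n => d1 n * a n) z) +
      (ContinuousLinearMap.snd ℝ ℝ ℝ).smulRight (ev (fun n => d2 n * a n) z) := by
      funext z; exact (hasFDerivAt_ev ha z).fderiv
    rw [e]
    have i1 := ih (ha.mul d1_le)
    have i2 := ih (ha.mul d2_le)
    fun_prop

lemma contDiff_ev {a : Ix → ℂ} (ha : Rapid a) : ContDiff ℝ (⊤ : ℕ∞) (ev a) :=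
  contDiff_infty.2 (fun k => contDiff_ev_nat k ha)

/-- derivative along lines -/
lemma hasDerivAt_ev {a : Ix → ℂ} (ha : Rapid a) (z v : ℝ × ℝ) (s : ℝ) :
    HasDerivAt (fun s : ℝ => ev a (z + s • v))
      (v.1 * ev (fun n => d1 n * a n) (z + s • v) + v.2 * ev (fun n => d2 n * a n) (z + s • v)) s := by
  have h1 : HasDerivAt (fun s : ℝ => z + s • v) v s := by
    simpa using ((hasDerivAt_id s).smul_const v).const_add z
  have := (hasFDerivAt_ev ha (z + s • v)).comp_hasDerivAt s h1
  simpa [Function.comp_def] using this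

end GMA

namespace GMA

/-! ### Part C : Fourier series of smooth functions -/

lemma uniq1 (h : ℝ → ℂ) (hc : Continuous h) (hp : Function.Periodic h 1)
    (h0 : ∀ n : ℤ, ∫ x in (0:ℝ)..1, h x * Complex.exp (((2 * Real.pi * (n * x) : ℝ) : ℂ) * Complex.I) = 0) :
    ∀ x, h x = 0 := by
  haveI : Fact ((0:ℝ) < 1) := ⟨one_pos⟩
  let f : C(AddCircle (1:ℝ), ℂ) := ⟨hp.lift, by
    exact continuous_coinduced_dom.mpr hc⟩
  have hf : ∀ x : ℝ, f x = h x := fun x => rfl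
  have hz : ∀ n, fourierCoeff f n = 0 := by
    intro n
    rw [fourierCoeff_eq_intervalIntegral f n 0]
    simp only [hf, zero_add]
    have := h0 (-n)
    rw [show ((1:ℝ) / 1) = 1 by norm_num, one_smul]
    rw [← this]
    congr 1; funext x
    rw [fourier_coe_apply, smul_eq_mul, mul_comm]
    congr 2; push_cast; simp; ring
  intro x
  have hs := has_pointwise_sum_fourier_series_of_summable (f := f) (by
    rw [show fourierCoeff (f : AddCircle (1:ℝ) → ℂ) = fun _ => 0 from funext hz]; exact summable_zero) (x : AddCircle (1:ℝ))
  simp only [hz, zero_smul] at hs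
  rw [← hf x]
  exact hs.unique hasSum_zero

lemma mu_eq' {E : Type*} [NormedAddCommGroup E] [NormedSpace ℝ E] {f : ℝ × ℝ → E} (hf : Continuous f) :
    ∫ z, f z ∂mu = ∫ y in (0:ℝ)..1, ∫ x in (0:ℝ)..1, f (x, y) := by
  have := mu_int hf
  unfold mu at this ⊢
  rw [Measure.volume_eq_prod, ← Measure.prod_restrict] at this ⊢
  rw [integral_prod_symm _ this, intervalIntegral.integral_of_le zero_le_one]
  simp only [intervalIntegral.integral_of_le zero_le_one]

def Per (g : ℝ × ℝ → ℂ) : Prop := ∀ x y : ℝ, g (x + 1, y) = g (x, y) ∧ g (x, y + 1) = g (x, y)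

noncomputable def fc (g : ℝ × ℝ → ℂ) (n : Ix) : ℂ := ∫ z, g z * ex (-n) z ∂mu

lemma uniq2 (h : ℝ × ℝ → ℂ) (hc : Continuous h) (hp : Per h) (h0 : ∀ n, fc h n = 0) : ∀ z, h z = 0 := by
  let E : ℤ → ℝ → ℂ := fun n x => Complex.exp (((2 * Real.pi * (n * x) : ℝ) : ℂ) * Complex.I)
  have hE : ∀ n, Continuous (E n) := fun n => by simp only [E]; fun_prop
  have e : ∀ n x y, ex n (x, y) = E n.1 x * E n.2 y := fun n x y => by
    simp only [E]; unfold ex; rw [← Complex.exp_add]; congr 1; push_cast; ring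
  have h1 : ∀ n1 : ℤ, ∀ y, (∫ x in (0:ℝ)..1, h (x, y) * E n1 x) = 0 := by
    intro n1
    apply uniq1
    · have hE1 := hE n1
      apply intervalIntegral.continuous_parametric_intervalIntegral_of_continuous' 
      exact (hc.comp (by fun_prop)).mul (hE1.comp (by fun_prop))
    · intro y; simp only [(hp _ y).2]
    · intro n2
      have := h0 (-(n1, n2))
      unfold fc at this
      rw [neg_neg, mu_eq' (f := fun z => h z * ex (n1, n2) z) (hc.mul (ex_cont _))] at this
      rw [← this]
      congr 1; funext y
      rw [← intervalIntegral.integral_mul_const]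
      congr 1; funext x
      simp only [e]; ring
  rintro ⟨x, y⟩
  refine uniq1 (fun x => h (x, y)) (hc.comp (by fun_prop)) (fun x => (hp x y).1) (fun n => h1 n y) x

/-- partial derivatives -/
noncomputable def p1 (g : ℝ × ℝ → ℂ) (z : ℝ × ℝ) : ℂ := fderiv ℝ g z (1, 0)
noncomputable def p2 (g : ℝ × ℝ → ℂ) (z : ℝ × ℝ) : ℂ := fderiv ℝ g z (0, 1)

lemma p1_smooth {g} (hg : ContDiff ℝ (⊤ : ℕ∞) g) : ContDiff ℝ (⊤ : ℕ∞) (p1 g) :=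
  (hg.fderiv_right (m := (⊤ : ℕ∞)) (by simp)).clm_apply contDiff_const
lemma p2_smooth {g} (hg : ContDiff ℝ (⊤ : ℕ∞) g) : ContDiff ℝ (⊤ : ℕ∞) (p2 g) :=
  (hg.fderiv_right (m := (⊤ : ℕ∞)) (by simp)).clm_apply contDiff_const

lemma per_fderiv {g} (hp : Per g) (x y : ℝ) : fderiv ℝ g (x + 1, y) = fderiv ℝ g (x, y) ∧
    fderiv ℝ g (x, y + 1) = fderiv ℝ g (x, y) := by
  have e1 : (fun z : ℝ × ℝ => g (z + (1, 0))) = g := by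
    funext ⟨x, y⟩; simpa using (hp x y).1
  have e2 : (fun z : ℝ × ℝ => g (z + (0, 1))) = g := by
    funext ⟨x, y⟩; simpa using (hp x y).2
  constructor
  · have := fderiv_comp_add_right (𝕜 := ℝ) (f := g) (x := (x, y)) ((1, 0) : ℝ × ℝ)
    rw [e1] at this; rw [this]; simp
  · have := fderiv_comp_add_right (𝕜 := ℝ) (f := g) (x := (x, y)) ((0, 1) : ℝ × ℝ)
    rw [e2] at this; rw [this]; simp

lemma p1_per {g} (hp : Per g) : Per (p1 g) := fun x y => by
  unfold p1; rw [(per_fderiv hp x y).1, (per_fderiv hp x y).2]; simp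
lemma p2_per {g} (hp : Per g) : Per (p2 g) := fun x y => by
  unfold p2; rw [(per_fderiv hp x y).1, (per_fderiv hp x y).2]; simp

lemma p1_hasDeriv {g : ℝ × ℝ → ℂ} (hg : ContDiff ℝ (⊤ : ℕ∞) g) (x y : ℝ) :
    HasDerivAt (fun x => g (x, y)) (p1 g (x, y)) x := by
  have h := ((hg.differentiable (by simp)) (x, y)).hasFDerivAt
  have h2 : HasDerivAt (fun x : ℝ => (x, y)) ((1, 0) : ℝ × ℝ) x :=
    (hasDerivAt_id x).prodMk (hasDerivAt_const x y)
  exact h.comp_hasDerivAt x h2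

lemma p2_hasDeriv {g : ℝ × ℝ → ℂ} (hg : ContDiff ℝ (⊤ : ℕ∞) g) (x y : ℝ) :
    HasDerivAt (fun y => g (x, y)) (p2 g (x, y)) y := by
  have h := ((hg.differentiable (by simp)) (x, y)).hasFDerivAt
  have h2 : HasDerivAt (fun y : ℝ => (x, y)) ((0, 1) : ℝ × ℝ) y :=
    (hasDerivAt_const y x).prodMk (hasDerivAt_id y)
  exact h.comp_hasDerivAt y h2

lemma int_p1 {g : ℝ × ℝ → ℂ} (hg : ContDiff ℝ (⊤ : ℕ∞) g) (hp : Per g) : ∫ z, p1 g z ∂mu = 0 := by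
  rw [mu_eq' (p1_smooth hg).continuous]
  have : ∀ y : ℝ, ∫ x in (0:ℝ)..1, p1 g (x, y) = 0 := by
    intro y
    rw [intervalIntegral.integral_eq_sub_of_hasDerivAt (fun x _ => p1_hasDeriv hg x y)
      (((p1_smooth hg).continuous.comp (by fun_prop)).intervalIntegrable _ _)]
    have := (hp 0 y).1
    rw [zero_add] at this; rw [this, sub_self]
  simp [this]

lemma int_p2 {g : ℝ × ℝ → ℂ} (hg : ContDiff ℝ (⊤ : ℕ∞) g) (hp : Per g) : ∫ z, p2 g z ∂mu = 0 := by
  rw [mu_eq (p2_smooth hg).continuous]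
  have : ∀ x : ℝ, ∫ y in (0:ℝ)..1, p2 g (x, y) = 0 := by
    intro x
    rw [intervalIntegral.integral_eq_sub_of_hasDerivAt (fun y _ => p2_hasDeriv hg x y)
      (((p2_smooth hg).continuous.comp (by fun_prop)).intervalIntegrable _ _)]
    have := (hp x 0).2
    rw [zero_add] at this; rw [this, sub_self]
  simp [this]

lemma ex_smooth (n) : ContDiff ℝ (⊤ : ℕ∞) (ex n) := by
  unfold ex
  have : ContDiff ℝ (⊤ : ℕ∞) (fun z : ℝ × ℝ => ((2 * Real.pi * (n.1 * z.1 + n.2 * z.2) : ℝ) : ℂ)) :=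
    Complex.ofRealCLM.contDiff.comp (f := fun z : ℝ × ℝ => (2 * Real.pi * (n.1 * z.1 + n.2 * z.2) : ℝ)) (by fun_prop)
  exact (this.mul contDiff_const).cexp

lemma ex_per (n) : Per (ex n) := fun x y => by
  have h1 := ex_int n (x, y) (1, 0)
  have h2 := ex_int n (x, y) (0, 1)
  simp at h1 h2
  exact ⟨h1, h2⟩

lemma d1_neg' (n) : d1 (-n) = - d1 n := by simp [d1]
lemma d2_neg' (n) : d2 (-n) = - d2 n := by simp [d2]

lemma fc_p1 {g : ℝ × ℝ → ℂ} (hg : ContDiff ℝ (⊤ : ℕ∞) g) (hp : Per g) (n) : fc (p1 g) n = d1 n * fc g n := by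
  have hs : ContDiff ℝ (⊤ : ℕ∞) (fun z => g z * ex (-n) z) := hg.mul (ex_smooth _)
  have hper : Per (fun z => g z * ex (-n) z) := fun x y => by
    simp only [(hp x y).1, (hp x y).2, (ex_per (-n) x y).1, (ex_per (-n) x y).2, and_self]
  have h := int_p1 hs hper
  have e : ∀ z, p1 (fun z => g z * ex (-n) z) z = p1 g z * ex (-n) z - d1 n * (g z * ex (-n) z) := by
    intro z
    have hm := ((hg.differentiable (by simp)) z).hasFDerivAt.mul (ex_fderiv (-n) z)
    unfold p1
    have hm' := hm.fderiv
    rw [show (fun z => g z * ex (-n) z) = g * ex (-n) from rfl, hm']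
    simp [exL, d1_neg']; ring
  simp only [e] at h
  rw [integral_sub, integral_const_mul, sub_eq_zero] at h
  · exact h
  · exact mu_int ((p1_smooth hg).continuous.mul (ex_cont _))
  · exact mu_int (hs.continuous.const_mul _)

lemma fc_p2 {g : ℝ × ℝ → ℂ} (hg : ContDiff ℝ (⊤ : ℕ∞) g) (hp : Per g) (n) : fc (p2 g) n = d2 n * fc g n := by
  have hs : ContDiff ℝ (⊤ : ℕ∞) (fun z => g z * ex (-n) z) := hg.mul (ex_smooth _)
  have hper : Per (fun z => g z * ex (-n) z) := fun x y => by
    simp only [(hp x y).1, (hp x y).2, (ex_per (-n) x y).1, (ex_per (-n) x y).2, and_self]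
  have h := int_p2 hs hper
  have e : ∀ z, p2 (fun z => g z * ex (-n) z) z = p2 g z * ex (-n) z - d2 n * (g z * ex (-n) z) := by
    intro z
    have hm := ((hg.differentiable (by simp)) z).hasFDerivAt.mul (ex_fderiv (-n) z)
    unfold p2
    have hm' := hm.fderiv
    rw [show (fun z => g z * ex (-n) z) = g * ex (-n) from rfl, hm']
    simp [exL, d2_neg']; ring
  simp only [e] at h
  rw [integral_sub, integral_const_mul, sub_eq_zero] at h
  · exact h
  · exact mu_int ((p2_smooth hg).continuous.mul (ex_cont _))
  · exact mu_int (hs.continuous.const_mul _)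

lemma fc_bdd {g : ℝ × ℝ → ℂ} (hg : Continuous g) : ∃ C, ∀ n, ‖fc g n‖ ≤ C := by
  refine ⟨∫ z, ‖g z‖ ∂mu, fun n => ?_⟩
  refine (norm_integral_le_integral_norm _).trans_eq ?_
  simp [ex_norm]

lemma fc_decay1 (k : ℕ) : ∀ {g : ℝ × ℝ → ℂ}, ContDiff ℝ (⊤ : ℕ∞) g → Per g →
    ∃ C, ∀ n, ‖d1 n‖ ^ k * ‖fc g n‖ ≤ C := by
  induction k with
  | zero => intro g hg hp; simpa using fc_bdd hg.continuous
  | succ k ih =>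
    intro g hg hp
    obtain ⟨C, hC⟩ := ih (p1_smooth hg) (p1_per hp)
    refine ⟨C, fun n => ?_⟩
    have := hC n
    rw [fc_p1 hg hp, norm_mul] at this
    rw [pow_succ]; linarith

lemma fc_decay2 (k : ℕ) : ∀ {g : ℝ × ℝ → ℂ}, ContDiff ℝ (⊤ : ℕ∞) g → Per g →
    ∃ C, ∀ n, ‖d2 n‖ ^ k * ‖fc g n‖ ≤ C := by
  induction k with
  | zero => intro g hg hp; simpa using fc_bdd hg.continuous
  | succ k ih =>
    intro g hg hp
    obtain ⟨C, hC⟩ := ih (p2_smooth hg) (p2_per hp)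
    refine ⟨C, fun n => ?_⟩
    have := hC n
    rw [fc_p2 hg hp, norm_mul] at this
    rw [pow_succ]; linarith

lemma pow3 (k : ℕ) {a b c : ℝ} (ha : 0 ≤ a) (hb : 0 ≤ b) (hc : 0 ≤ c) :
    (a + b + c) ^ k ≤ 3 ^ k * (a ^ k + b ^ k + c ^ k) := by
  have pa := pow_nonneg ha k
  have pb := pow_nonneg hb k
  have pc := pow_nonneg hc k
  have key : ∀ t : ℝ, 0 ≤ t → a ≤ t → b ≤ t → c ≤ t → (t ^ k ≤ a ^ k + b ^ k + c ^ k) →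
      (a + b + c) ^ k ≤ 3 ^ k * (a ^ k + b ^ k + c ^ k) := by
    intro t ht h1 h2 h3 h4
    calc (a + b + c) ^ k ≤ (3 * t) ^ k := pow_le_pow_left₀ (by positivity) (by linarith) k
      _ = 3 ^ k * t ^ k := mul_pow _ _ _
      _ ≤ _ := by gcongr
  rcases le_total a b with hab | hab <;> rcases le_total b c with hbc | hbc <;> rcases le_total a c with hac | hac
  all_goals first
    | exact key a ha le_rfl (by linarith) (by linarith) (by linarith)
    | exact key b hb (by linarith) le_rfl (by linarith) (by linarith)
    | exact key c hc (by linarith) (by linarith) le_rfl (by linarith)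

/-- Rapid decay from decay in each direction. -/
lemma rapid_of {a : Ix → ℂ} (h1 : ∀ k : ℕ, ∃ C, ∀ n, ‖d1 n‖ ^ k * ‖a n‖ ≤ C)
    (h2 : ∀ k : ℕ, ∃ C, ∀ n, ‖d2 n‖ ^ k * ‖a n‖ ≤ C) : Rapid a := by
  intro k
  obtain ⟨C0, hC0⟩ := h1 0
  obtain ⟨C1, hC1⟩ := h1 (2 * k)
  obtain ⟨C2, hC2⟩ := h2 (2 * k)
  refine ⟨3 ^ k * (C0 + C1 + C2), fun n => ?_⟩
  have hb : ∀ t : ℝ, (t ^ 2) ^ k ≤ (2 * Real.pi * |t|) ^ (2 * k) := by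
    intro t
    rw [← sq_abs t, ← pow_mul]
    apply pow_le_pow_left₀ (abs_nonneg _)
    have := Real.pi_gt_three
    nlinarith [abs_nonneg t]
  have b1 := hb n.1
  have b2 := hb n.2
  rw [← d1_norm] at b1
  rw [← d2_norm] at b2
  have hw : w n ^ k ≤ 3 ^ k * (1 + ‖d1 n‖ ^ (2 * k) + ‖d2 n‖ ^ (2 * k)) := by
    unfold w
    refine (pow3 k zero_le_one (sq_nonneg _) (sq_nonneg _)).trans ?_
    gcongr
    simp
  calc w n ^ k * ‖a n‖ ≤ 3 ^ k * (1 + ‖d1 n‖ ^ (2 * k) + ‖d2 n‖ ^ (2 * k)) * ‖a n‖ := by gcongr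
    _ = 3 ^ k * (‖d1 n‖ ^ 0 * ‖a n‖ + ‖d1 n‖ ^ (2 * k) * ‖a n‖ + ‖d2 n‖ ^ (2 * k) * ‖a n‖) := by ring
    _ ≤ _ := by gcongr; exacts [hC0 n, hC1 n, hC2 n]

lemma ev_Per (a) : Per (ev a) := fun x y => by
  have h1 := ev_per a (x, y) (1, 0)
  have h2 := ev_per a (x, y) (0, 1)
  simp at h1 h2
  exact ⟨h1, h2⟩

lemma fc_ev {a : Ix → ℂ} (ha : Sm a) (n) : fc (ev a) n = a n := by
  unfold fc
  have : ∀ z, ev a z * ex (-n) z = ev (fun k => a (k + n)) z := by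
    intro z
    unfold ev
    rw [← tsum_mul_right, ← (Equiv.addRight n).tsum_eq]
    refine tsum_congr (fun k => ?_)
    simp only [Equiv.coe_addRight]
    rw [mul_assoc, ← ex_add]; simp
  simp only [this]
  rw [int_ev]
  · simp
  · exact ((Equiv.addRight n).summable_iff (f := fun n => ‖a n‖)).2 ha

theorem fourier_smooth {g : ℝ × ℝ → ℝ} (hg : ContDiff ℝ (⊤ : ℕ∞) g)
    (hp : ∀ x y : ℝ, g (x + 1, y) = g (x, y) ∧ g (x, y + 1) = g (x, y)) :
    ∃ b : Ix → ℂ, Rapid b ∧ Re b ∧ (∀ z, ev b z = (g z : ℂ)) := by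
  let G : ℝ × ℝ → ℂ := fun z => (g z : ℂ)
  have hG : ContDiff ℝ (⊤ : ℕ∞) G := Complex.ofRealCLM.contDiff.comp hg
  have hGp : Per G := fun x y => by simp only [G, (hp x y).1, (hp x y).2, and_self]
  have hr : Rapid (fc G) := rapid_of (fun k => fc_decay1 k hG hGp) (fun k => fc_decay2 k hG hGp)
  refine ⟨fc G, hr, ?_, ?_⟩
  · intro n
    unfold fc
    rw [← integral_conj]
    simp [ex_neg, G]
  · have := uniq2 (fun z => ev (fc G) z - G z) ((ev_cont hr.Sm).sub hG.continuous) (fun x y => by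
      simp only [(hGp x y).1, (hGp x y).2, (ev_Per (fc G) x y).1, (ev_Per (fc G) x y).2, and_self]) (fun n => by
      have e : fc (fun z => ev (fc G) z - G z) n = fc (ev (fc G)) n - fc G n := by
        rw [fc, fc.eq_1 (ev (fc G)), fc.eq_1 G n, ← integral_sub]
        · simp only [sub_mul]
        · exact mu_int ((ev_cont hr.Sm).mul (ex_cont _))
        · exact mu_int (hG.continuous.mul (ex_cont _))
      rw [e, fc_ev hr.Sm, sub_self])
    intro z
    exact sub_eq_zero.1 (this z)

end GMA

namespace GMA

/-! ### Part D : parameters, symbols, the Cordes estimate -/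

structure Par where
  a : ℝ
  b : ℝ
  c : ℝ
  l11 : ℝ
  l12 : ℝ
  l22 : ℝ
  m11 : ℝ
  m12 : ℝ
  m22 : ℝ
  ha : 0 < a
  hd : 0 < a * b - c ^ 2
  h1 : m11 * l22 = 0
  h2 : l11 * l22 - l12 ^ 2 = 0
  h3 : m11 * m22 - m12 ^ 2 = 0
  h4 : l11 * m22 + l22 * m11 - 2 * l12 * m12 = 0

namespace Par
variable (P : Par)

lemma hb : 0 < P.b := by
  have := P.hd; have := P.ha
  by_contra h
  push Not at h
  nlinarith [sq_nonneg P.c]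

noncomputable def s11 (n : Ix) : ℂ := d1 n * d1 n - P.l11 * d1 n - P.m11 * d2 n
noncomputable def s12 (n : Ix) : ℂ := d1 n * d2 n - P.l12 * d1 n - P.m12 * d2 n
noncomputable def s22 (n : Ix) : ℂ := d2 n * d2 n - P.l22 * d1 n - P.m22 * d2 n
noncomputable def sp (m k : Ix) : ℂ := P.s11 m * P.s22 k + P.s22 m * P.s11 k - 2 * P.s12 m * P.s12 k
noncomputable def sA (n : Ix) : ℂ := P.b * P.s11 n + P.a * P.s22 n - 2 * P.c * P.s12 n

noncomputable def Cs : ℝ := 4 * Real.pi ^ 2 + 2 * Real.pi * (|P.l11| + |P.l12| + |P.l22| + |P.m11| + |P.m12| + |P.m22|)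

lemma Cs_pos : 0 < P.Cs := by unfold Cs; have := Real.pi_pos; positivity

lemma s11_neg (n) : P.s11 (-n) = (starRingEnd ℂ) (P.s11 n) := by simp [s11, d1_neg, d2_neg]
lemma s12_neg (n) : P.s12 (-n) = (starRingEnd ℂ) (P.s12 n) := by simp [s12, d1_neg, d2_neg]
lemma s22_neg (n) : P.s22 (-n) = (starRingEnd ℂ) (P.s22 n) := by simp [s22, d1_neg, d2_neg]
lemma sp_neg (m k) : P.sp (-m) (-k) = (starRingEnd ℂ) (P.sp m k) := by
  simp [sp, s11_neg, s12_neg, s22_neg, Complex.conj_ofNat]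
lemma sA_neg (n) : P.sA (-n) = (starRingEnd ℂ) (P.sA n) := by
  simp [sA, s11_neg, s12_neg, s22_neg, Complex.conj_ofNat]
lemma sp_comm (m k) : P.sp m k = P.sp k m := by simp only [sp]; ring

lemma s11_zero : P.s11 0 = 0 := by simp [s11, d1, d2]
lemma s12_zero : P.s12 0 = 0 := by simp [s12, d1, d2]
lemma s22_zero : P.s22 0 = 0 := by simp [s22, d1, d2]
lemma sA_zero : P.sA 0 = 0 := by simp [sA, s11_zero, s12_zero, s22_zero]

lemma sp_anti (n) : P.sp n (-n) = 0 := by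
  simp only [sp, s11, s12, s22, d1_neg', d2_neg']
  have h2 : (P.l11 * P.l22 - P.l12 ^ 2 : ℂ) = 0 := by exact_mod_cast P.h2
  have h3 : (P.m11 * P.m22 - P.m12 ^ 2 : ℂ) = 0 := by exact_mod_cast P.h3
  have h4 : (P.l11 * P.m22 + P.l22 * P.m11 - 2 * P.l12 * P.m12 : ℂ) = 0 := by exact_mod_cast P.h4
  linear_combination (-2 * d1 n ^ 2) * h2 + (-2 * d2 n ^ 2) * h3 + (-2 * d1 n * d2 n) * h4


lemma gen_le (n : Ix) (q : ℂ) (l m S : ℝ) (hq : ‖q‖ ≤ 4 * Real.pi ^ 2 * w n) (hS : |l| + |m| ≤ S) :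
    ‖q - l * d1 n - m * d2 n‖ ≤ (4 * Real.pi ^ 2 + 2 * Real.pi * S) * w n := by
  have e1 := d1_le n
  have e2 := d2_le n
  rw [pow_one] at e1 e2
  have h := norm_sub_le (q - l * d1 n) (m * d2 n)
  have h' := norm_sub_le q (l * d1 n)
  rw [norm_mul, Complex.norm_real, Real.norm_eq_abs] at h h'
  have f1 := mul_le_mul_of_nonneg_left e1 (abs_nonneg l)
  have f2 := mul_le_mul_of_nonneg_left e2 (abs_nonneg m)
  have f3 : (|l| + |m|) * (2 * Real.pi * w n) ≤ S * (2 * Real.pi * w n) :=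
    mul_le_mul_of_nonneg_right hS (by have := w_pos n; have := Real.pi_pos; positivity)
  linarith

lemma dd_le (n : Ix) (s t : ℝ) (h : |s| * |t| ≤ w n) : 2 * Real.pi * |s| * (2 * Real.pi * |t|) ≤ 4 * Real.pi ^ 2 * w n := by
  have := mul_le_mul_of_nonneg_left h (show 0 ≤ 4 * Real.pi ^ 2 by positivity)
  linarith

lemma s11_le (n) : ‖P.s11 n‖ ≤ P.Cs * w n := by
  apply gen_le
  · rw [norm_mul, d1_norm]; apply dd_le; rw [← pow_two, sq_abs]; unfold w; nlinarith [sq_nonneg (n.2 : ℝ)]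
  · linarith [abs_nonneg P.l12, abs_nonneg P.l22, abs_nonneg P.m12, abs_nonneg P.m22]
lemma s22_le (n) : ‖P.s22 n‖ ≤ P.Cs * w n := by
  apply gen_le
  · rw [norm_mul, d2_norm]; apply dd_le; rw [← pow_two, sq_abs]; unfold w; nlinarith [sq_nonneg (n.1 : ℝ)]
  · linarith [abs_nonneg P.l12, abs_nonneg P.l11, abs_nonneg P.m12, abs_nonneg P.m11]
lemma s12_le (n) : ‖P.s12 n‖ ≤ P.Cs * w n := by
  apply gen_le
  · rw [norm_mul, d2_norm, d1_norm]; apply dd_le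
    have := sq_abs (n.1 : ℝ)
    have := sq_abs (n.2 : ℝ)
    unfold w; nlinarith [sq_nonneg (|(n.1 : ℝ)| - |(n.2 : ℝ)|)]
  · linarith [abs_nonneg P.l11, abs_nonneg P.l22, abs_nonneg P.m11, abs_nonneg P.m22]

lemma sp_le (m k) : ‖P.sp m k‖ ≤ 4 * P.Cs ^ 2 * (w m * w k) := by
  have hc := P.Cs_pos
  have key : ∀ u v : ℂ, ‖u‖ ≤ P.Cs * w m → ‖v‖ ≤ P.Cs * w k → ‖u * v‖ ≤ P.Cs ^ 2 * (w m * w k) := by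
    intro u v hu hv
    rw [norm_mul]
    have := mul_le_mul hu hv (norm_nonneg _) ((norm_nonneg _).trans hu)
    linarith
  have e1 := key _ _ (P.s11_le m) (P.s22_le k)
  have e2 := key _ _ (P.s22_le m) (P.s11_le k)
  have e3 := key _ _ (P.s12_le m) (P.s12_le k)
  have h := norm_sub_le (P.s11 m * P.s22 k + P.s22 m * P.s11 k) (2 * P.s12 m * P.s12 k)
  have h' := norm_add_le (P.s11 m * P.s22 k) (P.s22 m * P.s11 k)
  have h2 : ‖2 * P.s12 m * P.s12 k‖ = 2 * ‖P.s12 m * P.s12 k‖ := by rw [mul_assoc, norm_mul]; simp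
  unfold sp
  linarith

noncomputable def CA : ℝ := (|P.b| + |P.a| + 2 * |P.c|) * P.Cs

lemma sA_le (n) : ‖P.sA n‖ ≤ P.CA * w n := by
  have h := norm_sub_le (P.b * P.s11 n + P.a * P.s22 n) (2 * P.c * P.s12 n)
  have h' := norm_add_le (P.b * P.s11 n) (P.a * P.s22 n)
  simp only [norm_mul, Complex.norm_real, Real.norm_eq_abs, Complex.norm_ofNat] at h h'
  have e1 := mul_le_mul_of_nonneg_left (P.s11_le n) (abs_nonneg P.b)
  have e2 := mul_le_mul_of_nonneg_left (P.s22_le n) (abs_nonneg P.a)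
  have e3 := mul_le_mul_of_nonneg_left (P.s12_le n) (abs_nonneg P.c)
  unfold sA CA
  linarith

lemma d1_re (n) : (d1 n).re = 0 := by simp [d1]
lemma d2_re (n) : (d2 n).re = 0 := by simp [d2]
lemma d1_im (n) : (d1 n).im = 2 * Real.pi * n.1 := by simp [d1]
lemma d2_im (n) : (d2 n).im = 2 * Real.pi * n.2 := by simp [d2]

lemma s11_re (n) : (P.s11 n).re = - (4 * Real.pi ^ 2 * n.1 ^ 2) := by
  simp [s11, d1_re, d2_re, d1_im, d2_im]; ring
lemma s22_re (n) : (P.s22 n).re = - (4 * Real.pi ^ 2 * n.2 ^ 2) := by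
  simp [s22, d1_re, d2_re, d1_im, d2_im]; ring
lemma s12_re (n) : (P.s12 n).re = - (4 * Real.pi ^ 2 * n.1 * n.2) := by
  simp [s12, d1_re, d2_re, d1_im, d2_im]; ring

lemma w_le_of_ne {n : Ix} (hn : n ≠ 0) : w n ≤ 2 * ((n.1 : ℝ) ^ 2 + (n.2 : ℝ) ^ 2) := by
  have h : (1 : ℤ) ≤ n.1 ^ 2 + n.2 ^ 2 := by
    by_contra h
    push Not at h
    apply hn
    have a1 : n.1 = 0 := by nlinarith [sq_nonneg n.1, sq_nonneg n.2]
    have a2 : n.2 = 0 := by nlinarith [sq_nonneg n.1, sq_nonneg n.2]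
    exact Prod.ext a1 a2
  have h' : (1 : ℝ) ≤ (n.1 : ℝ) ^ 2 + (n.2 : ℝ) ^ 2 := by exact_mod_cast h
  unfold w; linarith

lemma w_le_s {n : Ix} (hn : n ≠ 0) : w n ≤ ‖P.s11 n‖ + ‖P.s22 n‖ := by
  have h1 := Complex.abs_re_le_norm (P.s11 n)
  have h2 := Complex.abs_re_le_norm (P.s22 n)
  rw [s11_re, abs_neg, abs_of_nonneg (by positivity)] at h1
  rw [s22_re, abs_neg, abs_of_nonneg (by positivity)] at h2
  have h3 := w_le_of_ne hn
  have hp := Real.pi_gt_three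
  have q1 := sq_nonneg (n.1 : ℝ)
  have q2 := sq_nonneg (n.2 : ℝ)
  have hp2 : 2 ≤ 4 * Real.pi ^ 2 := by nlinarith
  nlinarith

lemma sA_lower {n : Ix} (hn : n ≠ 0) : ((P.a * P.b - P.c ^ 2) / (P.a + P.b)) * w n ≤ ‖P.sA n‖ := by
  have ha := P.ha
  have hb := P.hb
  have hd := P.hd
  have hT : 0 < P.a + P.b := by linarith
  have h1 := Complex.abs_re_le_norm (P.sA n)
  have e : (P.sA n).re = -(4 * Real.pi ^ 2 * (P.b * n.1 ^ 2 + P.a * n.2 ^ 2 - 2 * P.c * n.1 * n.2)) := by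
    simp [sA, s11_re, s22_re, s12_re]; ring
  rw [e, abs_neg] at h1
  have h3 := w_le_of_ne hn
  rw [div_mul_eq_mul_div, div_le_iff₀ hT]
  have key : (P.a * P.b - P.c ^ 2) * ((n.1 : ℝ) ^ 2 + (n.2 : ℝ) ^ 2) ≤
      (P.b * n.1 ^ 2 + P.a * n.2 ^ 2 - 2 * P.c * n.1 * n.2) * (P.a + P.b) := by
    nlinarith [sq_nonneg (P.b * n.1 - P.c * n.2), sq_nonneg (P.a * n.2 - P.c * n.1)]
  have hp := Real.pi_gt_three
  have hp2 : 2 ≤ 4 * Real.pi ^ 2 := by nlinarith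
  have h4 := le_abs_self (4 * Real.pi ^ 2 * (P.b * n.1 ^ 2 + P.a * n.2 ^ 2 - 2 * P.c * n.1 * n.2))
  have k1 := mul_le_mul_of_nonneg_left h3 hd.le
  have q0 : 0 ≤ (P.b * n.1 ^ 2 + P.a * n.2 ^ 2 - 2 * P.c * n.1 * n.2) * (P.a + P.b) := le_trans (by positivity) key
  have k2 := mul_le_mul_of_nonneg_right (h4.trans h1) hT.le
  have k3 := mul_le_mul_of_nonneg_right hp2 q0
  nlinarith

/-! kernels -/

noncomputable def Qk : Ker where
  K m k := w (m + k) * P.sp m k * ((w m)⁻¹ ^ 2 * (w k)⁻¹ ^ 2 : ℝ)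
  c1 := 8 * P.Cs ^ 2
  c2 := 8 * P.Cs ^ 2
  h1 := by positivity
  h2 := by positivity
  hK m k := by
    have hm := w_pos m
    have hk := w_pos k
    have hmk := w_pos (m + k)
    rw [norm_mul, norm_mul, Complex.norm_real, Complex.norm_real, Real.norm_of_nonneg hmk.le, Real.norm_of_nonneg (by positivity)]
    calc w (m + k) * ‖P.sp m k‖ * ((w m)⁻¹ ^ 2 * (w k)⁻¹ ^ 2)
        ≤ (2 * (w m + w k)) * (4 * P.Cs ^ 2 * (w m * w k)) * ((w m)⁻¹ ^ 2 * (w k)⁻¹ ^ 2) := by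
          gcongr
          · exact w_add_le m k
          · exact P.sp_le m k
      _ = _ := by field_simp; ring

noncomputable def Bk : Ker where
  K m k := P.sp m k * ((w m)⁻¹ ^ 2 * (w k)⁻¹ : ℝ)
  c1 := 4 * P.Cs ^ 2
  c2 := 0
  h1 := by positivity
  h2 := le_rfl
  hK m k := by
    have hm := w_pos m
    have hk := w_pos k
    rw [norm_mul, Complex.norm_real, Real.norm_of_nonneg (by positivity)]
    calc ‖P.sp m k‖ * ((w m)⁻¹ ^ 2 * (w k)⁻¹)
        ≤ (4 * P.Cs ^ 2 * (w m * w k)) * ((w m)⁻¹ ^ 2 * (w k)⁻¹) := by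
          gcongr
          exact P.sp_le m k
      _ = _ := by field_simp; ring

noncomputable def Ck (ε : ℝ) (hε : 0 < ε) : Ker where
  K m k := (w (m + k) - w k : ℝ) * P.sp m k * ((w m)⁻¹ ^ 2 * (w k)⁻¹ ^ 2 : ℝ)
  c1 := 4 * P.Cs ^ 2 * ε
  c2 := 4 * P.Cs ^ 2 * (1 + ε⁻¹)
  h1 := by positivity
  h2 := by positivity
  hK m k := by
    have hm := w_pos m
    have hk := w_pos k
    rw [norm_mul, norm_mul, Complex.norm_real, Complex.norm_real, Real.norm_eq_abs, Real.norm_of_nonneg (by positivity)]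
    calc |w (m + k) - w k| * ‖P.sp m k‖ * ((w m)⁻¹ ^ 2 * (w k)⁻¹ ^ 2)
        ≤ ((1 + ε⁻¹) * w m + ε * w k) * (4 * P.Cs ^ 2 * (w m * w k)) * ((w m)⁻¹ ^ 2 * (w k)⁻¹ ^ 2) := by
          gcongr
          · exact w_sub_le m k ε hε
          · exact P.sp_le m k
      _ = _ := by field_simp; ring

/-! physical quantities -/

noncomputable def U11 (p : Ix → ℂ) (z : ℝ × ℝ) : ℝ := P.a + (ev (fun n => P.s11 n * p n) z).re
noncomputable def U12 (p : Ix → ℂ) (z : ℝ × ℝ) : ℝ := P.c + (ev (fun n => P.s12 n * p n) z).re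
noncomputable def U22 (p : Ix → ℂ) (z : ℝ × ℝ) : ℝ := P.b + (ev (fun n => P.s22 n * p n) z).re

end Par

def W2 (p : Ix → ℂ) : Prop := Sm (fun n => w n * p n)

lemma W2.mul {p : Ix → ℂ} (hp : W2 p) {φ : Ix → ℂ} {C : ℝ} (h : ∀ n, ‖φ n‖ ≤ C * w n) : Sm (fun n => φ n * p n) := by
  refine Sm.dom hp (C := C) (fun n => ?_)
  rw [norm_mul, norm_mul, Complex.norm_real, Real.norm_of_nonneg (w_pos n).le, ← mul_assoc]
  exact mul_le_mul_of_nonneg_right (h n) (norm_nonneg _)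

namespace Par
variable (P : Par)

lemma Sm11 {p} (hp : W2 p) : Sm (fun n => P.s11 n * p n) := hp.mul P.s11_le
lemma Sm12 {p} (hp : W2 p) : Sm (fun n => P.s12 n * p n) := hp.mul P.s12_le
lemma Sm22 {p} (hp : W2 p) : Sm (fun n => P.s22 n * p n) := hp.mul P.s22_le

/-- polar form of the determinant on sequences -/
noncomputable def st (p u : Ix → ℂ) (n : Ix) : ℂ := ∑' m, P.sp m (n - m) * p m * u (n - m)

lemma st_eq {p u : Ix → ℂ} (hp : W2 p) (hu : W2 u) (n) : P.st p u n =
    cv (fun n => P.s11 n * p n) (fun n => P.s22 n * u n) n + cv (fun n => P.s22 n * p n) (fun n => P.s11 n * u n) n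
     - 2 * cv (fun n => P.s12 n * p n) (fun n => P.s12 n * u n) n := by
  have t1 := (P.Sm11 hp).cv_terms (P.Sm22 hu) n
  have t2 := (P.Sm22 hp).cv_terms (P.Sm11 hu) n
  have t3 := (P.Sm12 hp).cv_terms (P.Sm12 hu) n
  unfold cv st
  rw [← tsum_mul_left, ← t1.tsum_add t2, ← (t1.add t2).tsum_sub (t3.mul_left 2)]
  exact tsum_congr (fun m => by simp only [sp]; ring)

lemma st_Sm {p u : Ix → ℂ} (hp : W2 p) (hu : W2 u) : Sm (P.st p u) := by
  rw [funext (P.st_eq hp hu)]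
  exact (((P.Sm11 hp).cv (P.Sm22 hu)).add ((P.Sm22 hp).cv (P.Sm11 hu))).sub (((P.Sm12 hp).cv (P.Sm12 hu)).smul 2)

lemma ev_st {p u : Ix → ℂ} (hp : W2 p) (hu : W2 u) (z) : ev (P.st p u) z =
    ev (fun n => P.s11 n * p n) z * ev (fun n => P.s22 n * u n) z + ev (fun n => P.s22 n * p n) z * ev (fun n => P.s11 n * u n) z
     - 2 * (ev (fun n => P.s12 n * p n) z * ev (fun n => P.s12 n * u n) z) := by
  have c1 := (P.Sm11 hp).cv (P.Sm22 hu)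
  have c2 := (P.Sm22 hp).cv (P.Sm11 hu)
  have c3 := (P.Sm12 hp).cv (P.Sm12 hu)
  rw [funext (P.st_eq hp hu), ev_sub (c1.add c2) (c3.smul 2), ev_add c1 c2, ev_smul,
    ev_cv (P.Sm11 hp) (P.Sm22 hu), ev_cv (P.Sm22 hp) (P.Sm11 hu), ev_cv (P.Sm12 hp) (P.Sm12 hu)]

/-- linearised operator on sequences -/
noncomputable def Lf (p u : Ix → ℂ) (n : Ix) : ℂ := P.sA n * u n + P.st p u n

lemma sA_Sm {u} (hu : W2 u) : Sm (fun n => P.sA n * u n) := hu.mul P.sA_le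

lemma Lf_Sm {p u : Ix → ℂ} (hp : W2 p) (hu : W2 u) : Sm (P.Lf p u) := (P.sA_Sm hu).add (P.st_Sm hp hu)

lemma ev_sA {u} (hu : W2 u) (z) : ev (fun n => P.sA n * u n) z = P.b * ev (fun n => P.s11 n * u n) z +
    P.a * ev (fun n => P.s22 n * u n) z - 2 * P.c * ev (fun n => P.s12 n * u n) z := by
  rw [← ev_smul _ (P.b : ℂ), ← ev_smul _ (P.a : ℂ), ← ev_smul _ (2 * P.c : ℂ), ← ev_add ((P.Sm11 hu).smul _) ((P.Sm22 hu).smul _),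
    ← ev_sub (((P.Sm11 hu).smul _).add ((P.Sm22 hu).smul _)) ((P.Sm12 hu).smul _)]
  congr 1; funext n; simp only [sA]; ring

lemma Re11 {p} (hp : Re p) : Re (fun n => P.s11 n * p n) := Re.mul P.s11_neg hp
lemma Re12 {p} (hp : Re p) : Re (fun n => P.s12 n * p n) := Re.mul P.s12_neg hp
lemma Re22 {p} (hp : Re p) : Re (fun n => P.s22 n * p n) := Re.mul P.s22_neg hp

lemma ev_Lf {p u : Ix → ℂ} (hp : W2 p) (hr : Re p) (hu : W2 u) (z) : ev (P.Lf p u) z =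
    P.U22 p z * ev (fun n => P.s11 n * u n) z + P.U11 p z * ev (fun n => P.s22 n * u n) z
      - 2 * (P.U12 p z * ev (fun n => P.s12 n * u n) z) := by
  unfold Lf
  rw [ev_add (P.sA_Sm hu) (P.st_Sm hp hu), P.ev_sA hu, P.ev_st hp hu]
  unfold U11 U12 U22
  push_cast
  rw [ev_re (P.Re11 hr), ev_re (P.Re12 hr), ev_re (P.Re22 hr)]
  ring

end Par

/-- lower bound of a quadratic form -/
def Low (lam A B C : ℝ) : Prop := ∀ s t : ℝ, lam * (s ^ 2 + t ^ 2) ≤ A * s ^ 2 + 2 * B * s * t + C * t ^ 2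

lemma Low.h1 {lam A B C : ℝ} (h : Low lam A B C) : lam ≤ A := by have := h 1 0; simpa using this
lemma Low.h2 {lam A B C : ℝ} (h : Low lam A B C) : lam ≤ C := by have := h 0 1; simpa using this
lemma Low.h3 {lam A B C : ℝ} (h : Low lam A B C) : B ^ 2 ≤ (A - lam) * (C - lam) := by
  have h' : ∀ x : ℝ, 0 ≤ (A - lam) * (x * x) + (2 * B) * x + (C - lam) := fun x => by
    have := h x 1; nlinarith
  have := discrim_le_zero h'
  unfold discrim at this
  nlinarith
lemma Low.det {lam A B C : ℝ} (h : Low lam A B C) (hl : 0 ≤ lam) : lam ^ 2 ≤ A * C - B ^ 2 := by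
  have := h.h1; have := h.h2; have := h.h3
  nlinarith

lemma low_of {lam A B C : ℝ} (h1 : lam ≤ A) (h2 : lam ≤ C) (h3 : B ^ 2 ≤ (A - lam) * (C - lam)) : Low lam A B C := by
  intro s t
  rcases eq_or_lt_of_le h1 with h | h
  · have : B = 0 := by
      have : B ^ 2 ≤ 0 := by rw [← h] at h3; simpa using h3
      nlinarith [sq_nonneg B]
    subst this
    nlinarith [mul_nonneg (sub_nonneg.2 h2) (sq_nonneg t)]
  · have h0 : 0 < A - lam := by linarith
    have e : (A - lam) * ((A * s ^ 2 + 2 * B * s * t + C * t ^ 2) - lam * (s ^ 2 + t ^ 2)) =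
        ((A - lam) * s + B * t) ^ 2 + ((A - lam) * (C - lam) - B ^ 2) * t ^ 2 := by ring
    have p : 0 ≤ (A - lam) * ((A * s ^ 2 + 2 * B * s * t + C * t ^ 2) - lam * (s ^ 2 + t ^ 2)) := by
      rw [e]; have := mul_nonneg (sub_nonneg.2 h3) (sq_nonneg t); positivity
    have := nonneg_of_mul_nonneg_right p h0
    linarith

lemma psd_sq {n1 n2 n3 : ℝ} (h1 : 0 ≤ n1) (h3 : 0 ≤ n3) (h2 : n2 ^ 2 ≤ n1 * n3) (h k l : ℝ) :
    0 ≤ (n1 * h + 2 * n2 * k + n3 * l) ^ 2 - 2 * (n1 * n3 - n2 ^ 2) * (h * l - k ^ 2) := by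
  rcases eq_or_lt_of_le h1 with h0 | h0
  · have : n2 = 0 := by
      have : n2 ^ 2 ≤ 0 := by rw [← h0] at h2; simpa using h2
      nlinarith [sq_nonneg n2]
    subst this; rw [← h0]; nlinarith [sq_nonneg (n3 * l)]
  · have e : n1 ^ 2 * ((n1 * h + 2 * n2 * k + n3 * l) ^ 2 - 2 * (n1 * n3 - n2 ^ 2) * (h * l - k ^ 2)) =
      (n1 ^ 2 * h + 2 * n1 * n2 * k + n2 ^ 2 * l) ^ 2 + 2 * (n1 * n3 - n2 ^ 2) * (n1 * k + n2 * l) ^ 2 +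
        (n1 * n3 - n2 ^ 2) ^ 2 * l ^ 2 := by ring
    have hD := sub_nonneg.2 h2
    have p : 0 ≤ n1 ^ 2 * ((n1 * h + 2 * n2 * k + n3 * l) ^ 2 - 2 * (n1 * n3 - n2 ^ 2) * (h * l - k ^ 2)) := by
      rw [e]; positivity
    exact nonneg_of_mul_nonneg_right p (by positivity)

lemma cordes_real {lam A B C : ℝ} (hl : 0 ≤ lam) (h : Low lam A B C) (p q r : ℝ) :
    lam ^ 2 * (p ^ 2 + 2 * q ^ 2 + r ^ 2) ≤ (C * p - 2 * B * q + A * r) ^ 2 - 2 * (A * C - B ^ 2) * (p * r - q ^ 2) := by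
  have a1 := h.h1; have a2 := h.h2; have a3 := h.h3
  have k1 := psd_sq (n1 := C - lam) (n2 := -B) (n3 := A - lam) (by linarith) (by linarith) (by nlinarith) p q r
  have k2 := h (q) (-p)
  have k3 := h (r) (-q)
  nlinarith

lemma cordes_c {lam L A B C : ℝ} (hl : 0 < lam) (h : Low lam A B C) (hA : A ≤ L) (hC : C ≤ L) (p q r : ℂ) :
    lam ^ 2 / L ^ 2 * (‖p‖ ^ 2 + 2 * ‖q‖ ^ 2 + ‖r‖ ^ 2) ≤ ‖C * p + A * r - 2 * (B * q)‖ ^ 2 / lam ^ 2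
      - 2 * ((p * (starRingEnd ℂ) r).re - (q * (starRingEnd ℂ) q).re) := by
  have e1 := cordes_real hl.le h p.re q.re r.re
  have e2 := cordes_real hl.le h p.im q.im r.im
  have hd := h.det hl.le
  have hl2 : 0 < lam ^ 2 := by positivity
  have hd0 : 0 < A * C - B ^ 2 := lt_of_lt_of_le hl2 hd
  have a1 := h.h1; have a2 := h.h2
  have hd1 : A * C - B ^ 2 ≤ L ^ 2 := by nlinarith [sq_nonneg B]
  have n2 : ∀ u : ℂ, ‖u‖ ^ 2 = u.re ^ 2 + u.im ^ 2 := fun u => by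
    rw [← Complex.normSq_eq_norm_sq, Complex.normSq_apply]; ring
  set D := A * C - B ^ 2 with hD
  have key : lam ^ 2 * (‖p‖ ^ 2 + 2 * ‖q‖ ^ 2 + ‖r‖ ^ 2) ≤ ‖C * p + A * r - 2 * (B * q)‖ ^ 2
      - D * (2 * ((p * (starRingEnd ℂ) r).re - (q * (starRingEnd ℂ) q).re)) := by
    rw [n2, n2, n2, n2]
    simp
    nlinarith
  set X := ‖p‖ ^ 2 + 2 * ‖q‖ ^ 2 + ‖r‖ ^ 2 with hX
  set Y := ‖C * p + A * r - 2 * (B * q)‖ ^ 2 with hY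
  set Z := 2 * ((p * (starRingEnd ℂ) r).re - (q * (starRingEnd ℂ) q).re)
  have hX0 : 0 ≤ X := by positivity
  have hY0 : 0 ≤ Y := by positivity
  have k1 : lam ^ 2 / D * X ≤ Y / D - Z := by
    rw [div_mul_eq_mul_div, div_le_iff₀ hd0]
    have : (Y / D - Z) * D = Y - D * Z := by field_simp
    rw [this]; exact key
  have k2 : lam ^ 2 / L ^ 2 * X ≤ lam ^ 2 / D * X := by gcongr
  have k3 : Y / D ≤ Y / lam ^ 2 := by gcongr
  linarith

namespace Par
variable (P : Par)

/-- ellipticity bounds -/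
def Ell (lam : ℝ) (p : Ix → ℂ) : Prop := ∀ z, Low lam (P.U11 p z) (P.U12 p z) (P.U22 p z)
def Upp (L : ℝ) (p : Ix → ℂ) : Prop := ∀ z, P.U11 p z ≤ L ∧ P.U22 p z ≤ L

lemma sconj (n) : (P.s11 n * (starRingEnd ℂ) (P.s22 n)).re = (P.s12 n * (starRingEnd ℂ) (P.s12 n)).re := by
  have h := P.sp_anti n
  unfold sp at h
  rw [s11_neg, s22_neg, s12_neg] at h
  have := congrArg Complex.re h
  simp at this ⊢
  linarith

lemma cordes_plain {p u : Ix → ℂ} (hp : W2 p) (hr : Re p) (hu : W2 u) {lam L : ℝ} (hl : 0 < lam)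
    (he : P.Ell lam p) (hL : P.Upp L p) :
    lam ^ 2 / L ^ 2 * ((∑' n, ‖P.s11 n * u n‖ ^ 2) + 2 * (∑' n, ‖P.s12 n * u n‖ ^ 2) + ∑' n, ‖P.s22 n * u n‖ ^ 2)
      ≤ (∑' n, ‖P.Lf p u n‖ ^ 2) / lam ^ 2 := by
  have S1 := P.Sm11 hu
  have S2 := P.Sm12 hu
  have S3 := P.Sm22 hu
  have C1 := ev_cont S1
  have C2 := ev_cont S2
  have C3 := ev_cont S3
  have CL := ev_cont (P.Lf_Sm hp hu)
  have hpt : ∀ z, lam ^ 2 / L ^ 2 * (‖ev (fun n => P.s11 n * u n) z‖ ^ 2 + 2 * ‖ev (fun n => P.s12 n * u n) z‖ ^ 2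
      + ‖ev (fun n => P.s22 n * u n) z‖ ^ 2) ≤ ‖ev (P.Lf p u) z‖ ^ 2 / lam ^ 2 -
      2 * ((ev (fun n => P.s11 n * u n) z * (starRingEnd ℂ) (ev (fun n => P.s22 n * u n) z)).re -
        (ev (fun n => P.s12 n * u n) z * (starRingEnd ℂ) (ev (fun n => P.s12 n * u n) z)).re) := by
    intro z
    rw [P.ev_Lf hp hr hu]
    exact cordes_c hl (he z) (hL z).1 (hL z).2 _ _ _
  have cc : Continuous (starRingEnd ℂ) := Complex.continuous_conj
  have hI := integral_mono (μ := mu) (mu_int (by fun_prop)) (mu_int (by fun_prop)) hpt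
  rw [integral_const_mul, integral_add (mu_int (by fun_prop)) (mu_int (by fun_prop)),
    integral_add (mu_int (by fun_prop)) (mu_int (by fun_prop)), integral_const_mul, integral_sub (mu_int (by fun_prop)) (mu_int (by fun_prop)),
    integral_div, integral_const_mul, integral_sub (mu_int (by fun_prop)) (mu_int (by fun_prop)),
    parseval S1, parseval S2, parseval S3, parseval (P.Lf_Sm hp hu), parseval_re S1 S3, parseval_re S2 S2] at hI
  have e : ∀ n, (P.s11 n * u n * (starRingEnd ℂ) (P.s22 n * u n)).re = (P.s12 n * u n * (starRingEnd ℂ) (P.s12 n * u n)).re := by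
    intro n
    have h := P.sconj n
    have k : ∀ s t : ℂ, (s * u n * (starRingEnd ℂ) (t * u n)).re = (s * (starRingEnd ℂ) t).re * ‖u n‖ ^ 2 := by
      intro s t
      have : s * u n * (starRingEnd ℂ) (t * u n) = (s * (starRingEnd ℂ) t) * ((‖u n‖ ^ 2 : ℝ) : ℂ) := by
        rw [← Complex.normSq_eq_norm_sq, ← Complex.mul_conj]; simp; ring
      rw [this, Complex.re_mul_ofReal]
    rw [k, k, h]
  rw [tsum_congr e] at hI
  linarith

/-- Cordes estimate -/
lemma LE2 {p u : Ix → ℂ} (hp : W2 p) (hr : Re p) (hu : W2 u) {lam L : ℝ} (hl : 0 < lam)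
    (he : P.Ell lam p) (hL : P.Upp L p) :
    (∑' n, ‖w n * u n‖ ^ 2) ≤ 2 * (L / lam ^ 2) ^ 2 * (∑' n, ‖P.Lf p u n‖ ^ 2) + ‖u 0‖ ^ 2 := by
  have h := P.cordes_plain hp hr hu hl he hL
  have S1 := (P.Sm11 hu).sq
  have S3 := (P.Sm22 hu).sq
  have Sw : Summable (fun n => ‖(w n : ℂ) * u n‖ ^ 2) := Sm.sq hu
  have hL0 : 0 < L := lt_of_lt_of_le hl ((he 0).h1.trans (hL 0).1)
  have S2 : 0 ≤ ∑' n, ‖P.s12 n * u n‖ ^ 2 := tsum_nonneg (fun n => by positivity)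
  have h1 : (∑' n, ‖P.s11 n * u n‖ ^ 2) + ∑' n, ‖P.s22 n * u n‖ ^ 2 ≤ (L / lam ^ 2) ^ 2 * ∑' n, ‖P.Lf p u n‖ ^ 2 := by
    rw [div_mul_eq_mul_div, div_le_div_iff₀ (by positivity) (by positivity)] at h
    rw [div_pow, div_mul_eq_mul_div, le_div_iff₀ (by positivity)]
    nlinarith [mul_nonneg S2 (show 0 ≤ lam ^ 4 by positivity)]
  have hz : Summable (fun n : Ix => if n = 0 then ‖u 0‖ ^ 2 else 0) := by
    apply summable_of_ne_finset_zero (s := {0}); intro n hn; simp at hn; simp [hn]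
  have hb : ∀ n, ‖(w n : ℂ) * u n‖ ^ 2 ≤ (2 * ‖P.s11 n * u n‖ ^ 2 + 2 * ‖P.s22 n * u n‖ ^ 2) + if n = 0 then ‖u 0‖ ^ 2 else 0 := by
    intro n
    by_cases hn : n = 0
    · subst hn; simp [w_zero]; positivity
    · simp only [hn, if_false, add_zero]
      have := mul_le_mul_of_nonneg_right (P.w_le_s hn) (norm_nonneg (u n))
      simp only [norm_mul, Complex.norm_real, Real.norm_of_nonneg (w_pos n).le]
      have w0 := w_pos n
      have k0 : 0 ≤ w n * ‖u n‖ := by positivity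
      nlinarith [sq_nonneg (‖P.s11 n‖ * ‖u n‖ - ‖P.s22 n‖ * ‖u n‖)]
  have := Sw.tsum_le_tsum hb (((S1.mul_left 2).add (S3.mul_left 2)).add hz)
  rw [((S1.mul_left 2).add (S3.mul_left 2)).tsum_add hz, (S1.mul_left 2).tsum_add (S3.mul_left 2), tsum_mul_left, tsum_mul_left, tsum_ite_eq] at this
  linarith

/-- boundedness -/
lemma SB {p u : Ix → ℂ} (hp : W2 p) (hr : Re p) (hu : W2 u) {lam L : ℝ} (hl : 0 ≤ lam)
    (he : P.Ell lam p) (hL : P.Upp L p) :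
    (∑' n, ‖P.Lf p u n‖ ^ 2) ≤ (4 * L * P.Cs) ^ 2 * ∑' n, ‖w n * u n‖ ^ 2 := by
  have S1 := P.Sm11 hu
  have S2 := P.Sm12 hu
  have S3 := P.Sm22 hu
  have C1 := ev_cont S1
  have C2 := ev_cont S2
  have C3 := ev_cont S3
  have CL := ev_cont (P.Lf_Sm hp hu)
  have hpt : ∀ z, ‖ev (P.Lf p u) z‖ ^ 2 ≤ 4 * L ^ 2 * (‖ev (fun n => P.s11 n * u n) z‖ ^ 2 + 2 * ‖ev (fun n => P.s12 n * u n) z‖ ^ 2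
      + ‖ev (fun n => P.s22 n * u n) z‖ ^ 2) := by
    intro z
    rw [P.ev_Lf hp hr hu]
    have a1 := (he z).h1; have a2 := (he z).h2; have a3 := (he z).h3
    have b1 := (hL z).1; have b2 := (hL z).2
    set A := P.U11 p z
    set B := P.U12 p z
    set C := P.U22 p z
    have hB : |B| ≤ L := by
      apply abs_le_of_sq_le_sq _ (by linarith)
      nlinarith
    set X := ev (fun n => P.s11 n * u n) z
    set Y := ev (fun n => P.s12 n * u n) z
    set Z := ev (fun n => P.s22 n * u n) z
    have t1 := norm_sub_le (C * X + A * Z) (2 * (B * Y))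
    have t2 := norm_add_le (C * X) (A * Z)
    simp only [norm_mul, Complex.norm_real, Real.norm_eq_abs, Complex.norm_ofNat] at t1 t2
    rw [abs_of_nonneg (by linarith), abs_of_nonneg (by linarith)] at t2
    have u1 := mul_le_mul_of_nonneg_right b2 (norm_nonneg X)
    have u2 := mul_le_mul_of_nonneg_right b1 (norm_nonneg Z)
    have u3 := mul_le_mul_of_nonneg_right hB (norm_nonneg Y)
    have : ‖C * X + A * Z - 2 * (B * Y)‖ ≤ L * (‖X‖ + ‖Z‖ + 2 * ‖Y‖) := by linarith
    have := pow_le_pow_left₀ (norm_nonneg _) this 2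
    refine this.trans ?_
    have : (‖X‖ + ‖Z‖ + 2 * ‖Y‖) ^ 2 ≤ 4 * (‖X‖ ^ 2 + 2 * ‖Y‖ ^ 2 + ‖Z‖ ^ 2) := by
      nlinarith [sq_nonneg (‖X‖ - ‖Y‖), sq_nonneg (‖X‖ - ‖Z‖), sq_nonneg (‖Z‖ - ‖Y‖)]
    rw [mul_pow]
    nlinarith [sq_nonneg L]
  have hI := integral_mono (μ := mu) (mu_int (by fun_prop)) (mu_int (by fun_prop)) hpt
  rw [integral_const_mul, integral_add (mu_int (by fun_prop)) (mu_int (by fun_prop)),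
    integral_add (mu_int (by fun_prop)) (mu_int (by fun_prop)), integral_const_mul, 
    parseval S1, parseval S2, parseval S3, parseval (P.Lf_Sm hp hu)] at hI
  have Sw : Summable (fun n => ‖(w n : ℂ) * u n‖ ^ 2) := Sm.sq hu
  have key : ∀ φ : Ix → ℂ, (∀ n, ‖φ n‖ ≤ P.Cs * w n) → Sm (fun n => φ n * u n) →
      ∑' n, ‖φ n * u n‖ ^ 2 ≤ P.Cs ^ 2 * ∑' n, ‖w n * u n‖ ^ 2 := by
    intro φ hφ hS
    rw [← tsum_mul_left]
    refine hS.sq.tsum_le_tsum (fun n => ?_) (Sw.mul_left _)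
    rw [← mul_pow]
    refine pow_le_pow_left₀ (norm_nonneg _) ?_ 2
    rw [norm_mul, norm_mul, Complex.norm_real, Real.norm_of_nonneg (w_pos n).le, ← mul_assoc]
    exact mul_le_mul_of_nonneg_right (hφ n) (norm_nonneg _)
  have k1 := key _ P.s11_le S1
  have k2 := key _ P.s12_le S2
  have k3 := key _ P.s22_le S3
  nlinarith [sq_nonneg L]

end Par
end GMA

namespace GMA

/-! ### Part E : linear theory in weighted sequence spaces -/

noncomputable def pp (x : Ix → ℂ) (n : Ix) : ℂ := (((w n)⁻¹ ^ 2 : ℝ) : ℂ) * x n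

lemma pp_W2 (x : HH) : W2 (pp x) := by
  unfold W2 Sm
  refine (l1_summable x).congr (fun n => ?_)
  have := w_pos n
  unfold pp
  rw [norm_mul, norm_mul, Complex.norm_real, Complex.norm_real, Real.norm_of_nonneg this.le, Real.norm_of_nonneg (by positivity)]
  field_simp

lemma pp_Re {x : Ix → ℂ} (h : Re x) : Re (pp x) := by
  intro n; unfold pp; rw [w_neg, h n, map_mul, Complex.conj_ofReal]

lemma sum_pp (x : HH) : ∑' n, ‖(w n : ℂ) * pp x n‖ = l1 x := by
  unfold l1
  refine tsum_congr (fun n => ?_)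
  have := w_pos n
  unfold pp
  rw [norm_mul, norm_mul, Complex.norm_real, Complex.norm_real, Real.norm_of_nonneg this.le, Real.norm_of_nonneg (by positivity)]
  field_simp

namespace Par
variable (P : Par)

lemma ev_pp_le {φ : Ix → ℂ} {C : ℝ} (hC : 0 ≤ C) (h : ∀ n, ‖φ n‖ ≤ C * w n) (x : HH) (z) :
    ‖ev (fun n => φ n * pp x n) z‖ ≤ C * Sw * ‖x‖ := by
  have hS := (pp_W2 x).mul h
  refine (ev_norm_le hS z).trans ?_
  have h1 : ∑' n, ‖φ n * pp x n‖ ≤ ∑' n, C * ‖(w n : ℂ) * pp x n‖ := by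
    refine Summable.tsum_le_tsum (fun n => ?_) hS (Summable.mul_left _ (pp_W2 x))
    rw [norm_mul, norm_mul, Complex.norm_real, Real.norm_of_nonneg (w_pos n).le, ← mul_assoc]
    exact mul_le_mul_of_nonneg_right (h n) (norm_nonneg _)
  rw [tsum_mul_left, sum_pp] at h1
  have := mul_le_mul_of_nonneg_left (l1_le x) hC
  linarith

lemma Upp_of {x : HH} {M : ℝ} (hM : ‖x‖ ≤ M) : P.Upp (P.a + P.b + P.Cs * Sw * M) (pp x) := by
  intro z
  have c0 := P.Cs_pos
  have s0 := Sw_nonneg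
  have k1 := (Complex.re_le_norm _).trans (ev_pp_le c0.le P.s11_le x z)
  have k2 := (Complex.re_le_norm _).trans (ev_pp_le c0.le P.s22_le x z)
  have := mul_le_mul_of_nonneg_left hM (mul_nonneg c0.le s0)
  have := P.ha; have := P.hb
  unfold U11 U22
  constructor <;> linarith

noncomputable def dgA : HH →L[ℂ] HH := dg (fun n => P.sA n * ((w n)⁻¹ : ℝ)) P.CA (fun n => by
  have := w_pos n
  rw [norm_mul, Complex.norm_real, Real.norm_of_nonneg (by positivity)]
  rw [← div_eq_mul_inv, div_le_iff₀ this]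
  exact P.sA_le n)

lemma dgA_apply (x : HH) (n) : P.dgA x n = P.sA n * ((w n)⁻¹ : ℝ) * x n := rfl

noncomputable def LL (x : HH) : HH →L[ℂ] HH := P.dgA + TK P.Bk x

lemma LL_apply (x y : HH) (n) : P.LL x y n = P.Lf (pp x) (fun n => ((w n)⁻¹ : ℝ) * y n) n := by
  simp only [LL, ContinuousLinearMap.add_apply, lp.coeFn_add, Pi.add_apply, dgA_apply, TK_apply, Lf, st]
  congr 1
  · ring
  · refine tsum_congr (fun m => ?_)
    simp only [Bk, pp]; push_cast; ring

lemma le2_fin {x y : HH} (hr : Re x) {lam L : ℝ} (hl : 0 < lam) (he : P.Ell lam (pp x)) (hL : P.Upp L (pp x))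
    (hy : Sm y) : ‖y‖ ^ 2 ≤ 2 * (L / lam ^ 2) ^ 2 * ‖P.LL x y‖ ^ 2 + ‖y 0‖ ^ 2 := by
  have e : ∀ n, (w n : ℂ) * (((w n)⁻¹ : ℝ) * y n) = y n := by
    intro n; rw [← mul_assoc, ← Complex.ofReal_mul, mul_inv_cancel₀ (w_ne n)]; simp
  have hu : W2 (fun n => ((w n)⁻¹ : ℝ) * y n) := by
    unfold W2; simpa only [e] using hy
  have := P.LE2 (pp_W2 x) (pp_Re hr) hu hl he hL
  simp only [e, w_zero] at this
  rw [nsq, nsq]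
  simp only [LL_apply]
  simpa using this

lemma LE2H {x : HH} (hr : Re x) {lam L : ℝ} (hl : 0 < lam) (he : P.Ell lam (pp x)) (hL : P.Upp L (pp x)) (y : HH) :
    ‖y‖ ≤ 2 * (L / lam ^ 2) * ‖P.LL x y‖ + ‖y 0‖ := by
  have hs := lp.hasSum_single (E := fun _ : Ix => ℂ) (p := 2) (by norm_num) y
  have h2 : ‖y‖ ^ 2 ≤ 2 * (L / lam ^ 2) ^ 2 * ‖P.LL x y‖ ^ 2 + ‖y 0‖ ^ 2 := by
    have c1 : Continuous (fun y : HH => ‖y‖ ^ 2) := by fun_prop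
    have c2 : Continuous (fun y : HH => 2 * (L / lam ^ 2) ^ 2 * ‖P.LL x y‖ ^ 2 + ‖cd 0 y‖ ^ 2) := by fun_prop
    refine le_of_tendsto_of_tendsto' ((c1.tendsto y).comp hs) ((c2.tendsto y).comp hs) (fun s => ?_)
    refine P.le2_fin hr hl he hL ?_
    apply summable_of_ne_finset_zero (s := s)
    intro n hn
    rw [lp.coeFn_sum, Finset.sum_apply, Finset.sum_eq_zero, norm_zero]
    intro i hi
    rw [lp.single_apply_ne]
    rintro rfl; exact hn hi
  have hL0 : 0 < L := lt_of_lt_of_le hl ((he 0).h1.trans (hL 0).1)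
  have : 0 ≤ L / lam ^ 2 := by positivity
  refine abs_le_of_sq_le_sq' ?_ (by positivity) |>.2
  have h3 : 0 ≤ ‖P.LL x y‖ := norm_nonneg _
  have h4 : 0 ≤ ‖y 0‖ := norm_nonneg _
  have h5 : 0 ≤ (L / lam ^ 2) * ‖P.LL x y‖ := by positivity
  nlinarith [mul_nonneg h5 h4, sq_nonneg ((L / lam ^ 2) * ‖P.LL x y‖)]

/-- the delta at zero -/
noncomputable def D0 : HH →L[ℂ] HH := dg (fun n => if n = 0 then 1 else 0) 1 (fun n => by split_ifs <;> simp)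

lemma D0_apply (x : HH) (n) : D0 x n = (if n = 0 then 1 else 0) * x n := rfl

noncomputable def T (x : HH) : HH →L[ℂ] HH := P.dgA + D0 + TK P.Qk x

lemma T_zero_coord (x v : HH) : P.T x v 0 = v 0 := by
  simp only [T, ContinuousLinearMap.add_apply, lp.coeFn_add, Pi.add_apply, dgA_apply, TK_apply, D0_apply, sA_zero]
  have : ∀ m : Ix, P.Qk.K m (0 - m) * x m * v (0 - m) = 0 := by
    intro m; simp [Qk, sp_anti]
  rw [tsum_congr this]; simp

noncomputable def iw : HH →L[ℂ] HH := dg (fun n => ((w n)⁻¹ : ℝ)) 1 (fun n => by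
  have := w_pos n
  rw [Complex.norm_real, Real.norm_of_nonneg (by positivity)]
  exact inv_le_one_of_one_le₀ (one_le_w n))

lemma iw_apply (x : HH) (n) : iw x n = ((w n)⁻¹ : ℝ) * x n := rfl
lemma iw_le (x : HH) : ‖iw x‖ ≤ ‖x‖ := (dg_norm_le _ 1 _ x).trans_eq (one_mul _)

lemma LL_iw (x v : HH) : P.LL x (iw v) = iw (P.dgA v + TK P.Qk x v) := by
  apply HH_ext; intro n
  simp only [LL, ContinuousLinearMap.add_apply, lp.coeFn_add, Pi.add_apply, dgA_apply, TK_apply, iw_apply]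
  rw [mul_add, ← tsum_mul_left]
  congr 1
  · ring
  · refine tsum_congr (fun m => ?_)
    have := w_ne n
    simp only [Qk, Bk, add_sub_cancel]
    have h : (w n : ℂ) ≠ 0 := by exact_mod_cast this
    push_cast
    field_simp

lemma Q_eq (ε hε) (x v : HH) : TK P.Qk x v = TK P.Bk x v + TK (P.Ck ε hε) x v := by
  apply HH_ext; intro n
  simp only [lp.coeFn_add, Pi.add_apply, TK_apply]
  rw [← (ker_summable _ x v n).tsum_add (ker_summable _ x v n)]
  refine tsum_congr (fun m => ?_)
  have h : (w (n - m) : ℂ) ≠ 0 := by exact_mod_cast (w_ne (n - m))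
  simp only [Qk, Bk, Ck, add_sub_cancel]
  push_cast
  field_simp
  ring

end Par

/-- interpolation -/
lemma l1_interp (δ : ℝ) (hδ : 0 < δ) : ∃ C, 0 ≤ C ∧ ∀ v : HH, l1 v ≤ δ * ‖v‖ + C * ‖Par.iw v‖ := by
  have hs := summable_w.hasSum
  obtain ⟨s, hs⟩ := (tendsto_order.1 (tendsto_tsum_compl_atTop_zero (fun n : Ix => (w n)⁻¹ ^ 2))).2 (δ ^ 2) (by positivity) |>.exists
  refine ⟨s.card, by positivity, fun v => ?_⟩
  have h1 := (l1_summable v).sum_add_tsum_compl (s := s)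
  unfold l1
  rw [← h1]
  have a : ∑ n ∈ s, (w n)⁻¹ * ‖v n‖ ≤ s.card * ‖Par.iw v‖ := by
    rw [← nsmul_eq_mul]
    refine Finset.sum_le_card_nsmul _ _ _ (fun n _ => ?_)
    have := HH_le (Par.iw v) n
    rw [Par.iw_apply, norm_mul, Complex.norm_real, Real.norm_of_nonneg (inv_pos.2 (w_pos n)).le] at this
    exact this
  have b : ∑' n : ((↑s : Set Ix)ᶜ : Set Ix), (w n)⁻¹ * ‖v n‖ ≤ δ * ‖v‖ := by
    let v' : HH := mk2 (fun n => if n ∈ s then 0 else v n) (summable_dom (sqSummable v) (C := 1) (fun n => by split_ifs <;> simp))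
    have e : ∑' n : ((↑s : Set Ix)ᶜ : Set Ix), (w n)⁻¹ * ‖v n‖ = ∑' n : Ix, (if n ∈ s then 0 else (w n)⁻¹) * ‖v n‖ := by
      rw [tsum_subtype ((↑s : Set Ix)ᶜ) (fun n => (w n)⁻¹ * ‖v n‖)]
      refine tsum_congr (fun n => ?_)
      by_cases h : n ∈ s <;> simp [h]
    have e2 : ∑' n : ((↑s : Set Ix)ᶜ : Set Ix), (w n)⁻¹ ^ 2 = ∑' n : Ix, (if n ∈ s then 0 else (w n)⁻¹) ^ 2 := by
      rw [tsum_subtype ((↑s : Set Ix)ᶜ) (fun n => (w n)⁻¹ ^ 2)]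
      refine tsum_congr (fun n => ?_)
      by_cases h : n ∈ s <;> simp [h]
    have hsum : Summable (fun n : Ix => (if n ∈ s then 0 else (w n)⁻¹) ^ 2) := by
      refine Summable.of_nonneg_of_le (fun n => by positivity) (fun n => ?_) summable_w
      have := w_pos n
      split_ifs
      · simp; positivity
      · rfl
    have := cs_le hsum (sqSummable v)
    rw [← nsq, Real.sqrt_sq (norm_nonneg _)] at this
    rw [e]
    refine this.trans (mul_le_mul_of_nonneg_right ?_ (norm_nonneg _))
    rw [← e2, Real.sqrt_le_left hδ.le]
    exact hs.le
  linarith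
  
namespace Par
variable (P : Par)

lemma LE4 (lam M : ℝ) (hl : 0 < lam) : ∃ C, 0 < C ∧ ∀ x : HH, Re x → P.Ell lam (pp x) → ‖x‖ ≤ M → ∀ v, ‖v‖ ≤ C * ‖P.T x v‖ := by
  set M' := max M 0 with hM'
  have hM0 : 0 ≤ M' := le_max_right _ _
  set L := P.a + P.b + P.Cs * Sw * M' with hLd
  have c0 := P.Cs_pos
  have s0 := Sw_nonneg
  have hL0 : 0 < L := by have := P.ha; have := P.hb; positivity
  set K := 2 * (L / lam ^ 2) with hK
  have hK0 : 0 < K := by positivity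
  obtain ⟨ε, hε, hε2⟩ : ∃ ε : ℝ, 0 < ε ∧ K * (4 * P.Cs ^ 2 * ε * (Sw * M')) ≤ 1 / 4 := by
    refine ⟨1 / (4 * (K * (4 * P.Cs ^ 2 * (Sw * M')) + 1)), by positivity, ?_⟩
    rw [show K * (4 * P.Cs ^ 2 * (1 / (4 * (K * (4 * P.Cs ^ 2 * (Sw * M')) + 1))) * (Sw * M')) =
      (K * (4 * P.Cs ^ 2 * (Sw * M'))) / (4 * (K * (4 * P.Cs ^ 2 * (Sw * M')) + 1)) by ring]
    rw [div_le_iff₀ (by positivity)]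
    linarith
  set R := K * (4 * P.Cs ^ 2 * (1 + ε⁻¹) * M') with hR
  have hR0 : 0 ≤ R := by positivity
  obtain ⟨C1, hC1, hintg⟩ := l1_interp (1 / (4 * (R + 1))) (by positivity)
  refine ⟨2 * ((K + 1) * 2 + R * C1 * (K * 2 + 1)), by positivity, fun x hr he hM v => ?_⟩
  have hM2 : ‖x‖ ≤ M' := hM.trans (le_max_left _ _)
  have hU := P.Upp_of hM2
  set N := ‖P.T x v‖ with hN
  have hv0 : ‖v 0‖ ≤ N := by rw [← P.T_zero_coord x v]; exact HH_le _ _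
  have hD : ‖D0 v‖ ≤ N := by
    have : ‖D0 v‖ ≤ ‖P.T x v‖ := norm_le_of_le (fun n => by
      rw [D0_apply]
      by_cases h : n = 0
      · subst h; simp [T_zero_coord]
      · simp [h])
    exact this
  have hS : ‖P.dgA v + TK P.Qk x v‖ ≤ 2 * N := by
    have : P.dgA v + TK P.Qk x v = P.T x v - D0 v := by
      simp only [T, ContinuousLinearMap.add_apply]; abel
    rw [this]
    refine (norm_sub_le _ _).trans (by linarith)
  have h1 := P.LE2H hr hl he hU (iw v)
  rw [LL_iw] at h1
  have h1' := iw_le (P.dgA v + TK P.Qk x v)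
  have h10 : ‖iw v 0‖ ≤ N := by rw [iw_apply, w_zero]; simpa using hv0
  have h1f : ‖iw v‖ ≤ (K * 2 + 1) * N := by
    have := mul_le_mul_of_nonneg_left (h1'.trans hS) hK0.le
    linarith
  have h2 := P.LE2H hr hl he hU v
  have h3 : P.LL x v = (P.dgA v + TK P.Qk x v) - TK (P.Ck ε hε) x v := by
    rw [P.Q_eq ε hε]; simp only [LL, ContinuousLinearMap.add_apply]; abel
  have h4 := TK_norm (P.Ck ε hε) x v
  have h5 : ‖P.LL x v‖ ≤ 2 * N + (4 * P.Cs ^ 2 * ε * l1 x * ‖v‖ + 4 * P.Cs ^ 2 * (1 + ε⁻¹) * ‖x‖ * l1 v) := by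
    rw [h3]; exact (norm_sub_le _ _).trans (add_le_add hS h4)
  have h6 : 4 * P.Cs ^ 2 * ε * l1 x * ‖v‖ ≤ 4 * P.Cs ^ 2 * ε * (Sw * M') * ‖v‖ := by
    have := (l1_le x).trans (mul_le_mul_of_nonneg_left hM2 s0)
    gcongr
  have h7 : 4 * P.Cs ^ 2 * (1 + ε⁻¹) * ‖x‖ * l1 v ≤ 4 * P.Cs ^ 2 * (1 + ε⁻¹) * M' * l1 v := by
    have := l1_nonneg v
    gcongr
  have h8 : K * ‖P.LL x v‖ ≤ K * (2 * N) + 1 / 4 * ‖v‖ + R * l1 v := by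
    have a1 := mul_le_mul_of_nonneg_left (h5.trans (by linarith : _ ≤ 2 * N + (4 * P.Cs ^ 2 * ε * (Sw * M') * ‖v‖ + 4 * P.Cs ^ 2 * (1 + ε⁻¹) * M' * l1 v))) hK0.le
    have a2 := mul_le_mul_of_nonneg_right hε2 (norm_nonneg v)
    rw [hR]; linarith
  have h9 : R * l1 v ≤ 1 / 4 * ‖v‖ + R * C1 * ((K * 2 + 1) * N) := by
    have a1 := mul_le_mul_of_nonneg_left (hintg v) hR0
    have a2 := mul_le_mul_of_nonneg_left h1f (mul_nonneg hR0 hC1)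
    have a3 : R * (1 / (4 * (R + 1)) * ‖v‖) ≤ 1 / 4 * ‖v‖ := by
      rw [← mul_assoc]
      refine mul_le_mul_of_nonneg_right ?_ (norm_nonneg _)
      rw [mul_one_div, div_le_iff₀ (by positivity)]
      linarith
    linarith
  rw [← hLd, ← hK] at h2
  have hN0 : 0 ≤ N := norm_nonneg _
  linarith

noncomputable def lamA : ℝ := (P.a * P.b - P.c ^ 2) / (P.a + P.b)

lemma lamA_pos : 0 < P.lamA := by
  have := P.ha; have := P.hb; have := P.hd; unfold lamA; positivity

lemma lowA : Low P.lamA P.a P.c P.b := by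
  have := P.ha; have := P.hb; have := P.hd
  unfold lamA
  apply low_of
  · rw [div_le_iff₀ (by positivity)]; nlinarith [sq_nonneg P.c]
  · rw [div_le_iff₀ (by positivity)]; nlinarith [sq_nonneg P.c]
  · set D := P.a * P.b - P.c ^ 2
    have h : P.c ^ 2 = P.a * P.b - D := by simp [D]
    rw [h]
    have : (P.a - D / (P.a + P.b)) * (P.b - D / (P.a + P.b)) = P.a * P.b - D + (D / (P.a + P.b)) ^ 2 := by
      field_simp; ring
    rw [this]; nlinarith [sq_nonneg (D / (P.a + P.b))]

lemma Low.mono {lam lam' A B C : ℝ} (h : Low lam A B C) (hl : lam' ≤ lam) : Low lam' A B C := by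
  intro s t
  have := h s t
  nlinarith [mul_le_mul_of_nonneg_right hl (show 0 ≤ s ^ 2 + t ^ 2 by positivity)]

lemma U_smul (x : HH) (τ : ℝ) (z) : P.U11 (pp ((τ : ℂ) • x : HH)) z = (1 - τ) * P.a + τ * P.U11 (pp x) z ∧
    P.U12 (pp ((τ : ℂ) • x : HH)) z = (1 - τ) * P.c + τ * P.U12 (pp x) z ∧
    P.U22 (pp ((τ : ℂ) • x : HH)) z = (1 - τ) * P.b + τ * P.U22 (pp x) z := by
  have key : ∀ φ : Ix → ℂ, (ev (fun n => φ n * pp ((τ : ℂ) • x : HH) n) z).re = τ * (ev (fun n => φ n * pp x n) z).re := by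
    intro φ
    have : (fun n => φ n * pp ((τ : ℂ) • x : HH) n) = fun n => (τ : ℂ) * (φ n * pp x n) := by
      funext n; unfold pp; rw [lp.coeFn_smul, Pi.smul_apply, smul_eq_mul]; ring
    rw [this, ev_smul, Complex.re_ofReal_mul]
  unfold U11 U12 U22
  rw [key, key, key]
  refine ⟨by ring, by ring, by ring⟩

lemma Ell_smul {x : HH} {lam : ℝ} (he : P.Ell lam (pp x)) {τ : ℝ} (h0 : 0 ≤ τ) (h1 : τ ≤ 1) :
    P.Ell (min lam P.lamA) (pp ((τ : ℂ) • x : HH)) := by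
  intro z s t
  obtain ⟨e1, e2, e3⟩ := P.U_smul x τ z
  rw [e1, e2, e3]
  have k1 := (Low.mono (he z) (min_le_left lam P.lamA)) s t
  have k2 := (Low.mono P.lowA (min_le_right lam P.lamA)) s t
  have := mul_le_mul_of_nonneg_left k1 h0
  have := mul_le_mul_of_nonneg_left k2 (sub_nonneg.2 h1)
  linarith

lemma Re_smul {x : HH} (h : Re x) (τ : ℝ) : Re ((τ : ℂ) • x : HH) := by
  intro n; rw [lp.coeFn_smul, Pi.smul_apply, Pi.smul_apply, h n]; simp

lemma unit_zero : IsUnit (P.T 0) := by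
  have hA := P.lamA_pos
  have h0 : ∀ n, P.sA n * ((w n)⁻¹ : ℝ) + (if n = 0 then 1 else 0) ≠ 0 ∧
      ‖(P.sA n * ((w n)⁻¹ : ℝ) + (if n = 0 then 1 else 0))⁻¹‖ ≤ P.lamA⁻¹ + 1 := by
    intro n
    by_cases h : n = 0
    · subst h; simp [sA_zero]; positivity
    · have := P.sA_lower h
      have w0 := w_pos n
      have hn : P.lamA ≤ ‖P.sA n * ((w n)⁻¹ : ℝ)‖ := by
        rw [norm_mul, Complex.norm_real, Real.norm_of_nonneg (inv_pos.2 w0).le, ← div_eq_mul_inv, le_div_iff₀ w0]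
        exact this
      simp only [h, if_false, add_zero]
      refine ⟨norm_pos_iff.1 (hA.trans_le hn), ?_⟩
      rw [norm_inv]
      have := inv_anti₀ hA hn
      linarith
  let S : HH →L[ℂ] HH := dg (fun n => (P.sA n * ((w n)⁻¹ : ℝ) + (if n = 0 then 1 else 0))⁻¹) (P.lamA⁻¹ + 1) (fun n => (h0 n).2)
  have e : ∀ v n, P.T 0 v n = (P.sA n * ((w n)⁻¹ : ℝ) + (if n = 0 then 1 else 0)) * v n := by
    intro v n
    simp only [T, map_zero, add_zero, ContinuousLinearMap.add_apply, lp.coeFn_add, Pi.add_apply, dgA_apply, D0_apply]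
    ring
  refine ⟨⟨P.T 0, S, ?_, ?_⟩, rfl⟩
  · ext1 v; apply HH_ext; intro n
    rw [ContinuousLinearMap.mul_apply, e, ContinuousLinearMap.one_apply]
    simp only [S, dg_apply]
    rw [mul_inv_cancel_left₀ (h0 n).1]
  · ext1 v; apply HH_ext; intro n
    rw [ContinuousLinearMap.mul_apply, ContinuousLinearMap.one_apply]
    simp only [S, dg_apply]
    rw [e, inv_mul_cancel_left₀ (h0 n).1]

lemma unit_step {A B : HH →L[ℂ] HH} {C : ℝ} (hC : 0 < C) (hA : IsUnit A) (h : ∀ v, ‖v‖ ≤ C * ‖A v‖) (hB : ‖B - A‖ < C⁻¹) : IsUnit B := by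
  obtain ⟨u, rfl⟩ := hA
  have hu : ‖(↑u⁻¹ : HH →L[ℂ] HH)‖ ≤ C := by
    refine ContinuousLinearMap.opNorm_le_bound _ hC.le (fun v => ?_)
    have := h ((↑u⁻¹ : HH →L[ℂ] HH) v)
    rwa [← ContinuousLinearMap.mul_apply, Units.mul_inv, ContinuousLinearMap.one_apply] at this
  by_cases h0 : (↑u⁻¹ : HH →L[ℂ] HH) = 0
  · have := u.inv_mul
    rw [h0, zero_mul] at this
    have e : ∀ D : HH →L[ℂ] HH, D = 1 := fun D => by rw [← mul_one D, ← this, mul_zero]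
    rw [e B]; exact isUnit_one
  · have hp : 0 < ‖(↑u⁻¹ : HH →L[ℂ] HH)‖ := norm_pos_iff.2 h0
    exact ⟨Units.ofNearby u B (hB.trans_le (inv_anti₀ hp hu)), rfl⟩

lemma T_unit {x : HH} (hr : Re x) {lam : ℝ} (hl : 0 < lam) (he : P.Ell lam (pp x)) : IsUnit (P.T x) := by
  obtain ⟨C, hC, h⟩ := P.LE4 (min lam P.lamA) ‖x‖ (lt_min hl P.lamA_pos)
  obtain ⟨N, hN⟩ := exists_nat_gt (C * ‖TK P.Qk x‖)
  have hN0 : (0 : ℝ) < N := lt_of_le_of_lt (by positivity) hN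
  have key : ∀ k : ℕ, k ≤ N → IsUnit (P.T (((k / N : ℝ) : ℂ) • x)) := by
    intro k
    induction k with
    | zero => intro _; simpa using P.unit_zero
    | succ k ih =>
      intro hk
      have hk' : (k : ℝ) ≤ N := by exact_mod_cast (Nat.le_of_succ_le hk)
      have t0 : (0 : ℝ) ≤ k / N := by positivity
      have t1 : (k / N : ℝ) ≤ 1 := by rw [div_le_one hN0]; exact hk'
      refine unit_step hC (ih (Nat.le_of_succ_le hk)) (h _ (Re_smul hr _) (P.Ell_smul he t0 t1) ?_) ?_
      · rw [norm_smul, Complex.norm_real, Real.norm_of_nonneg t0]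
        exact mul_le_of_le_one_left (norm_nonneg _) t1
      · have : P.T ((((k + 1 : ℕ) / N : ℝ) : ℂ) • x) - P.T (((k / N : ℝ) : ℂ) • x) = ((1 / N : ℝ) : ℂ) • TK P.Qk x := by
          simp only [T]
          rw [add_sub_add_left_eq_sub, map_smul, map_smul, ← sub_smul]
          congr 1
          push_cast; ring
        rw [this, norm_smul, Complex.norm_real, Real.norm_of_nonneg (by positivity), one_div, ← div_eq_inv_mul, div_lt_iff₀ hN0,
          ← div_eq_inv_mul, lt_div_iff₀ hC]
        linarith
  have := key N le_rfl
  rw [div_self hN0.ne'] at this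
  simpa using this

end Par
end GMA

namespace GMA

/-! ### Part F : openness and regularity -/

namespace Par
variable (P : Par)

lemma Qk_comm (m k) : P.Qk.K m k = P.Qk.K k m := by
  simp only [Qk]; rw [sp_comm, add_comm m k]; push_cast; ring

lemma Q_comm (x y : HH) : TK P.Qk x y = TK P.Qk y x := by
  apply HH_ext; intro n
  rw [TK_apply, TK_apply, ← (Equiv.subLeft n).tsum_eq]
  refine tsum_congr (fun m => ?_)
  simp only [Equiv.subLeft_apply, sub_sub_cancel]
  rw [Qk_comm]; ring

noncomputable def G (x : HH) : HH := P.dgA x + D0 x + (2⁻¹ : ℂ) • TK P.Qk x x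

lemma G_contDiff {n : WithTop ℕ∞} : ContDiff ℂ n P.G := by
  unfold G
  have : ContDiff ℂ n (fun x : HH => TK P.Qk x x) := by fun_prop
  fun_prop

lemma G_fderiv (x : HH) : HasFDerivAt P.G (P.T x) x := by
  have h1 : HasFDerivAt (fun x : HH => TK P.Qk x x) (TK P.Qk x + (TK P.Qk).flip x) x := by
    have := (TK P.Qk).hasFDerivAt.clm_apply (hasFDerivAt_id x)
    rw [ContinuousLinearMap.comp_id] at this
    exact this
  have h2 : HasFDerivAt P.G (P.dgA + D0 + (2⁻¹ : ℂ) • (TK P.Qk x + (TK P.Qk).flip x)) x :=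
    (P.dgA.hasFDerivAt.add D0.hasFDerivAt).add (h1.const_smul (2⁻¹ : ℂ))
  convert h2 using 1
  have : (TK P.Qk).flip x = TK P.Qk x := by
    ext1 v; rw [ContinuousLinearMap.flip_apply, Q_comm]
  rw [this, ← two_smul ℂ (TK P.Qk x), smul_smul]
  simp [T]

lemma Qk_neg (m k) : P.Qk.K (-m) (-k) = (starRingEnd ℂ) (P.Qk.K m k) := by
  simp only [Qk, map_mul, Complex.conj_ofReal, w_neg, sp_neg]
  rw [← neg_add, w_neg]

lemma G_rc (x : HH) : P.G (rc x) = rc (P.G x) := by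
  unfold G
  rw [TK_rc P.Qk P.Qk_neg]
  apply HH_ext; intro n
  simp only [lp.coeFn_add, Pi.add_apply, dgA_apply, D0_apply, rc_apply, lp.coeFn_smul, Pi.smul_apply, smul_eq_mul, map_add, map_mul,
    map_inv₀, Complex.conj_ofNat, Complex.conj_ofReal, w_neg, sA_neg, neg_eq_zero]
  congr 2
  · simp
  · split_ifs <;> simp

lemma G_tr (x : HH) (z) : P.G (tr z x) = tr z (P.G x) := by
  unfold G
  rw [TK_tr, map_add, map_add, map_smul]
  congr 2
  · apply HH_ext; intro n; simp only [dgA_apply, tr_apply]; ring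
  · apply HH_ext; intro n; simp only [D0_apply, tr_apply]; ring

lemma Ell_near {x x' : HH} {lam : ℝ} (he : P.Ell lam (pp x)) : P.Ell (lam - 4 * P.Cs * Sw * ‖x' - x‖) (pp x') := by
  intro z s t
  have c0 := P.Cs_pos
  have key : ∀ φ : Ix → ℂ, (∀ n, ‖φ n‖ ≤ P.Cs * w n) → |(ev (fun n => φ n * pp x' n) z).re - (ev (fun n => φ n * pp x n) z).re| ≤ P.Cs * Sw * ‖x' - x‖ := by
    intro φ h
    have := ev_pp_le c0.le h (x' - x) z
    have e : (fun n => φ n * pp (x' - x : HH) n) = fun n => φ n * pp x' n - φ n * pp x n := by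
      funext n; unfold pp; rw [lp.coeFn_sub, Pi.sub_apply]; ring
    rw [e, ev_sub ((pp_W2 x').mul h) ((pp_W2 x).mul h)] at this
    rw [← Complex.sub_re]
    exact (Complex.abs_re_le_norm _).trans this
  have k1 := abs_le.1 (key _ P.s11_le)
  have k2 := abs_le.1 (key _ P.s12_le)
  have k3 := abs_le.1 (key _ P.s22_le)
  have h := he z s t
  set δ := P.Cs * Sw * ‖x' - x‖
  have hδ : 4 * P.Cs * Sw * ‖x' - x‖ = 4 * δ := by simp only [δ]; ring
  rw [hδ]
  have d0 : 0 ≤ δ := by have := Sw_nonneg; positivity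
  unfold U11 U12 U22 at h ⊢
  set A := (ev (fun n => P.s11 n * pp x n) z).re
  set A' := (ev (fun n => P.s11 n * pp x' n) z).re
  set B := (ev (fun n => P.s12 n * pp x n) z).re
  set B' := (ev (fun n => P.s12 n * pp x' n) z).re
  set C := (ev (fun n => P.s22 n * pp x n) z).re
  set C' := (ev (fun n => P.s22 n * pp x' n) z).re
  have a1 := mul_le_mul_of_nonneg_right k1.1 (sq_nonneg s)
  have a3 := mul_le_mul_of_nonneg_right k3.1 (sq_nonneg t)
  have a2 : - (δ * (s ^ 2 + t ^ 2)) ≤ 2 * (B' - B) * s * t := by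
    have b1 := mul_nonneg (sub_nonneg.2 k2.2) (sq_nonneg (s - t))
    have b2 := mul_nonneg (sub_nonneg.2 k2.1) (sq_nonneg (s + t))
    nlinarith
  nlinarith [mul_nonneg d0 (sq_nonneg s), mul_nonneg d0 (sq_nonneg t)]

/-- local homeomorphism -/
lemma local_inv {x : HH} (hr : Re x) {lam : ℝ} (hl : 0 < lam) (he : P.Ell lam (pp x)) :
    ∃ e : OpenPartialHomeomorph HH HH, x ∈ e.source ∧ (∀ v, e v = P.G v) ∧ ContDiffAt ℂ (⊤ : ℕ∞) e.symm (P.G x) := by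
  obtain ⟨u, hu⟩ := P.T_unit hr hl he
  let f' : HH ≃L[ℂ] HH := ContinuousLinearEquiv.ofUnit u
  have hf' : (f' : HH →L[ℂ] HH) = P.T x := by rw [← hu]; rfl
  have hd : HasFDerivAt P.G (f' : HH →L[ℂ] HH) x := by rw [hf']; exact P.G_fderiv x
  have hc : ContDiffAt ℂ (⊤ : ℕ∞) P.G x := P.G_contDiff.contDiffAt
  refine ⟨hc.toOpenPartialHomeomorph P.G hd (by simp), hc.mem_toOpenPartialHomeomorph_source hd (by simp), fun v => rfl, ?_⟩
  exact hc.to_localInverse hd (by simp)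

lemma openness {x : HH} (hr : Re x) {lam : ℝ} (hl : 0 < lam) (he : P.Ell lam (pp x)) :
    ∀ᶠ y : HH in nhds (P.G x), Re y → ∃ x' : HH, Re x' ∧ P.G x' = y ∧ P.Ell (lam / 2) (pp x') := by
  obtain ⟨e, hx, hG, -⟩ := P.local_inv hr hl he
  have hy : P.G x ∈ e.target := by rw [← hG]; exact e.map_source hx
  have hinv : e.symm (P.G x) = x := by rw [← hG]; exact e.left_inv hx
  have hc : Filter.Tendsto e.symm (nhds (P.G x)) (nhds x) := by
    have := e.symm.continuousAt (x := P.G x) hy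
    rwa [ContinuousAt, hinv] at this
  have ev1 : ∀ᶠ y in nhds (P.G x), y ∈ e.target := e.open_target.mem_nhds hy
  have ev2 : ∀ᶠ y in nhds (P.G x), rc (e.symm y) ∈ e.source := by
    have : Filter.Tendsto (fun y => rc (e.symm y)) (nhds (P.G x)) (nhds (rc x)) := (rc_cont.tendsto x).comp hc
    rw [(rc_eq_iff x).2 hr] at this
    exact this.eventually (e.open_source.mem_nhds hx)
  have ev3 : ∀ᶠ y in nhds (P.G x), 4 * P.Cs * Sw * ‖e.symm y - x‖ < lam / 2 := by
    have c : Continuous (fun v : HH => 4 * P.Cs * Sw * ‖v - x‖) := by fun_prop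
    have := (c.tendsto x).comp hc
    simp only [sub_self, norm_zero, mul_zero] at this
    exact this.eventually (gt_mem_nhds (by linarith))
  filter_upwards [ev1, ev2, ev3] with y h1 h2 h3 hy
  have hGy : P.G (e.symm y) = y := by rw [← hG]; exact e.right_inv h1
  refine ⟨e.symm y, ?_, hGy, ?_⟩
  · rw [← rc_eq_iff]
    apply e.injOn h2 (e.map_target h1)
    rw [hG, hG, G_rc, hGy]
    exact (rc_eq_iff y).2 hy
  · intro z
    exact Low.mono (P.Ell_near he z) (by linarith)

end Par

/-- directional multiplier -/
noncomputable def dE (e : ℝ × ℝ) (n : Ix) : ℂ := e.1 * d1 n + e.2 * d2 n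

lemma dE_eq (e n) : dE e n = ((2 * Real.pi * (n.1 * e.1 + n.2 * e.2) : ℝ) : ℂ) * Complex.I := by
  simp only [dE, d1, d2]; push_cast; ring

lemma ex_line (n) (s : ℝ) (e : ℝ × ℝ) : ex n (s • e) = Complex.exp (s * dE e n) := by
  rw [dE_eq]; unfold ex; congr 1; simp; ring

lemma dE_le (e n) : ‖dE e n‖ ≤ ((|e.1| + |e.2|) * (2 * Real.pi)) * w n ^ 1 := by
  unfold dE
  refine (norm_add_le _ _).trans ?_
  rw [norm_mul, norm_mul, Complex.norm_real, Complex.norm_real, Real.norm_eq_abs, Real.norm_eq_abs]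
  have a := mul_le_mul_of_nonneg_left (d1_le n) (abs_nonneg e.1)
  have b := mul_le_mul_of_nonneg_left (d2_le n) (abs_nonneg e.2)
  linarith

lemma exp_bound (t : ℝ) : ‖Complex.exp (t * Complex.I) - 1 - t * Complex.I‖ ≤ 2 * t ^ 2 := by
  by_cases h : |t| ≤ 1
  · have := Complex.norm_exp_sub_one_sub_id_le (x := t * Complex.I) (by simpa using h)
    refine this.trans ?_
    simp; nlinarith [sq_nonneg t]
  · push Not at h
    have h1 := Real.norm_exp_I_mul_ofReal_sub_one_le (x := t)
    rw [mul_comm] at h1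
    refine (norm_sub_le _ _).trans ?_
    simp only [norm_mul, Complex.norm_I, mul_one, Complex.norm_real, Real.norm_eq_abs] at *
    rw [← sq_abs]
    nlinarith

noncomputable def Rapid.toHH {y : Ix → ℂ} (hy : Rapid y) : HH := mk2 y hy.Sm.sq

lemma Rapid.dE {y : Ix → ℂ} (hy : Rapid y) (e) : Rapid (fun n => dE e n * y n) := hy.mul (dE_le e)

lemma tr_hasDeriv {y : Ix → ℂ} (hy : Rapid y) (e : ℝ × ℝ) (s : ℝ) :
    HasDerivAt (fun s : ℝ => tr (s • e) hy.toHH) (tr (s • e) (hy.dE e).toHH) s := by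
  rw [hasDerivAt_iff_isLittleO_nhds_zero]
  have hb : ∀ h : ℝ, ‖tr ((s + h) • e) hy.toHH - tr (s • e) hy.toHH - h • tr (s • e) (hy.dE e).toHH‖ ≤
      2 * h ^ 2 * ‖((hy.dE e).dE e).toHH‖ := by
    intro h
    refine norm_le_mul_of_le (by positivity) (fun n => ?_)
    have e1 : (tr ((s + h) • e) hy.toHH - tr (s • e) hy.toHH - h • tr (s • e) (hy.dE e).toHH : HH) n =
       ex n (s • e) * ((Complex.exp (h * GMA.dE e n) - 1 - h * GMA.dE e n) * y n) := by
      rw [lp.coeFn_sub, lp.coeFn_sub, lp.coeFn_smul, Pi.sub_apply, Pi.sub_apply, Pi.smul_apply, tr_apply, tr_apply, tr_apply, add_smul, ex_add_right, ex_line n h]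
      simp only [Rapid.toHH, mk2_apply, Complex.real_smul]
      ring
    rw [e1, norm_mul, ex_norm, one_mul, norm_mul]
    simp only [Rapid.toHH, mk2_apply, norm_mul]
    rw [← mul_assoc, ← mul_assoc]
    refine mul_le_mul_of_nonneg_right ?_ (norm_nonneg _)
    rw [dE_eq]
    set θ : ℝ := 2 * Real.pi * (n.1 * e.1 + n.2 * e.2)
    have := exp_bound (h * θ)
    push_cast at this
    simp only [← mul_assoc] at this ⊢
    refine this.trans ?_
    simp only [norm_mul, Complex.norm_I, mul_one, Complex.norm_real, Real.norm_eq_abs]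
    rw [mul_assoc (2 * h ^ 2), abs_mul_abs_self]
    nlinarith
  rw [Asymptotics.isLittleO_iff]
  intro c hc
  set N := ‖((hy.dE e).dE e).toHH‖
  have : ∀ᶠ h : ℝ in nhds 0, 2 * |h| * N < c := by
    have k : Continuous (fun h : ℝ => 2 * |h| * N) := by fun_prop
    have := k.tendsto 0
    simp only [abs_zero, mul_zero, zero_mul] at this
    exact this.eventually (gt_mem_nhds hc)
  filter_upwards [this] with h hh
  refine (hb h).trans ?_
  rw [Real.norm_eq_abs, ← sq_abs]
  nlinarith [mul_le_mul_of_nonneg_right hh.le (abs_nonneg h)]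

lemma tr_contDiff {y : Ix → ℂ} (hy : Rapid y) (e : ℝ × ℝ) (k : ℕ) : ContDiff ℝ k (fun s : ℝ => tr (s • e) hy.toHH) := by
  induction k generalizing y with
  | zero =>
    rw [Nat.cast_zero, contDiff_zero]
    exact continuous_iff_continuousAt.2 (fun s => (tr_hasDeriv hy e s).continuousAt)
  | succ k ih =>
    rw [Nat.cast_succ, contDiff_succ_iff_deriv]
    refine ⟨fun s => (tr_hasDeriv hy e s).differentiableAt, by simp, ?_⟩
    rw [show deriv (fun s : ℝ => tr (s • e) hy.toHH) = _ from funext (fun s => (tr_hasDeriv hy e s).deriv)]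
    exact ih (hy.dE e)


lemma tr_cont (x : HH) : Continuous (fun z => tr z x) := by
  rw [continuous_iff_continuousAt]
  intro z
  rw [ContinuousAt, tendsto_iff_norm_sub_tendsto_zero]
  have : Filter.Tendsto (fun z' => ∑' n, ‖(ex n z' - ex n z) * x n‖ ^ 2) (nhds z) (nhds (∑' n : Ix, (0 : ℝ))) := by
    refine tendsto_tsum_of_dominated_convergence (bound := fun n => 4 * ‖x n‖ ^ 2) ((sqSummable x).mul_left 4) (fun n => ?_) (Filter.Eventually.of_forall (fun z' n => ?_))
    · have c : Continuous (fun z' => ‖(ex n z' - ex n z) * x n‖ ^ 2) := by have := ex_cont n; fun_prop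
      have := c.tendsto z
      simpa using this
    · rw [norm_mul, Real.norm_of_nonneg (by positivity), mul_pow]
      have := norm_sub_le (ex n z') (ex n z)
      rw [ex_norm, ex_norm] at this
      have h0 := norm_nonneg (ex n z' - ex n z)
      have : ‖ex n z' - ex n z‖ ^ 2 ≤ 4 := by nlinarith
      exact mul_le_mul_of_nonneg_right this (by positivity)
  rw [tsum_zero] at this
  have h2 := this.sqrt
  rw [Real.sqrt_zero] at h2
  refine h2.congr (fun z' => ?_)
  rw [← Real.sqrt_sq (norm_nonneg (tr z' x - tr z x)), nsq]
  congr 1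
  refine tsum_congr (fun n => ?_)
  rw [lp.coeFn_sub, Pi.sub_apply, tr_apply, tr_apply, sub_mul]

lemma cd_iter (x : HH) (e : ℝ × ℝ) (n : Ix) (k : ℕ) :
    iteratedDeriv k (fun s : ℝ => tr (s • e) x n) = fun s => dE e n ^ k * (tr (s • e) x n) := by
  induction k with
  | zero => simp
  | succ k ih =>
    rw [iteratedDeriv_succ, ih]
    funext s
    simp only [tr_apply, ex_line]
    have : HasDerivAt (fun s : ℝ => Complex.exp (s * dE e n)) (Complex.exp (s * dE e n) * (1 * dE e n)) s :=
      ((Complex.ofRealCLM.hasDerivAt (x := s)).mul_const (dE e n)).cexp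
    have := ((this.mul_const (x n)).const_mul (dE e n ^ k)).deriv
    rw [this]; ring

lemma coord_bound (x : HH) (e : ℝ × ℝ) (h : ContDiffAt ℝ (⊤ : ℕ∞) (fun s : ℝ => tr (s • e) x) 0) (k : ℕ) :
    ∃ C, ∀ n, ‖dE e n‖ ^ k * ‖x n‖ ≤ C := by
  refine ⟨‖iteratedFDeriv ℝ k (fun s : ℝ => tr (s • e) x) 0‖, fun n => ?_⟩
  have h1 := ((cd n).restrictScalars ℝ).iteratedFDeriv_comp_left h (i := k) (by exact_mod_cast le_top)
  have h2 : ‖iteratedFDeriv ℝ k (fun s : ℝ => tr (s • e) x n) 0‖ = ‖dE e n‖ ^ k * ‖x n‖ := by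
    rw [norm_iteratedFDeriv_eq_norm_iteratedDeriv, cd_iter]
    simp [tr_apply, ex_zero_right]
  rw [← h2]
  have h3 : iteratedFDeriv ℝ k (fun s : ℝ => tr (s • e) x n) 0 = iteratedFDeriv ℝ k (((cd n).restrictScalars ℝ) ∘ fun s : ℝ => tr (s • e) x) 0 := rfl
  rw [h3, h1]
  refine ContinuousMultilinearMap.opNorm_le_bound (norm_nonneg _) (fun m => ?_)
  exact (HH_le _ n).trans (ContinuousMultilinearMap.le_opNorm _ _)

namespace Par
variable (P : Par)

lemma regularity {x : HH} (hr : Re x) {lam : ℝ} (hl : 0 < lam) (he : P.Ell lam (pp x)) (hy : Rapid (P.G x)) : Rapid x := by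
  have key : ∀ e : ℝ × ℝ, ContDiffAt ℝ (⊤ : ℕ∞) (fun s : ℝ => tr (s • e) x) 0 := by
    intro e
    obtain ⟨φ, hx, hG, hc⟩ := P.local_inv hr hl he
    have hc' : ContDiffAt ℝ (⊤ : ℕ∞) φ.symm (P.G x) := hc.restrict_scalars ℝ
    have hYeq : hy.toHH = P.G x := HH_ext (fun n => rfl)
    have hY : ContDiff ℝ (⊤ : ℕ∞) (fun s : ℝ => tr (s • e) (P.G x)) := by
      rw [contDiff_infty]; intro k; rw [← hYeq]; exact tr_contDiff hy e k
    have t0 : ∀ x : HH, tr ((0 : ℝ) • e) x = x := fun x => HH_ext (fun n => by simp [tr_apply, ex_zero_right])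
    have hcomp : ContDiffAt ℝ (⊤ : ℕ∞) (fun s : ℝ => φ.symm (tr (s • e) (P.G x))) 0 := by
      refine ContDiffAt.comp (0 : ℝ) (g := φ.symm) ?_ hY.contDiffAt
      rw [t0]; exact hc'
    refine hcomp.congr_of_eventuallyEq ?_
    have hcont : Continuous (fun s : ℝ => tr (s • e) x) := (tr_cont x).comp (by fun_prop)
    have hm : ∀ᶠ s : ℝ in nhds 0, tr (s • e) x ∈ φ.source := by
      have := hcont.tendsto 0
      rw [t0] at this
      exact this.eventually (φ.open_source.mem_nhds hx)
    filter_upwards [hm] with s hs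
    rw [← G_tr, ← hG, φ.left_inv hs]
  refine rapid_of (fun k => ?_) (fun k => ?_)
  · simpa [dE] using coord_bound x (1, 0) (key _) k
  · simpa [dE] using coord_bound x (0, 1) (key _) k

end Par
end GMA

namespace GMA

/-! ### Part G : a priori estimates of first and second order -/

noncomputable def D (e : ℝ × ℝ) (a : Ix → ℂ) (n : Ix) : ℂ := dE e n * a n
noncomputable def R (a : Ix → ℂ) (z : ℝ × ℝ) : ℝ := (ev a z).re

lemma dE_neg (e n) : dE e (-n) = (starRingEnd ℂ) (dE e n) := by
  simp [dE, d1_neg, d2_neg]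

lemma Rapid.D {a : Ix → ℂ} (ha : Rapid a) (e) : Rapid (D e a) := ha.mul (dE_le e)
lemma Re.D {a : Ix → ℂ} (ha : Re a) (e) : Re (D e a) := Re.mul (dE_neg e) ha

lemma Rapid.W2 {a : Ix → ℂ} (ha : Rapid a) : W2 a :=
  (ha.mul (φ := fun n => (w n : ℂ)) (C := 1) (j := 1) (fun n => by simp [abs_of_pos (w_pos n)])).Sm

lemma D_add_dir (e e' : ℝ × ℝ) (a : Ix → ℂ) (s t : ℝ) (n) : D (s • e + t • e') a n = s * D e a n + t * D e' a n := by
  simp [D, dE]; ring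

lemma ev_D {a : Ix → ℂ} (ha : Rapid a) (v : ℝ × ℝ) (z) :
    ev (D v a) z = v.1 * ev (D (1, 0) a) z + v.2 * ev (D (0, 1) a) z := by
  rw [← ev_smul, ← ev_smul, ← ev_add ((ha.D _).Sm.smul _) ((ha.D _).Sm.smul _)]
  congr 1; funext n; simp [D, dE]; ring

lemma R_D {a : Ix → ℂ} (ha : Rapid a) (v : ℝ × ℝ) (z) :
    R (D v a) z = v.1 * R (D (1, 0) a) z + v.2 * R (D (0, 1) a) z := by
  unfold R; rw [ev_D ha]; simp

lemma ev_line {a : Ix → ℂ} (ha : Rapid a) (z v : ℝ × ℝ) (s : ℝ) :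
    HasDerivAt (fun s : ℝ => ev a (z + s • v)) (ev (D v a) (z + s • v)) s := by
  have := hasDerivAt_ev ha z v s
  rw [ev_D ha]
  convert this using 5
  · simp [D, dE]
  · simp [D, dE]

lemma R_line {a : Ix → ℂ} (ha : Rapid a) (z v : ℝ × ℝ) (s : ℝ) :
    HasDerivAt (fun s : ℝ => R a (z + s • v)) (R (D v a) (z + s • v)) s := by
  have := Complex.reCLM.hasFDerivAt.comp_hasDerivAt s (ev_line ha z v s)
  exact this

lemma R_add {a b : Ix → ℂ} (ha : Sm a) (hb : Sm b) (z) : R (fun n => a n + b n) z = R a z + R b z := by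
  unfold R; rw [ev_add ha hb]; simp
lemma R_sub {a b : Ix → ℂ} (ha : Sm a) (hb : Sm b) (z) : R (fun n => a n - b n) z = R a z - R b z := by
  unfold R; rw [ev_sub ha hb]; simp
lemma R_smul (a : Ix → ℂ) (c : ℝ) (z) : R (fun n => c * a n) z = c * R a z := by
  unfold R; rw [ev_smul]; simp

lemma R_per (a : Ix → ℂ) (z : ℝ × ℝ) (k : Ix) : R a (z.1 + k.1, z.2 + k.2) = R a z := by
  unfold R; rw [ev_per]

lemma R_cont {a : Ix → ℂ} (ha : Sm a) : Continuous (R a) := Complex.continuous_re.comp (ev_cont ha)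

lemma exists_rep (z : ℝ × ℝ) : ∃ z' ∈ Set.Icc (0 : ℝ) 1 ×ˢ Set.Icc (0 : ℝ) 1, ∀ a, R a z' = R a z := by
  refine ⟨(Int.fract z.1, Int.fract z.2), ⟨⟨Int.fract_nonneg _, (Int.fract_lt_one _).le⟩, ⟨Int.fract_nonneg _, (Int.fract_lt_one _).le⟩⟩, fun a => ?_⟩
  have := R_per a z (-⌊z.1⌋, -⌊z.2⌋)
  rw [← this]
  congr 1
  ext <;> simp [Int.fract, sub_eq_add_neg]

lemma exists_max {a : Ix → ℂ} (ha : Sm a) : ∃ z0, ∀ z, R a z ≤ R a z0 := by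
  obtain ⟨z0, -, h⟩ := (isCompact_Icc.prod isCompact_Icc : IsCompact (Set.Icc (0 : ℝ) 1 ×ˢ Set.Icc (0 : ℝ) 1)).exists_isMaxOn
    ⟨(0, 0), by simp⟩ (R_cont ha).continuousOn
  refine ⟨z0, fun z => ?_⟩
  obtain ⟨z', hz', e⟩ := exists_rep z
  rw [← e]
  exact h hz'

/-- one dimensional gradient estimate -/
lemma grad1 (q q' q'' : ℝ → ℝ) (h1 : ∀ s, HasDerivAt q (q' s) s) (h2 : ∀ s, HasDerivAt q' (q'' s) s)
    (hper : ∀ s, q (s + 1) = q s) (k α : ℝ) (hα : 0 ≤ α) (h : ∀ s, -α ≤ q'' s - k * q' s) (s : ℝ) :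
    |q' s| ≤ α * Real.exp |k| := by
  set E := Real.exp |k|
  have hE : 0 < E := Real.exp_pos _
  have hc : Continuous q := continuous_iff_continuousAt.2 (fun s => (h1 s).continuousAt)
  let g : ℝ → ℝ := fun τ => q' τ * Real.exp (k * (s - τ)) + α * E * τ
  have hg : ∀ τ, HasDerivAt g ((q'' τ - k * q' τ) * Real.exp (k * (s - τ)) + α * E) τ := by
    intro τ
    have e1 : HasDerivAt (fun τ => Real.exp (k * (s - τ))) (Real.exp (k * (s - τ)) * (k * (-1))) τ :=
      (((hasDerivAt_id τ).const_sub s).const_mul k).exp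
    have := ((h2 τ).mul e1).add ((hasDerivAt_id τ).const_mul (α * E))
    exact HasDerivAt.congr_deriv (f := g) this (by ring)
  have hmono : MonotoneOn g (Set.Icc (s - 1) (s + 1)) := by
    refine monotoneOn_of_deriv_nonneg (convex_Icc _ _) (fun τ _ => (hg τ).continuousAt.continuousWithinAt)
      (fun τ _ => (hg τ).differentiableAt.differentiableWithinAt) (fun τ hτ => ?_)
    rw [interior_Icc] at hτ
    rw [(hg τ).deriv]
    have h3 : Real.exp (k * (s - τ)) ≤ E := by
      apply Real.exp_le_exp.2
      calc k * (s - τ) ≤ |k * (s - τ)| := le_abs_self _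
        _ = |k| * |s - τ| := abs_mul _ _
        _ ≤ |k| * 1 := by
          refine mul_le_mul_of_nonneg_left ?_ (abs_nonneg _)
          rw [abs_le]; constructor <;> linarith [hτ.1, hτ.2]
        _ = |k| := mul_one _
    have h4 := mul_le_mul_of_nonneg_right (h τ) (Real.exp_pos (k * (s - τ))).le
    have h5 := mul_le_mul_of_nonneg_left h3 hα
    linarith
  obtain ⟨s0, hs0, e0⟩ := exists_hasDerivAt_eq_zero (show s - 1 < s by linarith) hc.continuousOn
    (by have := hper (s - 1); simpa using this.symm) (fun x _ => h1 x)
  obtain ⟨s1, hs1, e1⟩ := exists_hasDerivAt_eq_zero (show s < s + 1 by linarith) hc.continuousOn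
    (hper s).symm (fun x _ => h1 x)
  have m0 := hmono ⟨hs0.1.le, by linarith [hs0.2]⟩ ⟨by linarith, by linarith⟩ hs0.2.le
  have m1 := hmono ⟨by linarith, by linarith⟩ ⟨by linarith [hs1.1], hs1.2.le⟩ hs1.1.le
  simp only [g, e0, e1, sub_self, mul_zero, Real.exp_zero, mul_one, zero_mul, zero_add] at m0 m1
  have aE : 0 ≤ α * E := by positivity
  have k0 := hs0.1
  have k1 := hs1.2
  rw [abs_le]
  constructor <;> nlinarith

lemma second_le (φ φ' φ'' : ℝ → ℝ) (h1 : ∀ s, HasDerivAt φ (φ' s) s) (h2 : ∀ s, HasDerivAt φ' (φ'' s) s)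
    (hm : ∀ s, φ s ≤ φ 0) : φ' 0 = 0 ∧ φ'' 0 ≤ 0 := by
  have hmax : IsLocalMax φ 0 := Filter.Eventually.of_forall hm
  have z : φ' 0 = 0 := hmax.hasDerivAt_eq_zero (h1 0)
  refine ⟨z, ?_⟩
  by_contra hpos
  push Not at hpos
  have ed : deriv φ = φ' := funext (fun s => (h1 s).deriv)
  have hmin : IsLocalMin φ 0 := by
    refine isLocalMin_of_deriv_deriv_pos ?_ ?_ (h1 0).continuousAt
    · rw [ed, (h2 0).deriv]; exact hpos
    · rw [ed, z]
  have heq : φ =ᶠ[nhds 0] fun _ => φ 0 := by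
    filter_upwards [hmin, hmax] with s a b
    exact le_antisymm b a
  have h3 := heq.deriv.deriv.self_of_nhds
  rw [ed] at h3
  have h4 := (h2 0).deriv
  rw [h4] at h3
  simp at h3
  linarith

namespace Par
variable (P : Par)

/-! solutions in terms of sequences -/

structure Sol (p h : Ix → ℂ) : Prop where
  rp : Rapid p
  re : Re p
  rh : Rapid h
  reh : Re h
  eq : ∀ n, P.sA n * p n + 2⁻¹ * P.st p p n = h n - if n = 0 then ((P.a * P.b - P.c ^ 2 : ℝ) : ℂ) else 0

lemma st_terms {p u : Ix → ℂ} (hp : W2 p) (hu : W2 u) (n) : Summable (fun m => P.sp m (n - m) * p m * u (n - m)) := by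
  have t1 := (P.Sm11 hp).cv_terms (P.Sm22 hu) n
  have t2 := (P.Sm22 hp).cv_terms (P.Sm11 hu) n
  have t3 := (P.Sm12 hp).cv_terms (P.Sm12 hu) n
  refine ((t1.add t2).sub (t3.mul_left 2)).congr (fun m => ?_)
  simp only [sp]; ring

lemma st_comm (p u : Ix → ℂ) (n) : P.st p u n = P.st u p n := by
  unfold st
  rw [← (Equiv.subLeft n).tsum_eq]
  refine tsum_congr (fun m => ?_)
  simp only [Equiv.subLeft_apply, sub_sub_cancel]
  rw [sp_comm]; ring

lemma dE_split (e) (n m : Ix) : dE e n = dE e m + dE e (n - m) := by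
  simp [dE_eq]; ring

lemma dE_zero (e) : dE e 0 = 0 := by simp [dE_eq]

lemma st_D {p u : Ix → ℂ} (hp : Rapid p) (hu : Rapid u) (e n) :
    dE e n * P.st p u n = P.st (D e p) u n + P.st p (D e u) n := by
  unfold st
  rw [← tsum_mul_left, ← (P.st_terms (hp.D e).W2 hu.W2 n).tsum_add (P.st_terms hp.W2 (hu.D e).W2 n)]
  refine tsum_congr (fun m => ?_)
  rw [dE_split e n m]
  simp only [D]; ring

lemma Sol.L1 {p h : Ix → ℂ} (S : P.Sol p h) (e n) : P.Lf p (D e p) n = D e h n := by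
  have h1 := congrArg (fun q => dE e n * q) (S.eq n)
  simp only [mul_add, mul_sub] at h1
  have h2 := P.st_D S.rp S.rp e n
  rw [P.st_comm (D e p) p] at h2
  have h3 : dE e n * (if n = 0 then ((P.a * P.b - P.c ^ 2 : ℝ) : ℂ) else 0) = 0 := by
    by_cases h : n = 0
    · subst h; simp [dE_zero]
    · simp [h]
  rw [h3] at h1
  simp only [Lf, D] at *
  linear_combination h1 - 2⁻¹ * h2

lemma Sol.L2 {p h : Ix → ℂ} (S : P.Sol p h) (e e' n) : P.Lf p (D e (D e' p)) n = D e (D e' h) n - P.st (D e p) (D e' p) n := by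
  have h1 := congrArg (fun q => dE e n * q) (S.L1 P e' n)
  simp only [Lf, mul_add] at h1
  have h2 := P.st_D S.rp (S.rp.D e') e n
  simp only [Lf, D] at *
  linear_combination h1 - h2

lemma R_s11 {p : Ix → ℂ} (hp : Rapid p) (z) : (ev (fun n => P.s11 n * p n) z).re =
    R (D (1, 0) (D (1, 0) p)) z - P.l11 * R (D (1, 0) p) z - P.m11 * R (D (0, 1) p) z := by
  rw [← R_smul, ← R_smul, ← R_sub ((hp.D _).D _).Sm ((hp.D _).Sm.smul _),
    ← R_sub (((hp.D _).D _).Sm.sub ((hp.D _).Sm.smul _)) ((hp.D _).Sm.smul _)]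
  unfold R; congr 2; funext n; simp [D, dE, s11]; ring

lemma R_s22 {p : Ix → ℂ} (hp : Rapid p) (z) : (ev (fun n => P.s22 n * p n) z).re =
    R (D (0, 1) (D (0, 1) p)) z - P.l22 * R (D (1, 0) p) z - P.m22 * R (D (0, 1) p) z := by
  rw [← R_smul, ← R_smul, ← R_sub ((hp.D _).D _).Sm ((hp.D _).Sm.smul _),
    ← R_sub (((hp.D _).D _).Sm.sub ((hp.D _).Sm.smul _)) ((hp.D _).Sm.smul _)]
  unfold R; congr 2; funext n; simp [D, dE, s22]; ring

lemma R_s12 {p : Ix → ℂ} (hp : Rapid p) (z) : (ev (fun n => P.s12 n * p n) z).re =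
    R (D (0, 1) (D (1, 0) p)) z - P.l12 * R (D (1, 0) p) z - P.m12 * R (D (0, 1) p) z := by
  rw [← R_smul, ← R_smul, ← R_sub ((hp.D _).D _).Sm ((hp.D _).Sm.smul _),
    ← R_sub (((hp.D _).D _).Sm.sub ((hp.D _).Sm.smul _)) ((hp.D _).Sm.smul _)]
  unfold R; congr 2; funext n; simp [D, dE, s12]; ring

lemma ev_delta (c : ℂ) (z) : ev (fun n => if n = 0 then c else 0) z = c := by
  unfold ev
  rw [tsum_eq_single 0]
  · simp [ex_zero]
  · intro n hn; simp [hn]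

lemma Sm_delta (c : ℂ) : Sm (fun n => if n = 0 then c else 0) := by
  apply summable_of_ne_finset_zero (s := {0}); intro n hn; simp at hn; simp [hn]

lemma Sol.E0 {p h : Ix → ℂ} (S : P.Sol p h) (z) : P.U11 p z * P.U22 p z - P.U12 p z ^ 2 = R h z := by
  have h1 : ev (fun n => P.sA n * p n + 2⁻¹ * P.st p p n) z = ev h z - ((P.a * P.b - P.c ^ 2 : ℝ) : ℂ) := by
    rw [funext S.eq, ev_sub S.rh.Sm (Sm_delta _), ev_delta]
  have hp := S.rp.W2
  rw [ev_add (P.sA_Sm hp) ((P.st_Sm hp hp).smul _), ev_smul, P.ev_sA hp, P.ev_st hp hp] at h1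
  rw [← ev_re (P.Re11 S.re), ← ev_re (P.Re12 S.re), ← ev_re (P.Re22 S.re), ← ev_re S.reh] at h1
  have h2 : P.b * (ev (fun n => P.s11 n * p n) z).re + P.a * (ev (fun n => P.s22 n * p n) z).re - 2 * P.c * (ev (fun n => P.s12 n * p n) z).re
     + 2⁻¹ * ((ev (fun n => P.s11 n * p n) z).re * (ev (fun n => P.s22 n * p n) z).re + (ev (fun n => P.s22 n * p n) z).re * (ev (fun n => P.s11 n * p n) z).re
      - 2 * ((ev (fun n => P.s12 n * p n) z).re * (ev (fun n => P.s12 n * p n) z).re)) = (ev h z).re - (P.a * P.b - P.c ^ 2) := by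
    apply Complex.ofReal_injective; push_cast; push_cast at h1; exact h1
  unfold U11 U12 U22 R
  linear_combination h2

lemma Sol.ELf {p h : Ix → ℂ} (S : P.Sol p h) {u : Ix → ℂ} (hu : Rapid u) (z) : R (P.Lf p u) z =
    P.U22 p z * R (fun n => P.s11 n * u n) z + P.U11 p z * R (fun n => P.s22 n * u n) z
      - 2 * (P.U12 p z * R (fun n => P.s12 n * u n) z) := by
  unfold R
  rw [P.ev_Lf S.rp.W2 S.re hu.W2]
  simp

lemma R_st {p u : Ix → ℂ} (hp : Rapid p) (hrp : Re p) (hu : Rapid u) (hru : Re u) (z) : R (P.st p u) z =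
    R (fun n => P.s11 n * p n) z * R (fun n => P.s22 n * u n) z + R (fun n => P.s22 n * p n) z * R (fun n => P.s11 n * u n) z
     - 2 * (R (fun n => P.s12 n * p n) z * R (fun n => P.s12 n * u n) z) := by
  unfold R
  rw [P.ev_st hp.W2 hu.W2]
  rw [← ev_re (P.Re11 hrp), ← ev_re (P.Re12 hrp), ← ev_re (P.Re22 hrp), ← ev_re (P.Re11 hru), ← ev_re (P.Re12 hru), ← ev_re (P.Re22 hru)]
  norm_cast

end Par
end GMA

namespace GMA
namespace Par
variable (P : Par)

lemma U11_eq {p : Ix → ℂ} (hp : Rapid p) (z) : P.U11 p z = P.a + R (D (1, 0) (D (1, 0) p)) z - P.l11 * R (D (1, 0) p) z - P.m11 * R (D (0, 1) p) z := by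
  unfold U11; rw [P.R_s11 hp]; ring
lemma U22_eq {p : Ix → ℂ} (hp : Rapid p) (z) : P.U22 p z = P.b + R (D (0, 1) (D (0, 1) p)) z - P.l22 * R (D (1, 0) p) z - P.m22 * R (D (0, 1) p) z := by
  unfold U22; rw [P.R_s22 hp]; ring
lemma U12_eq {p : Ix → ℂ} (hp : Rapid p) (z) : P.U12 p z = P.c + R (D (0, 1) (D (1, 0) p)) z - P.l12 * R (D (1, 0) p) z - P.m12 * R (D (0, 1) p) z := by
  unfold U12; rw [P.R_s12 hp]; ring

lemma gradx {p : Ix → ℂ} (hp : Rapid p) (k α : ℝ) (hα : 0 ≤ α) (h : ∀ z, -α ≤ R (D (1, 0) (D (1, 0) p)) z - k * R (D (1, 0) p) z) (z) :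
    |R (D (1, 0) p) z| ≤ α * Real.exp |k| := by
  have := grad1 _ _ _ (R_line hp z (1, 0)) (R_line (hp.D (1, 0)) z (1, 0)) (fun s => by
    have := R_per p (z + s • ((1 : ℝ), (0 : ℝ))) (1, 0)
    rw [← this]; congr 1; ext <;> simp <;> ring) k α hα (fun s => h _) 0
  simpa using this

lemma grady {p : Ix → ℂ} (hp : Rapid p) (k α : ℝ) (hα : 0 ≤ α) (h : ∀ z, -α ≤ R (D (0, 1) (D (0, 1) p)) z - k * R (D (0, 1) p) z) (z) :
    |R (D (0, 1) p) z| ≤ α * Real.exp |k| := by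
  have := grad1 _ _ _ (R_line hp z (0, 1)) (R_line (hp.D (0, 1)) z (0, 1)) (fun s => by
    have := R_per p (z + s • ((0 : ℝ), (1 : ℝ))) (0, 1)
    rw [← this]; congr 1; ext <;> simp <;> ring) k α hα (fun s => h _) 0
  simpa using this

/-- first order estimate -/
lemma C1 : ∃ K, 0 ≤ K ∧ ∀ p : Ix → ℂ, Rapid p → (∀ z, 0 ≤ P.U11 p z ∧ 0 ≤ P.U22 p z) →
    ∀ z, |R (D (1, 0) p) z| ≤ K ∧ |R (D (0, 1) p) z| ≤ K := by
  have ha := P.ha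
  have hb := P.hb
  by_cases hm : P.m11 = 0
  · set K1 := P.a * Real.exp |P.l11|
    have hK1 : 0 ≤ K1 := by positivity
    set K2 := (P.b + |P.l22| * K1) * Real.exp |P.m22|
    have hK2 : 0 ≤ K2 := by positivity
    refine ⟨K1 + K2, by positivity, fun p hp hU => ?_⟩
    have g1 : ∀ z, |R (D (1, 0) p) z| ≤ K1 := gradx hp _ _ ha.le (fun z => by
      have := (hU z).1; rw [P.U11_eq hp, hm] at this; linarith)
    have g2 : ∀ z, |R (D (0, 1) p) z| ≤ K2 := grady hp _ _ (by positivity) (fun z => by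
      have := (hU z).2; rw [P.U22_eq hp] at this
      have h1 : |P.l22 * R (D (1, 0) p) z| ≤ |P.l22| * K1 := by
        rw [abs_mul]; exact mul_le_mul_of_nonneg_left (g1 z) (abs_nonneg _)
      have := (abs_le.1 h1).1
      linarith)
    exact fun z => ⟨(g1 z).trans (by linarith), (g2 z).trans (by linarith)⟩
  · have hl : P.l22 = 0 := by
      rcases mul_eq_zero.1 P.h1 with h | h
      · exact absurd h hm
      · exact h
    set K2 := P.b * Real.exp |P.m22|
    have hK2 : 0 ≤ K2 := by positivity
    set K1 := (P.a + |P.m11| * K2) * Real.exp |P.l11|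
    have hK1 : 0 ≤ K1 := by positivity
    refine ⟨K1 + K2, by positivity, fun p hp hU => ?_⟩
    have g2 : ∀ z, |R (D (0, 1) p) z| ≤ K2 := grady hp _ _ hb.le (fun z => by
      have := (hU z).2; rw [P.U22_eq hp, hl] at this; linarith)
    have g1 : ∀ z, |R (D (1, 0) p) z| ≤ K1 := gradx hp _ _ (by positivity) (fun z => by
      have := (hU z).1; rw [P.U11_eq hp] at this
      have h1 : |P.m11 * R (D (0, 1) p) z| ≤ |P.m11| * K2 := by
        rw [abs_mul]; exact mul_le_mul_of_nonneg_left (g2 z) (abs_nonneg _)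
      have := (abs_le.1 h1).1
      linarith)
    exact fun z => ⟨(g1 z).trans (by linarith), (g2 z).trans (by linarith)⟩

lemma osc {p : Ix → ℂ} (hp : Rapid p) {K : ℝ} (h : ∀ z, |R (D (1, 0) p) z| ≤ K ∧ |R (D (0, 1) p) z| ≤ K) (z z') :
    R p z - R p z' ≤ 2 * K := by
  obtain ⟨y, hy, e⟩ := exists_rep z
  obtain ⟨y', hy', e'⟩ := exists_rep z'
  rw [← e, ← e']
  obtain ⟨⟨a1, a2⟩, a3, a4⟩ := hy
  obtain ⟨⟨b1, b2⟩, b3, b4⟩ := hy'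
  have hd := R_line hp y' (y - y')
  obtain ⟨s, hs, es⟩ := exists_hasDerivAt_eq_slope (fun s : ℝ => R p (y' + s • (y - y'))) _ (show (0 : ℝ) < 1 by norm_num)
    (continuous_iff_continuousAt.2 (fun s => (hd s).continuousAt)).continuousOn (fun s _ => hd s)
  simp at es
  rw [← es, R_D hp]
  set z1 := y' + s • (y - y')
  have h1 : (y - y').1 * R (D (1, 0) p) z1 ≤ K := by
    refine (le_abs_self _).trans ?_
    rw [abs_mul]
    have : |(y - y').1| ≤ 1 := by rw [abs_le]; constructor <;> simp <;> linarith
    calc _ ≤ 1 * K := mul_le_mul this (h z1).1 (abs_nonneg _) (by norm_num)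
      _ = K := one_mul _
  have h2 : (y - y').2 * R (D (0, 1) p) z1 ≤ K := by
    refine (le_abs_self _).trans ?_
    rw [abs_mul]
    have : |(y - y').2| ≤ 1 := by rw [abs_le]; constructor <;> simp <;> linarith
    calc _ ≤ 1 * K := mul_le_mul this (h z1).2 (abs_nonneg _) (by norm_num)
      _ = K := one_mul _
  linarith

lemma alg1 {A B C x y z : ℝ} (hA : 0 < A) (hf : 0 < A * C - B ^ 2) :
    4 * (A * C - B ^ 2) * (x * z - y ^ 2) ≤ (C * x + A * z - 2 * (B * y)) ^ 2 := by
  have e : A ^ 2 * ((C * x + A * z - 2 * (B * y)) ^ 2 - 4 * (A * C - B ^ 2) * (x * z - y ^ 2)) =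
    (A ^ 2 * z - 2 * A * B * y + (2 * B ^ 2 - A * C) * x) ^ 2 + 4 * (A * C - B ^ 2) * (A * y - B * x) ^ 2 := by ring
  have h0 : 0 ≤ A ^ 2 * ((C * x + A * z - 2 * (B * y)) ^ 2 - 4 * (A * C - B ^ 2) * (x * z - y ^ 2)) := by
    rw [e]; positivity
  have := nonneg_of_mul_nonneg_right h0 (by positivity)
  linarith

/-- the algebra behind the estimate at the maximum -/
lemma alg2 {A B C x y z X Y Z i1 i2 i3 H11 H12 H22 f fe fee fm N a b c la : ℝ} (hA : 0 < A)
    (hess : ∀ s t : ℝ, s ^ 2 * H11 + 2 * s * t * H12 + t ^ 2 * H22 ≤ 0) (E0 : A * C - B ^ 2 = f)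
    (low : Low la a c b) (hfm : 0 < fm) (hfz : fm ≤ f ∧ f ≤ N) (h1 : |fe| ≤ N) (h2 : |fee| ≤ N)
    (l1 : C * x + A * z - 2 * (B * y) = fe)
    (l2 : C * X + A * Z - 2 * (B * Y) = fee - (x * z + z * x - 2 * (y * y)))
    (u11 : A = a + i1) (u12 : B = c + i2) (u22 : C = b + i3)
    (s11g : X - i1 = H11) (s12g : Y - i2 = H12) (s22g : Z - i3 = H22) :
    la * (A + C) ≤ 3 * N + N ^ 2 / (2 * fm) := by
  have hf0 : 0 < A * C - B ^ 2 := by rw [E0]; linarith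
  have LH : C * H11 + A * H22 - 2 * (B * H12) ≤ 0 := by
    have a1 := hess (-B) A
    have a2 : H11 ≤ 0 := by have := hess 1 0; linarith
    have a3 := mul_nonneg hf0.le (neg_nonneg.2 a2)
    have : A * (C * H11 + A * H22 - 2 * (B * H12)) ≤ 0 := by linarith
    by_contra hh
    push Not at hh
    linarith [mul_pos hA hh]
  have al := alg1 (x := x) (y := y) (z := z) hA hf0
  rw [l1, E0] at al
  have N1 := abs_le.1 h1
  have N2 := abs_le.1 h2
  have fe2 : fe ^ 2 ≤ N ^ 2 := by nlinarith
  have hN : 2 * (x * z - y ^ 2) ≤ N ^ 2 / (2 * fm) := by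
    rw [le_div_iff₀ (by linarith)]
    by_cases hd : x * z - y ^ 2 ≤ 0
    · nlinarith [sq_nonneg N]
    · push Not at hd
      nlinarith [mul_le_mul_of_nonneg_right hfz.1 hd.le]
  have CA : la * (A + C) ≤ b * A + a * C - 2 * (c * B) := by
    have k1 := low (-B) A
    have k2 := mul_le_mul_of_nonneg_right low.h1 hf0.le
    have : 0 ≤ A * (b * A + a * C - 2 * (c * B) - la * (A + C)) := by linarith
    have := nonneg_of_mul_nonneg_right this hA
    linarith
  have fin : b * A + a * C - 2 * (c * B) ≤ 2 * f - fee + 2 * (x * z - y ^ 2) := by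
    have j1 : i1 = A - a := by linarith
    have j2 : i2 = B - c := by linarith
    have j3 : i3 = C - b := by linarith
    rw [← s11g, ← s22g, ← s12g, j1, j2, j3] at LH
    linarith
  linarith

/-- estimate at the maximum of `p_ee - p` -/
lemma C2max {p h : Ix → ℂ} (S : P.Sol p h) {lam : ℝ} (hl : 0 < lam) (he : P.Ell lam p) {fm N : ℝ} (hfm : 0 < fm)
    (hf : ∀ z, fm ≤ R h z ∧ R h z ≤ N) (e : ℝ × ℝ) (h1 : ∀ z, |R (D e h) z| ≤ N) (h2 : ∀ z, |R (D e (D e h)) z| ≤ N) :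
    ∃ z0, (∀ z, R (D e (D e p)) z - R p z ≤ R (D e (D e p)) z0 - R p z0) ∧
      P.lamA * (P.U11 p z0 + P.U22 p z0) ≤ 3 * N + N ^ 2 / (2 * fm) := by
  have rE : Rapid (D e (D e p)) := (S.rp.D e).D e
  set g : Ix → ℂ := fun n => D e (D e p) n + ((-1 : ℝ) : ℂ) * p n with hg
  have rg : Rapid g := rE.add (S.rp.smul _)
  have Rg : ∀ z, R g z = R (D e (D e p)) z - R p z := fun z => by
    rw [hg, R_add rE.Sm (S.rp.smul _).Sm, R_smul]; ring
  obtain ⟨z0, hz⟩ := exists_max rg.Sm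
  refine ⟨z0, fun z => by rw [← Rg, ← Rg]; exact hz z, ?_⟩
  have key : ∀ v : ℝ × ℝ, R (D v g) z0 = 0 ∧ R (D v (D v g)) z0 ≤ 0 := fun v => by
    have := second_le _ _ _ (R_line rg z0 v) (R_line (rg.D v) z0 v) (fun s => by simpa using hz _)
    simpa using this
  have gx := (key (1, 0)).1
  have gy := (key (0, 1)).1
  set H11 := R (D (1, 0) (D (1, 0) g)) z0
  set H22 := R (D (0, 1) (D (0, 1) g)) z0
  set H12 := R (D (0, 1) (D (1, 0) g)) z0
  have hess : ∀ s t : ℝ, s ^ 2 * H11 + 2 * s * t * H12 + t ^ 2 * H22 ≤ 0 := fun s t => by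
    have := (key (s, t)).2
    rw [R_D (rg.D _)] at this
    have c1 : D (1, 0) (D (s, t) g) = D (s, t) (D (1, 0) g) := by funext n; simp only [D]; ring
    have c2 : D (0, 1) (D (s, t) g) = D (s, t) (D (0, 1) g) := by funext n; simp only [D]; ring
    rw [c1, c2, R_D (rg.D (1, 0)) (s, t), R_D (rg.D (0, 1)) (s, t)] at this
    have c3 : D (1, 0) (D (0, 1) g) = D (0, 1) (D (1, 0) g) := by funext n; simp only [D]; ring
    rw [c3] at this
    simp only at this
    change s * (s * H11 + t * H12) + t * (s * H12 + t * H22) ≤ 0 at this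
    linarith
  have E0 := S.E0 P z0
  have hA : 0 < P.U11 p z0 := hl.trans_le (he z0).h1
  have hC : 0 < P.U22 p z0 := hl.trans_le (he z0).h2
  -- the linearized operator at g
  have s11g : R (fun n => P.s11 n * g n) z0 = H11 := by
    unfold R; rw [P.R_s11 rg]; rw [gx, gy]; simp [H11]
  have s22g : R (fun n => P.s22 n * g n) z0 = H22 := by
    unfold R; rw [P.R_s22 rg]; rw [gx, gy]; simp [H22]
  have s12g : R (fun n => P.s12 n * g n) z0 = H12 := by
    unfold R; rw [P.R_s12 rg]; rw [gx, gy]; simp [H12]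
  have split : ∀ s : Ix → ℂ, Sm (fun n => s n * D e (D e p) n) → Sm (fun n => s n * p n) →
      R (fun n => s n * g n) z0 = R (fun n => s n * D e (D e p) n) z0 - R (fun n => s n * p n) z0 := fun s a b => by
    rw [← R_sub a b]; congr 1; funext n; simp [hg]; ring
  rw [split _ (P.Sm11 rE.W2) (P.Sm11 S.rp.W2)] at s11g
  rw [split _ (P.Sm22 rE.W2) (P.Sm22 S.rp.W2)] at s22g
  rw [split _ (P.Sm12 rE.W2) (P.Sm12 S.rp.W2)] at s12g
  have l2 : R (P.Lf p (D e (D e p))) z0 = R (D e (D e h)) z0 - R (P.st (D e p) (D e p)) z0 := by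
    rw [← R_sub ((S.rh.D e).D e).Sm (P.st_Sm (S.rp.D e).W2 (S.rp.D e).W2)]
    congr 1; funext n; exact S.L2 P e e n
  have l1 : R (P.Lf p (D e p)) z0 = R (D e h) z0 := by
    congr 1; funext n; exact S.L1 P e n
  rw [S.ELf P (S.rp.D e)] at l1
  rw [S.ELf P rE, P.R_st (S.rp.D e) (S.re.D e) (S.rp.D e) (S.re.D e)] at l2
  have u11 : P.U11 p z0 = P.a + R (fun n => P.s11 n * p n) z0 := rfl
  have u12 : P.U12 p z0 = P.c + R (fun n => P.s12 n * p n) z0 := rfl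
  have u22 : P.U22 p z0 = P.b + R (fun n => P.s22 n * p n) z0 := rfl
  exact alg2 hA hess E0 P.lowA hfm (hf z0) (h1 z0) (h2 z0) l1 l2 u11 u12 u22 s11g s12g s22g

/-- second order estimate -/
lemma C2 {fm N : ℝ} (hfm : 0 < fm) (hN0 : 0 ≤ N) : ∃ L lam0, 0 < L ∧ 0 < lam0 ∧ ∀ p h : Ix → ℂ, P.Sol p h → ∀ lam, 0 < lam → P.Ell lam p →
    (∀ z, fm ≤ R h z ∧ R h z ≤ N) → (∀ z, |R (D (1, 0) h) z| ≤ N ∧ |R (D (0, 1) h) z| ≤ N) →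
    (∀ z, |R (D (1, 0) (D (1, 0) h)) z| ≤ N ∧ |R (D (0, 1) (D (0, 1) h)) z| ≤ N) →
    P.Upp L p ∧ P.Ell lam0 p := by
  obtain ⟨K, hK, hC1⟩ := P.C1
  set M := (3 * N + N ^ 2 / (2 * fm)) / P.lamA
  have hlA := P.lamA_pos
  have hM : 0 ≤ M := by positivity
  set Q := (|P.l11| + |P.m11| + |P.l22| + |P.m22|) * K
  have hQ : 0 ≤ Q := by positivity
  have ha := P.ha
  have hb := P.hb
  set L := M + 2 * Q + 2 * K + P.a + P.b
  have hL : 0 < L := by positivity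
  refine ⟨L, fm / (2 * L), hL, by positivity, fun p h S lam hl he hf h1 h2 => ?_⟩
  have g := hC1 p S.rp (fun z => ⟨hl.le.trans (he z).h1, hl.le.trans (he z).h2⟩)
  have ho := osc S.rp g
  have b1 : ∀ z, |P.l11 * R (D (1, 0) p) z + P.m11 * R (D (0, 1) p) z| ≤ Q := fun z => by
    refine (abs_add_le _ _).trans ?_
    rw [abs_mul, abs_mul]
    have i1 := mul_le_mul_of_nonneg_left (g z).1 (abs_nonneg P.l11)
    have i2 := mul_le_mul_of_nonneg_left (g z).2 (abs_nonneg P.m11)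
    have i3 : 0 ≤ |P.l22| * K := by positivity
    have i4 : 0 ≤ |P.m22| * K := by positivity
    simp only [Q]; linarith
  have b2 : ∀ z, |P.l22 * R (D (1, 0) p) z + P.m22 * R (D (0, 1) p) z| ≤ Q := fun z => by
    refine (abs_add_le _ _).trans ?_
    rw [abs_mul, abs_mul]
    have i1 := mul_le_mul_of_nonneg_left (g z).1 (abs_nonneg P.l22)
    have i2 := mul_le_mul_of_nonneg_left (g z).2 (abs_nonneg P.m22)
    have i3 : 0 ≤ |P.l11| * K := by positivity
    have i4 : 0 ≤ |P.m11| * K := by positivity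
    simp only [Q]; linarith
  have U : P.Upp L p := by
    intro z
    constructor
    · obtain ⟨z0, k1, k2⟩ := P.C2max S hl he hfm hf (1, 0) (fun z => (h1 z).1) (fun z => (h2 z).1)
      rw [← le_div_iff₀' hlA] at k2
      have k2' : P.U11 p z0 ≤ M := by
        have := hl.le.trans (he z0).h2
        simp only [M]; linarith
      rw [P.U11_eq S.rp] at k2' ⊢
      have := k1 z
      have := ho z z0
      have := abs_le.1 (b1 z)
      have := abs_le.1 (b1 z0)
      simp only [L]; linarith
    · obtain ⟨z0, k1, k2⟩ := P.C2max S hl he hfm hf (0, 1) (fun z => (h1 z).2) (fun z => (h2 z).2)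
      rw [← le_div_iff₀' hlA] at k2
      have k2' : P.U22 p z0 ≤ M := by
        have := hl.le.trans (he z0).h1
        simp only [M]; linarith
      rw [P.U22_eq S.rp] at k2' ⊢
      have := k1 z
      have := ho z z0
      have := abs_le.1 (b2 z)
      have := abs_le.1 (b2 z0)
      simp only [L]; linarith
  refine ⟨U, fun z => ?_⟩
  have e := S.E0 P z
  have u := U z
  have f := (hf z).1
  have pA := hl.trans_le (he z).h1
  have pC := hl.trans_le (he z).h2
  have q1 : fm / (2 * L) ≤ P.U11 p z := by
    rw [div_le_iff₀ (by positivity)]; nlinarith [sq_nonneg (P.U12 p z), mul_le_mul_of_nonneg_left u.2 pA.le]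
  have q2 : fm / (2 * L) ≤ P.U22 p z := by
    rw [div_le_iff₀ (by positivity)]; nlinarith [sq_nonneg (P.U12 p z), mul_le_mul_of_nonneg_left u.1 pC.le]
  have q3 : fm / (2 * L) * (P.U11 p z + P.U22 p z) ≤ fm := by
    rw [div_mul_eq_mul_div, div_le_iff₀ (by positivity)]
    nlinarith
  exact low_of q1 q2 (by nlinarith [sq_nonneg (fm / (2 * L))])

end Par
end GMA

namespace GMA
open Filter Topology

/-! ### Part H : strong convergence of third derivatives -/

noncomputable def cut (s : Finset Ix) : HH →L[ℂ] HH := dg (fun n => if n ∈ s then 1 else 0) 1 (fun n => by split_ifs <;> simp)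

lemma cut_apply (s : Finset Ix) (y : HH) (n) : cut s y n = (if n ∈ s then 1 else 0) * y n := rfl

lemma cut_Sm (s : Finset Ix) (y : HH) : Sm (cut s y) := by
  apply summable_of_ne_finset_zero (s := s)
  intro n hn; simp [cut_apply, hn]

lemma cut_tendsto (y : HH) : Tendsto (fun s => cut s y) atTop (𝓝 y) := by
  have hs := lp.hasSum_single (E := fun _ : Ix => ℂ) (p := 2) (by norm_num) y
  refine hs.congr (fun s => HH_ext (fun n => ?_))
  rw [lp.coeFn_sum, Finset.sum_apply, cut_apply]
  by_cases hn : n ∈ s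
  · rw [Finset.sum_eq_single n]
    · simp [hn]
    · intro b _ hb; rw [lp.single_apply_ne]; exact hb.symm
    · intro h; exact absurd hn h
  · rw [Finset.sum_eq_zero]
    · simp [hn]
    · intro i hi; rw [lp.single_apply_ne]; rintro rfl; exact hn hi

lemma cut_ev (y : HH) {ε : ℝ} (hε : 0 < ε) : ∀ᶠ s in atTop, ‖y - cut s y‖ < ε := by
  have := Metric.tendsto_nhds.1 (cut_tendsto y) ε hε
  filter_upwards [this] with s hs
  rwa [dist_comm, dist_eq_norm] at hs

lemma Wk_bound (K : Ix → ℂ) {C : ℝ} (hC : 0 ≤ C) (hK : ∀ m, ‖K m‖ ≤ C) (v z : HH) (n : Ix) :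
    Summable (fun m => K m * v m * z (n - m)) ∧ ‖∑' m, K m * v m * z (n - m)‖ ≤ C * ‖v‖ * ‖z‖ := by
  have s1 := sqSummable v
  have s2 : Summable (fun m => ‖z (n - m)‖ ^ 2) := ((Equiv.subLeft n).summable_iff (f := fun m => ‖z m‖ ^ 2)).2 (sqSummable z)
  have e2 : ∑' m, ‖z (n - m)‖ ^ 2 = ‖z‖ ^ 2 := by
    rw [nsq]; exact (Equiv.subLeft n).tsum_eq (fun m => ‖z m‖ ^ 2)
  have hs := cs_summable s1 s2
  have hl := cs_le s1 s2
  rw [e2, ← nsq, Real.sqrt_sq (norm_nonneg _), Real.sqrt_sq (norm_nonneg _)] at hl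
  have hs' : Summable (fun m => ‖v m‖ * ‖z (n - m)‖) := hs.of_abs
  have hb : ∀ m, ‖K m * v m * z (n - m)‖ ≤ C * (‖v m‖ * ‖z (n - m)‖) := fun m => by
    rw [norm_mul, norm_mul, mul_assoc]
    exact mul_le_mul_of_nonneg_right (hK m) (by positivity)
  refine ⟨Summable.of_norm_bounded (hs'.mul_left C) hb, ?_⟩
  refine (tsum_of_norm_bounded (hs'.mul_left C).hasSum hb).trans ?_
  rw [tsum_mul_left, mul_assoc]
  exact mul_le_mul_of_nonneg_left hl hC

lemma Wk (K : Ix → ℂ) {C : ℝ} (hC : 0 ≤ C) (hK : ∀ m, ‖K m‖ ≤ C) {v : ℕ → HH} {v0 : HH} (hv : Tendsto v atTop (𝓝 v0))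
    {z : ℕ → HH} {z0 : HH} {M : ℝ} (hz : ∀ᶠ k in atTop, ‖z k‖ ≤ M) (hc : ∀ n, Tendsto (fun k => z k n) atTop (𝓝 (z0 n))) (n : Ix) :
    Tendsto (fun k => ∑' m, K m * v k m * z k (n - m)) atTop (𝓝 (∑' m, K m * v0 m * z0 (n - m))) := by
  have hM : 0 ≤ M := by obtain ⟨k, hk⟩ := hz.exists; exact (norm_nonneg _).trans hk
  set M1 := M + ‖z0‖ + 1
  have hM1 : 0 < M1 := by positivity
  rw [Metric.tendsto_nhds]
  intro ε hε
  set η := ε / (4 * (C + 1) * M1)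
  have hη : 0 < η := by positivity
  obtain ⟨s, hs⟩ := (cut_ev v0 hη).exists
  have f1 : Tendsto (fun k => ∑ m ∈ s, K m * v0 m * (z k (n - m) - z0 (n - m))) atTop (𝓝 0) := by
    have : Tendsto (fun k => ∑ m ∈ s, K m * v0 m * (z k (n - m) - z0 (n - m))) atTop (𝓝 (∑ m ∈ s, K m * v0 m * (z0 (n - m) - z0 (n - m)))) :=
      tendsto_finset_sum _ (fun m _ => ((hc (n - m)).sub tendsto_const_nhds).const_mul _)
    simpa using this
  have f2 := Metric.tendsto_nhds.1 f1 (ε / 4) (by positivity)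
  have f3 := Metric.tendsto_nhds.1 hv η hη
  filter_upwards [hz, f2, f3] with k k1 k2 k3
  rw [dist_eq_norm] at *
  rw [sub_zero] at k2
  have B1 := Wk_bound K hC hK (v k - v0) (z k) n
  have B2 := Wk_bound K hC hK (v0 - cut s v0) (z k - z0) n
  have B3 := Wk_bound K hC hK (cut s v0) (z k - z0) n
  have e3 : ∑' m, K m * (cut s v0) m * (z k - z0 : HH) (n - m) = ∑ m ∈ s, K m * v0 m * (z k (n - m) - z0 (n - m)) := by
    rw [tsum_eq_sum (s := s)]
    · refine Finset.sum_congr rfl (fun m hm => ?_)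
      simp [cut_apply, hm]
    · intro m hm; simp [cut_apply, hm]
  have tot : (∑' m, K m * v k m * z k (n - m)) - ∑' m, K m * v0 m * z0 (n - m) =
      (∑' m, K m * (v k - v0 : HH) m * z k (n - m)) + ((∑' m, K m * (v0 - cut s v0 : HH) m * (z k - z0 : HH) (n - m))
        + ∑' m, K m * (cut s v0) m * (z k - z0 : HH) (n - m)) := by
    rw [← B2.1.tsum_add B3.1, ← B1.1.tsum_add (B2.1.add B3.1),
      ← (Wk_bound K hC hK (v k) (z k) n).1.tsum_sub (Wk_bound K hC hK v0 z0 n).1]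
    refine tsum_congr (fun m => ?_)
    simp only [lp.coeFn_sub, Pi.sub_apply]; ring
  rw [tot, e3]
  have n1 : ‖z k - z0‖ ≤ M1 := (norm_sub_le _ _).trans (by simp only [M1]; linarith)
  have n0 : ‖z k‖ ≤ M1 := k1.trans (by simp only [M1]; linarith [norm_nonneg z0])
  have c1 : C * ‖v k - v0‖ * ‖z k‖ ≤ C * η * M1 := by gcongr
  have c2 : C * ‖v0 - cut s v0‖ * ‖z k - z0‖ ≤ C * η * M1 := by gcongr
  have c3 : C * η * M1 ≤ ε / 4 := by
    have : (C + 1) * η * M1 = ε / 4 := by simp only [η]; field_simp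
    nlinarith [mul_pos hη hM1]
  refine (norm_add_le _ _).trans_lt ?_
  have := norm_add_le (∑' m, K m * (v0 - cut s v0 : HH) m * (z k - z0 : HH) (n - m)) (∑ m ∈ s, K m * v0 m * (z k (n - m) - z0 (n - m)))
  linarith [B1.2, B2.2]

namespace Par
variable (P : Par)

lemma st_young (v : HH) (u : Ix → ℂ) (hu : Sm (fun n => (w n : ℂ) * u n)) (z : HH)
    (hz : ∀ n, z n = P.st (fun n => (((w n)⁻¹ : ℝ) : ℂ) * v n) u n) :
    ‖z‖ ≤ 4 * P.Cs ^ 2 * (∑' n, ‖(w n : ℂ) * u n‖) * ‖v‖ := by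
  obtain ⟨z1, h1, h2⟩ := young (fun m => 4 * P.Cs ^ 2 * ‖(w m : ℂ) * u m‖) (fun m => by positivity) (hu.mul_left _) v
  rw [tsum_mul_left] at h1
  refine le_trans (norm_le_of_le (fun n => ?_)) h1
  rw [hz, st, ← (Equiv.subLeft n).tsum_eq]
  refine tsum_of_norm_bounded (h2 n) (fun m => ?_)
  simp only [Equiv.subLeft_apply, sub_sub_cancel]
  have a := P.sp_le (n - m) m
  have b := w_pos (n - m)
  have c := w_pos m
  rw [norm_mul, norm_mul, norm_mul, norm_mul, Complex.norm_real, Complex.norm_real, Real.norm_of_nonneg (by positivity), Real.norm_of_nonneg c.le]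
  calc _ ≤ 4 * P.Cs ^ 2 * (w (n - m) * w m) * ((w (n - m))⁻¹ * ‖v (n - m)‖) * ‖u m‖ := by gcongr
    _ = _ := by field_simp

lemma pp_eq (x : HH) : pp x = fun n => (((w n)⁻¹ : ℝ) : ℂ) * iw x n := by
  funext n; rw [iw_apply, pp]; push_cast; ring

lemma LL_young (x y : HH) (hy : Sm y) : ‖TK P.Bk x y‖ ≤ 4 * P.Cs ^ 2 * (∑' n, ‖y n‖) * ‖iw x‖ := by
  have e : ∀ n, (w n : ℂ) * (((w n)⁻¹ : ℝ) * y n) = y n := by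
    intro n; rw [← mul_assoc, ← Complex.ofReal_mul, mul_inv_cancel₀ (w_ne n)]; simp
  have := P.st_young (iw x) (fun n => (((w n)⁻¹ : ℝ) : ℂ) * y n) (by simpa only [e] using hy) (TK P.Bk x y) (fun n => by
    rw [← pp_eq]
    rw [TK_apply, st]
    refine tsum_congr (fun m => ?_)
    simp only [Bk, pp]; push_cast; ring)
  simpa only [e] using this

lemma LL_bd {x : HH} (hr : Re x) {lam L : ℝ} (hl : 0 < lam) (he : P.Ell lam (pp x)) (hL : P.Upp L (pp x)) (y : HH) :
    ‖P.LL x y‖ ≤ 4 * L * P.Cs * ‖y‖ := by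
  have e : ∀ n (y : HH), (w n : ℂ) * (((w n)⁻¹ : ℝ) * y n) = y n := by
    intro n y; rw [← mul_assoc, ← Complex.ofReal_mul, mul_inv_cancel₀ (w_ne n)]; simp
  have hL0 : 0 < L := lt_of_lt_of_le hl ((he 0).h1.trans (hL 0).1)
  have hcs := P.Cs_pos
  have h : ∀ s, ‖P.LL x (cut s y)‖ ≤ 4 * L * P.Cs * ‖cut s y‖ := fun s => by
    have hu : W2 (fun n => ((w n)⁻¹ : ℝ) * (cut s y) n) := by
      unfold W2; simpa only [e] using cut_Sm s y
    have := P.SB (pp_W2 x) (pp_Re hr) hu hl.le he hL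
    simp only [e, ← P.LL_apply] at this
    rw [← nsq, ← nsq, ← mul_pow] at this
    exact (pow_le_pow_iff_left₀ (norm_nonneg _) (by positivity) two_ne_zero).1 this
  exact le_of_tendsto_of_tendsto' (((P.LL x).continuous.norm.tendsto y).comp (cut_tendsto y))
    (((cut_tendsto y).norm).const_mul _) h

end Par
end GMA

namespace GMA
open Filter Topology

/-! ### Part I : Ladyzhenskaya inequality -/

lemma line_ineq (f f' : ℝ → ℂ) (h : ∀ s, HasDerivAt f (f' s) s) (hc : Continuous f') {x : ℝ} (hx : x ∈ Set.Icc (0 : ℝ) 1) :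
    ‖f x‖ ^ 2 ≤ ∫ s in (0 : ℝ)..1, (‖f s‖ ^ 2 + 2 * (‖f s‖ * ‖f' s‖)) := by
  have hf : Continuous f := continuous_iff_continuousAt.2 (fun s => (h s).continuousAt)
  have hd : ∀ s, HasDerivAt (fun s => ‖f s‖ ^ 2) (2 * inner ℝ (f s) (f' s)) s := fun s => (h s).norm_sq
  have hci : Continuous (fun s => 2 * inner ℝ (f s) (f' s)) := by fun_prop
  set I := ∫ s in (0 : ℝ)..1, 2 * (‖f s‖ * ‖f' s‖)
  have key : ∀ y ∈ Set.Icc (0 : ℝ) 1, ‖f x‖ ^ 2 - I ≤ ‖f y‖ ^ 2 := by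
    intro y hy
    have e := intervalIntegral.integral_eq_sub_of_hasDerivAt (a := y) (b := x) (fun s _ => hd s) (hci.intervalIntegrable _ _)
    have k1 := intervalIntegral.norm_integral_le_integral_norm_uIoc (a := y) (b := x) (f := fun s => 2 * inner ℝ (f s) (f' s)) (μ := volume)
    have hsub : Set.uIoc y x ⊆ Set.Ioc 0 1 := by
      intro s hs
      rw [Set.uIoc, Set.mem_Ioc] at hs
      exact ⟨lt_of_le_of_lt (le_min hy.1 hx.1) hs.1, hs.2.trans (max_le hy.2 hx.2)⟩
    have hc2 : Continuous (fun s => 2 * (‖f s‖ * ‖f' s‖)) := by fun_prop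
    have k2 : ∫ s in Set.uIoc y x, ‖2 * inner ℝ (f s) (f' s)‖ ≤ I := by
      simp only [I]
      rw [intervalIntegral.integral_of_le zero_le_one]
      refine (setIntegral_mono (hci.norm.integrableOn_uIoc) (hc2.integrableOn_uIoc) (fun s => ?_)).trans
        (setIntegral_mono_set (hc2.integrableOn_Ioc) (Eventually.of_forall (fun s => by positivity)) hsub.eventuallyLE)
      rw [norm_mul, Real.norm_of_nonneg (by norm_num : (0 : ℝ) ≤ 2)]
      exact mul_le_mul_of_nonneg_left (norm_inner_le_norm _ _) (by norm_num)
    have k3 := (Real.le_norm_self _).trans (k1.trans k2)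
    rw [e] at k3
    linarith
  rw [intervalIntegral.integral_add ((by fun_prop : Continuous (fun s => ‖f s‖ ^ 2)).intervalIntegrable _ _)
    ((by fun_prop : Continuous (fun s => 2 * (‖f s‖ * ‖f' s‖))).intervalIntegrable _ _)]
  have := intervalIntegral.integral_mono_on (μ := volume) (zero_le_one (α := ℝ)) (f := fun _ => ‖f x‖ ^ 2 - I) (g := fun y => ‖f y‖ ^ 2)
    (by simp) ((by fun_prop : Continuous (fun s => ‖f s‖ ^ 2)).intervalIntegrable _ _) key
  simp at this
  linarith

lemma ev_fst {a : Ix → ℂ} (ha : Rapid a) (x y : ℝ) : HasDerivAt (fun s : ℝ => ev a (s, y)) (ev (D (1, 0) a) (x, y)) x := by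
  have := ev_line ha (0, y) (1, 0) x
  simpa using this

lemma ev_snd {a : Ix → ℂ} (ha : Rapid a) (x y : ℝ) : HasDerivAt (fun s : ℝ => ev a (x, s)) (ev (D (0, 1) a) (x, y)) y := by
  have := ev_line ha (x, 0) (0, 1) y
  simpa using this

lemma int_bd {a b : Ix → ℂ} (ha : Rapid a) (hb : Rapid b) {ε E : ℝ} (hε : 0 < ε) (hE : ε ≤ E) (h1 : ∑' n, ‖a n‖ ^ 2 ≤ ε ^ 2)
    (h2 : ∑' n, ‖b n‖ ^ 2 ≤ E ^ 2) : ∫ z, (‖ev a z‖ ^ 2 + 2 * (‖ev a z‖ * ‖ev b z‖)) ∂mu ≤ 3 * ε * E := by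
  have ca := ev_cont ha.Sm
  have cb := ev_cont hb.Sm
  have hE0 : 0 < E := hε.trans_le hE
  rw [← parseval ha.Sm] at h1
  rw [← parseval hb.Sm] at h2
  have ia : Integrable (fun z => ‖ev a z‖ ^ 2) mu := mu_int (by fun_prop)
  have ib : Integrable (fun z => ‖ev b z‖ ^ 2) mu := mu_int (by fun_prop)
  have : ∫ z, (‖ev a z‖ ^ 2 + 2 * (‖ev a z‖ * ‖ev b z‖)) ∂mu ≤ ∫ z, ((1 + E / ε) * ‖ev a z‖ ^ 2 + ε / E * ‖ev b z‖ ^ 2) ∂mu := by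
    refine integral_mono (mu_int (by fun_prop)) (mu_int (by fun_prop)) (fun z => ?_)
    have : 0 ≤ ε / E * (‖ev b z‖ - E / ε * ‖ev a z‖) ^ 2 := by positivity
    have e : ε / E * (‖ev b z‖ - E / ε * ‖ev a z‖) ^ 2 = E / ε * ‖ev a z‖ ^ 2 + ε / E * ‖ev b z‖ ^ 2 - 2 * (‖ev a z‖ * ‖ev b z‖) := by
      field_simp; ring
    simp only; linarith
  refine this.trans ?_
  rw [integral_add (ia.const_mul _) (ib.const_mul _), integral_const_mul, integral_const_mul]
  calc _ ≤ (1 + E / ε) * ε ^ 2 + ε / E * E ^ 2 := by gcongr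
    _ = ε ^ 2 + 2 * ε * E := by field_simp; ring
    _ ≤ _ := by nlinarith

lemma lady {a : Ix → ℂ} (ha : Rapid a) {ε E : ℝ} (hε : 0 < ε) (hE : ε ≤ E) (h1 : ∑' n, ‖a n‖ ^ 2 ≤ ε ^ 2)
    (h2 : ∑' n, ‖D (1, 0) a n‖ ^ 2 ≤ E ^ 2) (h3 : ∑' n, ‖D (0, 1) a n‖ ^ 2 ≤ E ^ 2) :
    ∫ z, ‖ev a z‖ ^ 4 ∂mu ≤ (3 * ε * E) ^ 2 := by
  have ca := ev_cont ha.Sm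
  have c1 := ev_cont (ha.D (1, 0)).Sm
  have c2 := ev_cont (ha.D (0, 1)).Sm
  have hE0 : 0 < E := hε.trans_le hE
  let g1 : ℝ × ℝ → ℝ := fun z => ‖ev a z‖ ^ 2 + 2 * (‖ev a z‖ * ‖ev (D (1, 0) a) z‖)
  let g2 : ℝ × ℝ → ℝ := fun z => ‖ev a z‖ ^ 2 + 2 * (‖ev a z‖ * ‖ev (D (0, 1) a) z‖)
  have cg1 : Continuous g1 := by fun_prop
  have cg2 : Continuous g2 := by fun_prop
  let A : ℝ → ℝ := fun y => ∫ x in (0 : ℝ)..1, g1 (x, y)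
  let B : ℝ → ℝ := fun x => ∫ y in (0 : ℝ)..1, g2 (x, y)
  have cA : Continuous A := intervalIntegral.continuous_parametric_intervalIntegral_of_continuous' (f := fun y x => g1 (x, y)) (by fun_prop) 0 1
  have cB : Continuous B := intervalIntegral.continuous_parametric_intervalIntegral_of_continuous' (f := fun x y => g2 (x, y)) (by fun_prop) 0 1
  have b1 : ∫ y in (0 : ℝ)..1, A y ≤ 3 * ε * E := by
    have := int_bd ha (ha.D (1, 0)) hε hE h1 h2
    rwa [mu_eq' cg1] at this
  have b2 : ∫ x in (0 : ℝ)..1, B x ≤ 3 * ε * E := by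
    have := int_bd ha (ha.D (0, 1)) hε hE h1 h3
    rwa [mu_eq cg2] at this
  have p1 : ∀ y, 0 ≤ A y := fun y => intervalIntegral.integral_nonneg zero_le_one (fun x _ => by simp only [g1]; positivity)
  have p2 : ∀ y, 0 ≤ B y := fun y => intervalIntegral.integral_nonneg zero_le_one (fun x _ => by simp only [g2]; positivity)
  have pw : ∀ x ∈ Set.Icc (0 : ℝ) 1, ∀ y ∈ Set.Icc (0 : ℝ) 1, ‖ev a (x, y)‖ ^ 4 ≤ B x * A y := by
    intro x hx y hy
    have q1 := line_ineq (fun s => ev a (s, y)) (fun s => ev (D (1, 0) a) (s, y)) (fun s => ev_fst ha s y) (by fun_prop) hx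
    have q2 := line_ineq (fun s => ev a (x, s)) (fun s => ev (D (0, 1) a) (x, s)) (fun s => ev_snd ha x s) (by fun_prop) hy
    calc _ = ‖ev a (x, y)‖ ^ 2 * ‖ev a (x, y)‖ ^ 2 := by ring
      _ ≤ _ := mul_le_mul q2 q1 (by positivity) (p2 x)
  have c4 : Continuous (fun z => ‖ev a z‖ ^ 4) := by fun_prop
  rw [mu_eq c4]
  have cin : Continuous (fun x => ∫ y in (0 : ℝ)..1, ‖ev a (x, y)‖ ^ 4) :=
    intervalIntegral.continuous_parametric_intervalIntegral_of_continuous' (f := fun x y => ‖ev a (x, y)‖ ^ 4) (by fun_prop) 0 1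
  calc _ ≤ ∫ x in (0 : ℝ)..1, B x * ∫ y in (0 : ℝ)..1, A y := by
        refine intervalIntegral.integral_mono_on zero_le_one (cin.intervalIntegrable _ _) ((cB.mul_const _).intervalIntegrable _ _) (fun x hx => ?_)
        rw [← intervalIntegral.integral_const_mul]
        exact intervalIntegral.integral_mono_on zero_le_one ((by fun_prop : Continuous (fun y => ‖ev a (x, y)‖ ^ 4)).intervalIntegrable _ _)
          ((cA.const_mul _).intervalIntegrable _ _) (fun y hy => pw x hx y hy)
    _ = (∫ x in (0 : ℝ)..1, B x) * ∫ y in (0 : ℝ)..1, A y := by rw [intervalIntegral.integral_mul_const]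
    _ ≤ (3 * ε * E) * (3 * ε * E) := mul_le_mul b2 b1 (intervalIntegral.integral_nonneg zero_le_one (fun y _ => p1 y)) (by positivity)
    _ = _ := by ring

/-- weighted sequence -/
lemma Rapid.wmul {a : Ix → ℂ} (ha : Rapid a) : Rapid (fun n => (w n : ℂ) * a n) :=
  ha.mul (φ := fun n => (w n : ℂ)) (C := 1) (j := 1) (fun n => by simp [abs_of_pos (w_pos n)])

noncomputable def wv {a : Ix → ℂ} (ha : Rapid a) : HH := ha.wmul.toHH
lemma wv_apply {a : Ix → ℂ} (ha : Rapid a) (n) : wv ha n = (w n : ℂ) * a n := rfl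

lemma wv_sum {a b : Ix → ℂ} (ha : Rapid a) (hb : Sm b) {C ε : ℝ} (hC : 0 ≤ C) (h : ∀ n, ‖b n‖ ≤ C * (w n * ‖a n‖)) (hε : ‖wv ha‖ ≤ ε) :
    ∑' n, ‖b n‖ ^ 2 ≤ (C * ε) ^ 2 := by
  have h0 : ∑' n, ‖b n‖ ^ 2 ≤ ∑' n, C ^ 2 * ‖wv ha n‖ ^ 2 := by
    refine Summable.tsum_le_tsum (fun n => ?_) hb.sq ((sqSummable (wv ha)).mul_left _)
    rw [← mul_pow, wv_apply, norm_mul, Complex.norm_real, Real.norm_of_nonneg (w_pos n).le]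
    exact pow_le_pow_left₀ (norm_nonneg _) (h n) 2
  refine h0.trans ?_
  rw [tsum_mul_left, ← nsq, mul_pow]
  gcongr

namespace Par
variable (P : Par)

lemma lady_s {s : Ix → ℂ} (hs : ∀ n, ‖s n‖ ≤ P.Cs * w n) {a : Ix → ℂ} (ha : Rapid a) {ε E : ℝ} (hε : 0 < ε) (hE : ε ≤ E)
    (h1 : ‖wv ha‖ ≤ ε) (h2 : ‖wv (ha.D (1, 0))‖ ≤ E) (h3 : ‖wv (ha.D (0, 1))‖ ≤ E) :
    ∫ z, ‖ev (fun n => s n * a n) z‖ ^ 4 ∂mu ≤ (3 * (P.Cs * ε) * (P.Cs * E)) ^ 2 := by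
  have c0 := P.Cs_pos
  have hr : Rapid (fun n => s n * a n) := ha.mul (C := P.Cs) (j := 1) (by simpa using hs)
  have hb : ∀ n, ‖s n * a n‖ ≤ P.Cs * (w n * ‖a n‖) := fun n => by
    rw [norm_mul, ← mul_assoc]; exact mul_le_mul_of_nonneg_right (hs n) (norm_nonneg _)
  have hd : ∀ e n, ‖D e (fun n => s n * a n) n‖ ≤ P.Cs * (w n * ‖D e a n‖) := fun e n => by
    have : D e (fun n => s n * a n) n = s n * D e a n := by simp only [D]; ring
    rw [this, norm_mul, ← mul_assoc]; exact mul_le_mul_of_nonneg_right (hs n) (norm_nonneg _)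
  exact lady hr (by positivity) (by gcongr) (wv_sum ha hr.Sm c0.le hb h1) (wv_sum (ha.D _) (hr.D _).Sm c0.le (hd _) h2)
    (wv_sum (ha.D _) (hr.D _).Sm c0.le (hd _) h3)

lemma lady_st {a b : Ix → ℂ} (ha : Rapid a) (hb : Rapid b) {ε E : ℝ} (hε : 0 < ε) (hE : ε ≤ E)
    (a1 : ‖wv ha‖ ≤ ε) (a2 : ‖wv (ha.D (1, 0))‖ ≤ E) (a3 : ‖wv (ha.D (0, 1))‖ ≤ E)
    (b1 : ‖wv hb‖ ≤ ε) (b2 : ‖wv (hb.D (1, 0))‖ ≤ E) (b3 : ‖wv (hb.D (0, 1))‖ ≤ E)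
    (z : HH) (hz : ∀ n, z n = P.st a b n) : ‖z‖ ≤ 12 * P.Cs ^ 2 * ε * E := by
  have c0 := P.Cs_pos
  have hE0 : 0 < E := hε.trans_le hE
  have q1 := P.lady_s P.s11_le ha hε hE a1 a2 a3
  have q2 := P.lady_s P.s12_le ha hε hE a1 a2 a3
  have q3 := P.lady_s P.s22_le ha hε hE a1 a2 a3
  have r1 := P.lady_s P.s11_le hb hε hE b1 b2 b3
  have r2 := P.lady_s P.s12_le hb hε hE b1 b2 b3
  have r3 := P.lady_s P.s22_le hb hε hE b1 b2 b3
  have k1 := ev_cont (P.Sm11 ha.W2)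
  have k2 := ev_cont (P.Sm12 ha.W2)
  have k3 := ev_cont (P.Sm22 ha.W2)
  have k4 := ev_cont (P.Sm11 hb.W2)
  have k5 := ev_cont (P.Sm12 hb.W2)
  have k6 := ev_cont (P.Sm22 hb.W2)
  have hst := P.st_Sm ha.W2 hb.W2
  have cst := ev_cont hst
  have hn : ‖z‖ ^ 2 = ∫ x, ‖ev (P.st a b) x‖ ^ 2 ∂mu := by
    rw [nsq, parseval hst]; exact tsum_congr (fun n => by rw [hz])
  set K := (3 * (P.Cs * ε) * (P.Cs * E)) ^ 2
  set f1 := ev (fun n => P.s11 n * a n)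
  set f2 := ev (fun n => P.s12 n * a n)
  set f3 := ev (fun n => P.s22 n * a n)
  set g1 := ev (fun n => P.s11 n * b n)
  set g2 := ev (fun n => P.s12 n * b n)
  set g3 := ev (fun n => P.s22 n * b n)
  have pw : ∀ x, ‖ev (P.st a b) x‖ ^ 2 ≤ 2 * (‖f1 x‖ ^ 4 + ‖g3 x‖ ^ 4 + (‖f3 x‖ ^ 4 + ‖g1 x‖ ^ 4)) + 4 * (‖f2 x‖ ^ 4 + ‖g2 x‖ ^ 4) := by
    intro x
    have e := P.ev_st ha.W2 hb.W2 x
    have h : ‖ev (P.st a b) x‖ ≤ ‖f1 x‖ * ‖g3 x‖ + ‖f3 x‖ * ‖g1 x‖ + 2 * (‖f2 x‖ * ‖g2 x‖) := by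
      rw [e]
      refine (norm_sub_le _ _).trans (add_le_add ((norm_add_le _ _).trans_eq ?_) (le_of_eq ?_))
      · rw [norm_mul, norm_mul]
      · simp [norm_mul, f2, g2]
    have h' := pow_le_pow_left₀ (norm_nonneg _) h 2
    refine h'.trans ?_
    set X := ‖f1 x‖ * ‖g3 x‖
    set Y := ‖f3 x‖ * ‖g1 x‖
    set Z := ‖f2 x‖ * ‖g2 x‖
    have x1 : X ^ 2 ≤ (‖f1 x‖ ^ 4 + ‖g3 x‖ ^ 4) / 2 := by simp only [X]; nlinarith [sq_nonneg (‖f1 x‖ ^ 2 - ‖g3 x‖ ^ 2)]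
    have x2 : Y ^ 2 ≤ (‖f3 x‖ ^ 4 + ‖g1 x‖ ^ 4) / 2 := by simp only [Y]; nlinarith [sq_nonneg (‖f3 x‖ ^ 2 - ‖g1 x‖ ^ 2)]
    have x3 : Z ^ 2 ≤ (‖f2 x‖ ^ 4 + ‖g2 x‖ ^ 4) / 2 := by simp only [Z]; nlinarith [sq_nonneg (‖f2 x‖ ^ 2 - ‖g2 x‖ ^ 2)]
    nlinarith [sq_nonneg (X - Y), sq_nonneg (X - Z), sq_nonneg (Y - Z)]
  have i : ∀ f : ℝ × ℝ → ℂ, Continuous f → Integrable (fun x => ‖f x‖ ^ 4) mu := fun f hf => mu_int (by fun_prop)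
  have tot : ‖z‖ ^ 2 ≤ 16 * K := by
    rw [hn]
    refine (integral_mono (mu_int (by fun_prop)) (mu_int (by fun_prop)) pw).trans ?_
    have j2 : ∀ f g : ℝ × ℝ → ℂ, Continuous f → Continuous g → ∫ x, (‖f x‖ ^ 4 + ‖g x‖ ^ 4) ∂mu = ∫ x, ‖f x‖ ^ 4 ∂mu + ∫ x, ‖g x‖ ^ 4 ∂mu :=
      fun f g hf hg => integral_add (i f hf) (i g hg)
    have e1 := integral_add (μ := mu) (f := fun x => 2 * (‖f1 x‖ ^ 4 + ‖g3 x‖ ^ 4 + (‖f3 x‖ ^ 4 + ‖g1 x‖ ^ 4))) (g := fun x => 4 * (‖f2 x‖ ^ 4 + ‖g2 x‖ ^ 4))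
      (mu_int (by fun_prop)) (mu_int (by fun_prop))
    have e2 := integral_add (μ := mu) (f := fun x => ‖f1 x‖ ^ 4 + ‖g3 x‖ ^ 4) (g := fun x => ‖f3 x‖ ^ 4 + ‖g1 x‖ ^ 4)
      (mu_int (by fun_prop)) (mu_int (by fun_prop))
    rw [e1, integral_const_mul, integral_const_mul, e2, j2 _ _ k1 k6, j2 _ _ k3 k4, j2 _ _ k2 k5]
    linarith
  have : ‖z‖ ^ 2 ≤ (12 * P.Cs ^ 2 * ε * E) ^ 2 := tot.trans_eq (by simp only [K]; ring)
  exact (pow_le_pow_iff_left₀ (norm_nonneg _) (by positivity) two_ne_zero).1 this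

end Par
end GMA

namespace GMA
open Filter Topology

/-! ### Part J : compactness of sequences of solutions -/

lemma wk_lim {z : ℕ → HH} {M : ℝ} (h : ∀ᶠ k in atTop, ‖z k‖ ≤ M) {f : Ix → ℂ} (hc : ∀ n, Tendsto (fun k => z k n) atTop (𝓝 (f n))) :
    ∃ z0 : HH, ∀ n, z0 n = f n := by
  have hs : Summable (fun n => ‖f n‖ ^ 2) := by
    refine summable_of_sum_le (c := M ^ 2) (fun n => by positivity) (fun s => ?_)
    have : Tendsto (fun k => ∑ n ∈ s, ‖z k n‖ ^ 2) atTop (𝓝 (∑ n ∈ s, ‖f n‖ ^ 2)) :=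
      tendsto_finset_sum _ (fun n _ => ((hc n).norm).pow 2)
    refine le_of_tendsto this ?_
    filter_upwards [h] with k hk
    refine ((sqSummable (z k)).sum_le_tsum s (fun n _ => by positivity)).trans ?_
    rw [← nsq]
    exact pow_le_pow_left₀ (norm_nonneg _) hk 2
  exact ⟨mk2 f hs, fun n => mk2_apply f hs n⟩

lemma Rapid.pp {x : Ix → ℂ} (h : Rapid x) : Rapid (pp x) :=
  h.mul (C := 1) (j := 0) (fun n => by
    have := w_pos n
    rw [Complex.norm_real, Real.norm_of_nonneg (by positivity)]
    have := inv_le_one_of_one_le₀ (one_le_w n)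
    have h2 : 0 ≤ (w n)⁻¹ := by positivity
    simpa using pow_le_one₀ (n := 2) h2 this)

namespace Par
variable (P : Par)

lemma w_pp (x : HH) (n) : (w n : ℂ) * pp x n = iw x n := by
  have h : (w n : ℂ) ≠ 0 := by exact_mod_cast (w_ne n)
  rw [iw_apply, pp]; push_cast; field_simp

lemma G_apply (x : HH) (n) : P.G x n = w n * (P.sA n * pp x n + 2⁻¹ * P.st (pp x) (pp x) n) + (if n = 0 then 1 else 0) * x n := by
  have h : (w n : ℂ) ≠ 0 := by exact_mod_cast (w_ne n)
  have e : TK P.Qk x x n = w n * P.st (pp x) (pp x) n := by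
    rw [TK_apply, st, ← tsum_mul_left]
    refine tsum_congr (fun m => ?_)
    simp only [Qk, pp, add_sub_cancel]; push_cast; ring
  rw [G, lp.coeFn_add, lp.coeFn_add, Pi.add_apply, Pi.add_apply, lp.coeFn_smul, Pi.smul_apply, e, dgA_apply, D0_apply, pp, smul_eq_mul]
  push_cast; field_simp; ring

lemma G_zero (x : HH) : P.G x 0 = x 0 := by
  rw [G_apply, sA_zero, st]
  have : ∀ m : Ix, P.sp m (0 - m) * pp x m * pp x (0 - m) = 0 := by
    intro m; simp [sp_anti]
  rw [tsum_congr this]; simp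

noncomputable def hh (t : ℝ) (Y : HH) (n : Ix) : ℂ := t * iw Y n + if n = 0 then ((P.a * P.b - P.c ^ 2 : ℝ) : ℂ) else 0

lemma Rapid_delta (c : ℂ) : Rapid (fun n => if n = 0 then c else 0) := by
  intro k
  refine ⟨‖c‖, fun n => ?_⟩
  by_cases h : n = 0
  · subst h; simp [w_zero]
  · simp [h]

lemma Rapid_iw {Y : HH} (hY : Rapid Y) : Rapid (iw Y) :=
  hY.mul (φ := fun n => ((w n)⁻¹ : ℝ)) (C := 1) (j := 0) (fun n => by
    have := w_pos n
    rw [Complex.norm_real, Real.norm_of_nonneg (by positivity)]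
    simpa using inv_le_one_of_one_le₀ (one_le_w n))

lemma Re_iw {Y : HH} (hY : Re Y) : Re (iw Y) := by
  intro n; rw [iw_apply, iw_apply, w_neg, hY n, map_mul, Complex.conj_ofReal]

lemma sol_of {x Y : HH} (hx : Rapid x) (hr : Re x) (hY : Rapid Y) (hYr : Re Y) (Y0 : Y 0 = 0) {t : ℝ} (h : P.G x = (t : ℂ) • Y) :
    P.Sol (pp x) (P.hh t Y) where
  rp := hx.pp
  re := pp_Re hr
  rh := ((Rapid_iw hY).smul _).add (Rapid_delta _)
  reh := by
    intro n
    simp only [hh, map_add, map_mul, Complex.conj_ofReal, Re_iw hYr n, neg_eq_zero]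
    by_cases hn : n = 0 <;> simp [hn]
  eq := by
    intro n
    have hw : (w n : ℂ) ≠ 0 := by exact_mod_cast (w_ne n)
    have h1 := congrArg (fun y : HH => y n) h
    simp only [lp.coeFn_smul, Pi.smul_apply, smul_eq_mul] at h1
    have h0 : (if n = 0 then (1 : ℂ) else 0) * x n = 0 := by
      by_cases hn : n = 0
      · subst hn
        rw [G_zero, Y0] at h1; simp [h1]
      · simp [hn]
    rw [G_apply, h0, add_zero] at h1
    simp only [hh, add_sub_cancel_right, iw_apply]
    push_cast
    field_simp
    linear_combination 2 * h1

lemma U_avg {x x' : HH} (z) : P.U11 (pp ((2⁻¹ : ℂ) • (x + x') : HH)) z = (P.U11 (pp x) z + P.U11 (pp x') z) / 2 ∧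
    P.U12 (pp ((2⁻¹ : ℂ) • (x + x') : HH)) z = (P.U12 (pp x) z + P.U12 (pp x') z) / 2 ∧
    P.U22 (pp ((2⁻¹ : ℂ) • (x + x') : HH)) z = (P.U22 (pp x) z + P.U22 (pp x') z) / 2 := by
  have key : ∀ φ : Ix → ℂ, (∀ n, ‖φ n‖ ≤ P.Cs * w n) → (ev (fun n => φ n * pp ((2⁻¹ : ℂ) • (x + x') : HH) n) z).re =
      ((ev (fun n => φ n * pp x n) z).re + (ev (fun n => φ n * pp x' n) z).re) / 2 := by
    intro φ hφ
    have : (fun n => φ n * pp ((2⁻¹ : ℂ) • (x + x') : HH) n) = fun n => ((2⁻¹ : ℝ) : ℂ) * (φ n * pp x n + φ n * pp x' n) := by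
      funext n; unfold pp; rw [lp.coeFn_smul, Pi.smul_apply, smul_eq_mul, lp.coeFn_add, Pi.add_apply]; push_cast; ring
    rw [this, ev_smul, ev_add ((pp_W2 x).mul hφ) ((pp_W2 x').mul hφ), Complex.re_ofReal_mul, Complex.add_re]; ring
  refine ⟨?_, ?_, ?_⟩
  · unfold U11; rw [key _ P.s11_le]; ring
  · unfold U12; rw [key _ P.s12_le]; ring
  · unfold U22; rw [key _ P.s22_le]; ring

lemma diff_est {x x' : HH} (hr : Re x) (hr' : Re x') {lam L : ℝ} (hl : 0 < lam) (he : P.Ell lam (pp x)) (he' : P.Ell lam (pp x'))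
    (hL : P.Upp L (pp x)) (hL' : P.Upp L (pp x')) (h0 : x 0 = x' 0) :
    ‖iw x - iw x'‖ ≤ 2 * (L / lam ^ 2) * ‖P.G x - P.G x'‖ := by
  have L0 : 0 < L := lt_of_lt_of_le hl ((he 0).h1.trans (hL 0).1)
  set z : HH := (2⁻¹ : ℂ) • (x + x')
  have zr : Re z := by
    intro n
    simp only [z, lp.coeFn_smul, lp.coeFn_add, Pi.smul_apply, Pi.add_apply, smul_eq_mul, hr n, hr' n, map_mul, map_add, map_inv₀]
    rw [show (starRingEnd ℂ) (2 : ℂ) = 2 from map_ofNat _ 2]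
  have ze : P.Ell lam (pp z) := by
    intro q s t
    obtain ⟨e1, e2, e3⟩ := P.U_avg (x := x) (x' := x') q
    rw [e1, e2, e3]
    have k1 := he q s t
    have k2 := he' q s t
    linarith
  have zL : P.Upp L (pp z) := by
    intro q
    obtain ⟨e1, e2, e3⟩ := P.U_avg (x := x) (x' := x') q
    rw [e1, e3]
    have k1 := hL q
    have k2 := hL' q
    constructor <;> linarith [k1.1, k1.2, k2.1, k2.2]
  have d0 : D0 (x - x') = 0 := by
    apply HH_ext; intro n
    rw [D0_apply]
    by_cases hn : n = 0
    · subst hn; simp [h0]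
    · simp [hn]
  have eG : P.G x - P.G x' = P.dgA (x - x') + TK P.Qk z (x - x') := by
    have : P.G x - P.G x' = P.dgA (x - x') + D0 (x - x') + (2⁻¹ : ℂ) • (TK P.Qk x x - TK P.Qk x' x') := by
      simp only [G, map_sub, smul_sub]; abel
    rw [this, d0, add_zero]
    congr 1
    simp only [z, map_smul, map_add, map_sub, ContinuousLinearMap.smul_apply, ContinuousLinearMap.add_apply]
    rw [P.Q_comm x' x]
    simp only [smul_sub, smul_add]; abel
  have k := P.LE2H zr hl ze zL (iw (x - x'))
  rw [LL_iw, ← eG] at k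
  have k0 : iw (x - x') 0 = 0 := by rw [iw_apply]; simp [h0]
  rw [k0, norm_zero, add_zero, map_sub] at k
  refine k.trans ?_
  have := iw_le (P.G x - P.G x')
  gcongr

lemma LL_wv (x : HH) {a : Ix → ℂ} (ha : Rapid a) (n) : P.LL x (wv ha) n = P.Lf (pp x) a n := by
  rw [LL_apply]
  have : (fun n => (((w n)⁻¹ : ℝ) : ℂ) * wv ha n) = a := by
    funext n
    have h : (w n : ℂ) ≠ 0 := by exact_mod_cast (w_ne n)
    rw [wv_apply]; push_cast; field_simp
  rw [this]

structure Sq (lam L : ℝ) (x : ℕ → HH) (t : ℕ → ℝ) (Y : HH) : Prop where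
  hl : 0 < lam
  rY : Rapid Y
  reY : Re Y
  Y0 : Y 0 = 0
  rx : ∀ k, Rapid (x k)
  re : ∀ k, Re (x k)
  el : ∀ k, P.Ell lam (pp (x k))
  up : ∀ k, P.Upp L (pp (x k))
  t1 : ∀ k, |t k| ≤ 1
  tc : CauchySeq t
  eq : ∀ k, P.G (x k) = (t k : ℂ) • Y

namespace Sq
variable {P} {lam L : ℝ} {x : ℕ → HH} {t : ℕ → ℝ} {Y : HH}

lemma Lpos (S : P.Sq lam L x t Y) : 0 < L := lt_of_lt_of_le S.hl ((S.el 0 0).h1.trans (S.up 0 0).1)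

lemma sol (S : P.Sq lam L x t Y) (k) : P.Sol (pp (x k)) (P.hh (t k) Y) := P.sol_of (S.rx k) (S.re k) S.rY S.reY S.Y0 (S.eq k)

lemma x0 (S : P.Sq lam L x t Y) (k) : x k 0 = 0 := by
  have := P.G_zero (x k)
  rw [S.eq k, lp.coeFn_smul, Pi.smul_apply, S.Y0] at this
  simpa using this.symm

lemma cauchy (S : P.Sq lam L x t Y) : ∃ v : HH, Tendsto (fun k => iw (x k)) atTop (𝓝 v) := by
  have L0 := S.Lpos
  apply cauchySeq_tendsto_of_complete
  rw [Metric.cauchySeq_iff]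
  intro ε hε
  set C := 2 * (L / lam ^ 2) * ‖Y‖ + 1
  have hl := S.hl
  have hC : 0 < C := by positivity
  obtain ⟨N, hN⟩ := Metric.cauchySeq_iff.1 S.tc (ε / C) (by positivity)
  refine ⟨N, fun k hk l hl' => ?_⟩
  have h1 := hN k hk l hl'
  rw [dist_eq_norm] at *
  have h2 := P.diff_est (S.re k) (S.re l) hl (S.el k) (S.el l) (S.up k) (S.up l) (by rw [S.x0, S.x0])
  rw [S.eq, S.eq, ← sub_smul, norm_smul, ← Complex.ofReal_sub, Complex.norm_real] at h2
  calc _ ≤ _ := h2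
    _ = (2 * (L / lam ^ 2) * ‖Y‖) * ‖t k - t l‖ := by ring
    _ ≤ C * ‖t k - t l‖ := by gcongr; simp [C]
    _ < C * (ε / C) := by gcongr
    _ = ε := by field_simp

/-- second derivatives of the gradient -/
noncomputable def y (S : P.Sq lam L x t Y) (e : ℝ × ℝ) (k : ℕ) : HH := wv ((S.rx k).pp.D e)
noncomputable def g (S : P.Sq lam L x t Y) (e : ℝ × ℝ) : HH := ((Rapid_iw S.rY).D e).toHH

lemma y_apply (S : P.Sq lam L x t Y) (e k n) : S.y e k n = dE e n * iw (x k) n := by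
  rw [y, wv_apply, D, ← w_pp]; ring

lemma g_apply (S : P.Sq lam L x t Y) (e n) : S.g e n = dE e n * iw Y n := rfl

lemma D_hh (S : P.Sq lam L x t Y) (e k n) : D e (P.hh (t k) Y) n = t k * D e (iw Y) n := by
  simp only [D, hh]
  by_cases hn : n = 0
  · subst hn; simp [dE_zero]
  · simp [hn]; ring

lemma LL_y (S : P.Sq lam L x t Y) (e k) : P.LL (x k) (S.y e k) = (t k : ℂ) • S.g e := by
  apply HH_ext; intro n
  rw [y, LL_wv, (S.sol k).L1, S.D_hh, lp.coeFn_smul, Pi.smul_apply, smul_eq_mul]; rfl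

lemma y_zero (S : P.Sq lam L x t Y) (e k) : S.y e k 0 = 0 := by rw [y_apply, dE_zero]; simp

lemma y_le (S : P.Sq lam L x t Y) (e k) : ‖S.y e k‖ ≤ 2 * (L / lam ^ 2) * ‖S.g e‖ := by
  have h := P.LE2H (S.re k) S.hl (S.el k) (S.up k) (S.y e k)
  have L0 := S.Lpos
  have l0 := S.hl
  rw [S.y_zero, norm_zero, add_zero, S.LL_y, norm_smul, Complex.norm_real] at h
  refine h.trans ?_
  have : ‖t k‖ * ‖S.g e‖ ≤ ‖S.g e‖ := mul_le_of_le_one_left (norm_nonneg _) (S.t1 k)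
  gcongr

lemma LL_cauchy (S : P.Sq lam L x t Y) (y : HH) : CauchySeq (fun k => P.LL (x k) y) := by
  obtain ⟨v, hv⟩ := S.cauchy
  have L0 := S.Lpos
  have c0 := P.Cs_pos
  rw [Metric.cauchySeq_iff]
  intro ε hε
  set η := ε / (16 * L * P.Cs)
  have hη : 0 < η := by positivity
  obtain ⟨s, hs⟩ := (cut_ev y hη).exists
  set C := 4 * P.Cs ^ 2 * (∑' n, ‖cut s y n‖) + 1
  have hC : 0 < C := by
    have : 0 ≤ ∑' n, ‖cut s y n‖ := tsum_nonneg (fun _ => norm_nonneg _)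
    positivity
  obtain ⟨N, hN⟩ := Metric.cauchySeq_iff.1 hv.cauchySeq (ε / (4 * C)) (by positivity)
  refine ⟨N, fun k hk l hl' => ?_⟩
  have h1 := hN k hk l hl'
  rw [dist_eq_norm] at *
  have b1 := P.LL_bd (S.re k) S.hl (S.el k) (S.up k) (y - cut s y)
  have b2 := P.LL_bd (S.re l) S.hl (S.el l) (S.up l) (y - cut s y)
  have b3 := P.LL_young (x k - x l) (cut s y) (cut_Sm s y)
  rw [map_sub iw] at b3
  have tot : P.LL (x k) y - P.LL (x l) y = P.LL (x k) (y - cut s y) - P.LL (x l) (y - cut s y) + TK P.Bk (x k - x l) (cut s y) := by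
    simp only [LL, map_sub, ContinuousLinearMap.add_apply, ContinuousLinearMap.sub_apply]; abel
  rw [tot]
  have n1 := norm_add_le (P.LL (x k) (y - cut s y) - P.LL (x l) (y - cut s y)) (TK P.Bk (x k - x l) (cut s y))
  have n2 := norm_sub_le (P.LL (x k) (y - cut s y)) (P.LL (x l) (y - cut s y))
  have m1 : 4 * L * P.Cs * ‖y - cut s y‖ ≤ ε / 4 := by
    calc _ ≤ 4 * L * P.Cs * η := by gcongr
      _ = ε / 4 := by simp only [η]; field_simp; norm_num
  have m3 : 4 * P.Cs ^ 2 * (∑' n, ‖cut s y n‖) * ‖iw (x k) - iw (x l)‖ ≤ ε / 4 := by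
    calc _ ≤ C * (ε / (4 * C)) := by
          apply mul_le_mul _ h1.le (norm_nonneg _) hC.le
          simp [C]
      _ = ε / 4 := by field_simp
  linarith

lemma y_conv (S : P.Sq lam L x t Y) (e) : ∃ y0 : HH, Tendsto (S.y e) atTop (𝓝 y0) := by
  obtain ⟨v, hv⟩ := S.cauchy
  have cv : ∀ n, Tendsto (fun k => iw (x k) n) atTop (𝓝 (v n)) := fun n => ((cd n).continuous.tendsto v).comp hv
  obtain ⟨y0, hy0⟩ := wk_lim (z := S.y e) (M := 2 * (L / lam ^ 2) * ‖S.g e‖) (f := fun n => dE e n * v n) (Eventually.of_forall (S.y_le e)) (fun n => by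
    simp only [S.y_apply]; exact (cv n).const_mul _)
  refine ⟨y0, ?_⟩
  have hc : ∀ n, Tendsto (fun k => (S.y e k - y0 : HH) n) atTop (𝓝 ((0 : HH) n)) := by
    intro n
    simp only [lp.coeFn_sub, Pi.sub_apply, S.y_apply, hy0, lp.coeFn_zero, Pi.zero_apply]
    rw [← sub_self (dE e n * v n)]
    exact ((cv n).const_mul _).sub tendsto_const_nhds
  set r : ℕ → HH := fun k => P.LL (x k) (S.y e k - y0)
  have hr : CauchySeq r := by
    have : r = fun k => (t k : ℂ) • S.g e - P.LL (x k) y0 := by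
      funext k; simp only [r, map_sub, S.LL_y]
    rw [this]
    obtain ⟨τ, hτ⟩ := cauchySeq_tendsto_of_complete S.tc
    obtain ⟨l, hl⟩ := cauchySeq_tendsto_of_complete (S.LL_cauchy y0)
    exact ((((Complex.continuous_ofReal.tendsto τ).comp hτ).smul_const (S.g e)).sub hl).cauchySeq
  obtain ⟨r0, hr0⟩ := cauchySeq_tendsto_of_complete hr
  have c0 := P.Cs_pos
  have r00 : r0 = 0 := by
    apply HH_ext; intro n
    have l1 : Tendsto (fun k => r k n) atTop (𝓝 (r0 n)) := ((cd n).continuous.tendsto r0).comp hr0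
    have w1 := Wk (fun m => P.sp m (n - m) * ((w m)⁻¹ * (w (n - m))⁻¹ : ℝ)) (C := 4 * P.Cs ^ 2) (by positivity) (fun m => by
      have := P.sp_le m (n - m)
      have a := w_pos m
      have b := w_pos (n - m)
      rw [norm_mul, Complex.norm_real, Real.norm_of_nonneg (by positivity)]
      calc _ ≤ 4 * P.Cs ^ 2 * (w m * w (n - m)) * ((w m)⁻¹ * (w (n - m))⁻¹) := by gcongr
        _ = _ := by field_simp) hv (z := fun k => S.y e k - y0) (z0 := 0) (M := 2 * (L / lam ^ 2) * ‖S.g e‖ + ‖y0‖)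
        (Eventually.of_forall (fun k => (norm_sub_le _ _).trans (add_le_add (S.y_le e k) le_rfl))) hc n
    have l2 : Tendsto (fun k => r k n) atTop (𝓝 0) := by
      have e1 : ∀ k, r k n = P.sA n * ((w n)⁻¹ : ℝ) * (S.y e k - y0 : HH) n +
          ∑' m, P.sp m (n - m) * ((w m)⁻¹ * (w (n - m))⁻¹ : ℝ) * iw (x k) m * (S.y e k - y0 : HH) (n - m) := by
        intro k
        simp only [r, LL, ContinuousLinearMap.add_apply, lp.coeFn_add, Pi.add_apply, dgA_apply, TK_apply]
        congr 1
        refine tsum_congr (fun m => ?_)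
        simp only [Bk, iw_apply]; push_cast; ring
      rw [funext e1]
      have := ((hc n).const_mul (P.sA n * ((w n)⁻¹ : ℝ))).add w1
      simpa using this
    rw [tendsto_nhds_unique l1 l2]; rfl
  rw [r00] at hr0
  rw [tendsto_iff_norm_sub_tendsto_zero]
  have b : ∀ k, ‖S.y e k - y0‖ ≤ 2 * (L / lam ^ 2) * ‖r k‖ := by
    intro k
    have h := P.LE2H (S.re k) S.hl (S.el k) (S.up k) (S.y e k - y0)
    have : (S.y e k - y0 : HH) 0 = 0 := by
      rw [lp.coeFn_sub, Pi.sub_apply, S.y_zero, hy0, dE_zero]; simp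
    rwa [this, norm_zero, add_zero] at h
  have := (hr0.norm).const_mul (2 * (L / lam ^ 2))
  simp only [norm_zero, mul_zero] at this
  exact squeeze_zero (fun _ => norm_nonneg _) b this

end Sq
end Par
end GMA

namespace GMA
open Filter Topology

/-! ### Part K : fourth order bound and closedness -/

noncomputable def hd (s : Finset Ix) (a : Ix → ℂ) (n : Ix) : ℂ := (if n ∈ s then 1 else 0) * a n
noncomputable def tl (s : Finset Ix) (a : Ix → ℂ) (n : Ix) : ℂ := (if n ∈ s then 0 else 1) * a n

lemma Rapid.hd {a : Ix → ℂ} (ha : Rapid a) (s) : Rapid (hd s a) :=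
  ha.mul (C := 1) (j := 0) (fun n => by split_ifs <;> simp)
lemma Rapid.tl {a : Ix → ℂ} (ha : Rapid a) (s) : Rapid (tl s a) :=
  ha.mul (C := 1) (j := 0) (fun n => by split_ifs <;> simp)

lemma hd_add_tl (s) (a : Ix → ℂ) (n) : a n = hd s a n + tl s a n := by
  unfold hd tl; split_ifs <;> simp

lemma wv_tl {a : Ix → ℂ} (ha : Rapid a) (s) : wv (ha.tl s) = wv ha - cut s (wv ha) := by
  apply HH_ext; intro n
  rw [lp.coeFn_sub, Pi.sub_apply, cut_apply, wv_apply, wv_apply, tl]; split_ifs <;> simp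

lemma wv_tl_le {a : Ix → ℂ} (ha : Rapid a) (s) : ‖wv (ha.tl s)‖ ≤ ‖wv ha‖ := by
  refine norm_le_of_le (fun n => ?_)
  rw [wv_apply, wv_apply, tl]; split_ifs
  · simp only [zero_mul, mul_zero, norm_zero]; exact norm_nonneg _
  · simp

lemma wv_D_tl_le {a : Ix → ℂ} (ha : Rapid a) (s) (e) : ‖wv ((ha.tl s).D e)‖ ≤ ‖wv (ha.D e)‖ := by
  refine norm_le_of_le (fun n => ?_)
  rw [wv_apply, wv_apply, D, D, tl]; split_ifs
  · simp only [zero_mul, mul_zero, norm_zero]; exact norm_nonneg _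
  · simp

lemma hd_l1 {a : Ix → ℂ} (ha : Rapid a) (s) : ∑' n, ‖(w n : ℂ) * hd s a n‖ ≤ s.card * ‖wv ha‖ := by
  rw [tsum_eq_sum (s := s)]
  · rw [← nsmul_eq_mul]
    refine Finset.sum_le_card_nsmul _ _ _ (fun n hn => ?_)
    refine le_trans (le_of_eq ?_) (HH_le (wv ha) n)
    rw [wv_apply, hd]; simp [hn]
  · intro n hn; simp [hd, hn]

namespace Par
variable (P : Par)

noncomputable def sv {a b : Ix → ℂ} (ha : Rapid a) (hb : Rapid b) : HH := mk2 (P.st a b) (P.st_Sm ha.W2 hb.W2).sq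
lemma sv_apply {a b : Ix → ℂ} (ha : Rapid a) (hb : Rapid b) (n) : P.sv ha hb n = P.st a b n := mk2_apply _ _ n

lemma sv_young {a b : Ix → ℂ} (ha : Rapid a) (hb : Rapid b) : ‖P.sv ha hb‖ ≤ 4 * P.Cs ^ 2 * (∑' n, ‖(w n : ℂ) * b n‖) * ‖wv ha‖ := by
  refine P.st_young (wv ha) b hb.W2 _ (fun n => ?_)
  rw [sv_apply]
  congr 1
  funext n
  have h : (w n : ℂ) ≠ 0 := by exact_mod_cast (w_ne n)
  rw [wv_apply]; push_cast; field_simp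

lemma sv_comm {a b : Ix → ℂ} (ha : Rapid a) (hb : Rapid b) : P.sv ha hb = P.sv hb ha := by
  apply HH_ext; intro n; rw [sv_apply, sv_apply, st_comm]

lemma sv_split {a b : Ix → ℂ} (ha : Rapid a) (hb : Rapid b) (s) :
    P.sv ha hb = P.sv (ha.hd s) hb + (P.sv (ha.tl s) (hb.hd s) + P.sv (ha.tl s) (hb.tl s)) := by
  apply HH_ext; intro n
  simp only [lp.coeFn_add, Pi.add_apply, sv_apply, st]
  rw [← (P.st_terms (ha.tl s).W2 (hb.hd s).W2 n).tsum_add (P.st_terms (ha.tl s).W2 (hb.tl s).W2 n),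
    ← (P.st_terms (ha.hd s).W2 hb.W2 n).tsum_add ((P.st_terms (ha.tl s).W2 (hb.hd s).W2 n).add (P.st_terms (ha.tl s).W2 (hb.tl s).W2 n))]
  refine tsum_congr (fun m => ?_)
  conv_lhs => rw [hd_add_tl s a m]
  conv_rhs => rw [← mul_add, ← hd_add_tl s b (n - m)]
  ring

lemma sv_bound {a b : Ix → ℂ} (ha : Rapid a) (hb : Rapid b) (s : Finset Ix) {M ε E : ℝ} (hε : 0 < ε) (hE : ε ≤ E)
    (a0 : ‖wv ha‖ ≤ M) (b0 : ‖wv hb‖ ≤ M)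
    (a1 : ‖wv ha - cut s (wv ha)‖ ≤ ε) (a2 : ‖wv (ha.D (1, 0))‖ ≤ E) (a3 : ‖wv (ha.D (0, 1))‖ ≤ E)
    (b1 : ‖wv hb - cut s (wv hb)‖ ≤ ε) (b2 : ‖wv (hb.D (1, 0))‖ ≤ E) (b3 : ‖wv (hb.D (0, 1))‖ ≤ E) :
    ‖P.sv ha hb‖ ≤ 8 * P.Cs ^ 2 * (s.card * M) * M + 12 * P.Cs ^ 2 * ε * E := by
  have c0 := P.Cs_pos
  have M0 : 0 ≤ M := (norm_nonneg _).trans a0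
  have t1 : ‖P.sv (ha.hd s) hb‖ ≤ 4 * P.Cs ^ 2 * (s.card * M) * M := by
    rw [sv_comm]
    refine (P.sv_young hb (ha.hd s)).trans ?_
    have := hd_l1 ha s
    have h2 : ∑' n, ‖(w n : ℂ) * GMA.hd s a n‖ ≤ s.card * M := this.trans (by gcongr)
    gcongr
  have t2 : ‖P.sv (ha.tl s) (hb.hd s)‖ ≤ 4 * P.Cs ^ 2 * (s.card * M) * M := by
    refine (P.sv_young (ha.tl s) (hb.hd s)).trans ?_
    have := hd_l1 hb s
    have h2 : ∑' n, ‖(w n : ℂ) * GMA.hd s b n‖ ≤ s.card * M := this.trans (by gcongr)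
    have h3 := (wv_tl_le ha s).trans a0
    gcongr
  have A1 : ‖wv (ha.tl s)‖ ≤ ε := by rw [wv_tl]; exact a1
  have B1 : ‖wv (hb.tl s)‖ ≤ ε := by rw [wv_tl]; exact b1
  have A2 := (wv_D_tl_le ha s (1, 0)).trans a2
  have A3 := (wv_D_tl_le ha s (0, 1)).trans a3
  have B2 := (wv_D_tl_le hb s (1, 0)).trans b2
  have B3 := (wv_D_tl_le hb s (0, 1)).trans b3
  have t3 : ‖P.sv (ha.tl s) (hb.tl s)‖ ≤ 12 * P.Cs ^ 2 * ε * E :=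
    P.lady_st (ha.tl s) (hb.tl s) hε hE A1 A2 A3 B1 B2 B3 (P.sv (ha.tl s) (hb.tl s)) (fun n => P.sv_apply (ha.tl s) (hb.tl s) n)
  rw [P.sv_split ha hb s]
  have n1 := norm_add_le (P.sv (ha.hd s) hb) (P.sv (ha.tl s) (hb.hd s) + P.sv (ha.tl s) (hb.tl s))
  have n2 := norm_add_le (P.sv (ha.tl s) (hb.hd s)) (P.sv (ha.tl s) (hb.tl s))
  linarith

lemma x_le {x : HH} (hx : Rapid x) (h0 : x 0 = 0) :
    ‖x‖ ≤ ‖wv ((hx.pp.D (1, 0)).D (1, 0))‖ + ‖wv ((hx.pp.D (0, 1)).D (0, 1))‖ := by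
  refine le_trans (norm_le_of_le (y := wv ((hx.pp.D (1, 0)).D (1, 0)) + wv ((hx.pp.D (0, 1)).D (0, 1))) (fun n => ?_)) (norm_add_le _ _)
  by_cases hn : n = 0
  · subst hn; rw [h0]; simp
  have hw := w_pos n
  have hw' : (w n : ℂ) ≠ 0 := by exact_mod_cast (w_ne n)
  have e : (wv ((hx.pp.D (1, 0)).D (1, 0)) + wv ((hx.pp.D (0, 1)).D (0, 1)) : HH) n =
      ((-((2 * Real.pi) ^ 2 * ((n.1 : ℝ) ^ 2 + (n.2 : ℝ) ^ 2) * (w n)⁻¹) : ℝ) : ℂ) * x n := by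
    rw [lp.coeFn_add, Pi.add_apply, wv_apply, wv_apply]
    simp only [D, dE_eq, pp]
    push_cast
    field_simp
    rw [Complex.I_sq]; ring
  have hle := w_le_of_ne hn
  have hpi := Real.pi_gt_three
  rw [e, norm_mul, Complex.norm_real, norm_neg, Real.norm_of_nonneg (by positivity)]
  refine le_mul_of_one_le_left (norm_nonneg _) ?_
  rw [← div_eq_mul_inv, one_le_div hw]
  have h0 : 0 ≤ (n.1 : ℝ) ^ 2 + (n.2 : ℝ) ^ 2 := by positivity
  have h2 : 2 ≤ (2 * Real.pi) ^ 2 := by nlinarith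
  exact hle.trans (mul_le_mul_of_nonneg_right h2 h0)

namespace Sq
variable {P} {lam L : ℝ} {x : ℕ → HH} {t : ℕ → ℝ} {Y : HH}

lemma tails (S : P.Sq lam L x t Y) (e) {ε : ℝ} (hε : 0 < ε) : ∀ᶠ s in atTop, ∀ᶠ k in atTop, ‖S.y e k - cut s (S.y e k)‖ ≤ ε := by
  obtain ⟨y0, hy⟩ := S.y_conv e
  filter_upwards [cut_ev y0 (half_pos hε)] with s hs
  filter_upwards [Metric.tendsto_nhds.1 hy (ε / 2) (half_pos hε)] with k hk
  rw [dist_eq_norm] at hk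
  have h1 : ‖(S.y e k - y0) - cut s (S.y e k - y0)‖ ≤ ‖S.y e k - y0‖ := by
    refine norm_le_of_le (fun n => ?_)
    rw [lp.coeFn_sub, Pi.sub_apply, cut_apply]; split_ifs <;> simp
  have e1 : S.y e k - cut s (S.y e k) = ((S.y e k - y0) - cut s (S.y e k - y0)) + (y0 - cut s y0) := by
    rw [map_sub]; abel
  rw [e1]
  have := norm_add_le ((S.y e k - y0) - cut s (S.y e k - y0)) (y0 - cut s y0)
  linarith

lemma yy_bound (S : P.Sq lam L x t Y) (e e' : ℝ × ℝ) (k) : ‖wv (((S.rx k).pp.D e').D e)‖ ≤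
    2 * (L / lam ^ 2) * (‖(((Rapid_iw S.rY).D e').D e).toHH‖ + ‖P.sv ((S.rx k).pp.D e) ((S.rx k).pp.D e')‖) := by
  have h := P.LE2H (S.re k) S.hl (S.el k) (S.up k) (wv (((S.rx k).pp.D e').D e))
  have L0 := S.Lpos
  have l0 := S.hl
  have z0 : wv (((S.rx k).pp.D e').D e) 0 = 0 := by rw [wv_apply, D, dE_zero]; simp
  have eq : P.LL (x k) (wv (((S.rx k).pp.D e').D e)) = (t k : ℂ) • (((Rapid_iw S.rY).D e').D e).toHH - P.sv ((S.rx k).pp.D e) ((S.rx k).pp.D e') := by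
    apply HH_ext; intro n
    rw [LL_wv, (S.sol k).L2, lp.coeFn_sub, Pi.sub_apply, lp.coeFn_smul, Pi.smul_apply, smul_eq_mul, sv_apply]
    congr 1
    have : D e' (P.hh (t k) Y) = fun n => t k * D e' (iw Y) n := funext (S.D_hh e' k)
    rw [this]
    simp only [D, Rapid.toHH, mk2_apply]; ring
  rw [z0, norm_zero, add_zero, eq] at h
  refine h.trans ?_
  have h1 := norm_sub_le ((t k : ℂ) • (((Rapid_iw S.rY).D e').D e).toHH) (P.sv ((S.rx k).pp.D e) ((S.rx k).pp.D e'))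
  rw [norm_smul, Complex.norm_real] at h1
  have h2 : ‖t k‖ * ‖(((Rapid_iw S.rY).D e').D e).toHH‖ ≤ ‖(((Rapid_iw S.rY).D e').D e).toHH‖ := mul_le_of_le_one_left (norm_nonneg _) (S.t1 k)
  have h3 := h1.trans (add_le_add h2 le_rfl)
  gcongr

lemma bounded (S : P.Sq lam L x t Y) : ∃ M, ∀ᶠ k in atTop, ‖x k‖ ≤ M := by
  have L0 := S.Lpos
  have l0 := S.hl
  have c0 := P.Cs_pos
  set κ := L / lam ^ 2
  have κ0 : 0 < κ := by positivity
  set ε := 1 / (192 * κ * P.Cs ^ 2 + 1)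
  have hε : 0 < ε := by positivity
  have hε1 : ε ≤ 1 := by
    simp only [ε]; rw [div_le_one (by positivity)]; nlinarith [mul_pos κ0 (pow_pos c0 2)]
  have hε2 : 192 * κ * P.Cs ^ 2 * ε ≤ 1 := by
    simp only [ε]; rw [mul_one_div, div_le_one (by positivity)]; linarith
  obtain ⟨s, s1, s2⟩ := ((S.tails (1, 0) hε).and (S.tails (0, 1) hε)).exists
  set M := 2 * κ * ‖S.g (1, 0)‖ + 2 * κ * ‖S.g (0, 1)‖
  set B := ‖(((Rapid_iw S.rY).D (1, 0)).D (1, 0)).toHH‖ + ‖(((Rapid_iw S.rY).D (0, 1)).D (0, 1)).toHH‖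
    + ‖(((Rapid_iw S.rY).D (1, 0)).D (0, 1)).toHH‖ + ‖(((Rapid_iw S.rY).D (0, 1)).D (1, 0)).toHH‖ with hB
  refine ⟨2 * (1 + 2 * κ * (B + 4 * (8 * P.Cs ^ 2 * (s.card * M) * M))), ?_⟩
  filter_upwards [s1, s2] with k k1 k2
  have m1 : ‖S.y (1, 0) k‖ ≤ M := (S.y_le (1, 0) k).trans (by simp only [M]; linarith [mul_nonneg κ0.le (norm_nonneg (S.g (0, 1)))])
  have m2 : ‖S.y (0, 1) k‖ ≤ M := (S.y_le (0, 1) k).trans (by simp only [M]; linarith [mul_nonneg κ0.le (norm_nonneg (S.g (1, 0)))])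
  have y11 := S.yy_bound (1, 0) (1, 0) k
  have y22 := S.yy_bound (0, 1) (0, 1) k
  have y12 := S.yy_bound (1, 0) (0, 1) k
  have y21 := S.yy_bound (0, 1) (1, 0) k
  set N11 := ‖wv (((S.rx k).pp.D (1, 0)).D (1, 0))‖
  set N22 := ‖wv (((S.rx k).pp.D (0, 1)).D (0, 1))‖
  set N12 := ‖wv (((S.rx k).pp.D (0, 1)).D (1, 0))‖
  set N21 := ‖wv (((S.rx k).pp.D (1, 0)).D (0, 1))‖
  have p11 : 0 ≤ N11 := norm_nonneg _
  have p22 : 0 ≤ N22 := norm_nonneg _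
  have p12 : 0 ≤ N12 := norm_nonneg _
  have p21 : 0 ≤ N21 := norm_nonneg _
  set E := 1 + N11 + N22 + N12 + N21 with hE
  have hεE : ε ≤ E := by linarith
  have e11 : N11 ≤ E := by linarith
  have e22 : N22 ≤ E := by linarith
  have e12 : N12 ≤ E := by linarith
  have e21 : N21 ≤ E := by linarith
  have v11 := P.sv_bound ((S.rx k).pp.D (1, 0)) ((S.rx k).pp.D (1, 0)) s hε hεE m1 m1 k1 e11 e21 k1 e11 e21
  have v22 := P.sv_bound ((S.rx k).pp.D (0, 1)) ((S.rx k).pp.D (0, 1)) s hε hεE m2 m2 k2 e12 e22 k2 e12 e22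
  have v12 := P.sv_bound ((S.rx k).pp.D (1, 0)) ((S.rx k).pp.D (0, 1)) s hε hεE m1 m2 k1 e11 e21 k2 e12 e22
  have v21 := P.sv_bound ((S.rx k).pp.D (0, 1)) ((S.rx k).pp.D (1, 0)) s hε hεE m2 m1 k2 e12 e22 k1 e11 e21
  have hx := x_le (S.rx k) (S.x0 k)
  change ‖x k‖ ≤ N11 + N22 at hx
  set V := 8 * P.Cs ^ 2 * (s.card * M) * M + 12 * P.Cs ^ 2 * ε * E with hV
  have f11 := y11.trans (mul_le_mul_of_nonneg_left (add_le_add_right v11 _) (by positivity))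
  have f22 := y22.trans (mul_le_mul_of_nonneg_left (add_le_add_right v22 _) (by positivity))
  have f12 := y12.trans (mul_le_mul_of_nonneg_left (add_le_add_right v12 _) (by positivity))
  have f21 := y21.trans (mul_le_mul_of_nonneg_left (add_le_add_right v21 _) (by positivity))
  have tot : E ≤ 1 + 2 * κ * (B + 4 * V) := by rw [hE, hB]; linarith
  have E0 : 0 ≤ E := by linarith
  have q : 2 * κ * (4 * (12 * P.Cs ^ 2 * ε * E)) ≤ E / 2 := by
    have := mul_le_mul_of_nonneg_right hε2 E0
    linarith
  have : E ≤ 2 * (1 + 2 * κ * (B + 4 * (8 * P.Cs ^ 2 * (s.card * M) * M))) := by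
    rw [hV] at tot; linarith
  linarith

lemma closed (S : P.Sq lam L x t Y) {τ : ℝ} (hτ : Tendsto t atTop (𝓝 τ)) : ∃ x' : HH, Re x' ∧ P.G x' = (τ : ℂ) • Y ∧ P.Ell lam (pp x') := by
  obtain ⟨v, hv⟩ := S.cauchy
  obtain ⟨M, hM⟩ := S.bounded
  have c0 := P.Cs_pos
  have cv : ∀ n, Tendsto (fun k => iw (x k) n) atTop (𝓝 (v n)) := fun n => ((cd n).continuous.tendsto v).comp hv
  have exk : ∀ k n, x k n = w n * iw (x k) n := by
    intro k n
    have h : (w n : ℂ) ≠ 0 := by exact_mod_cast (w_ne n)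
    rw [iw_apply]; push_cast; field_simp
  obtain ⟨x', hx'⟩ := wk_lim hM (f := fun n => w n * v n) (fun n => by
    simp only [exk]; exact (cv n).const_mul _)
  have cx : ∀ n, Tendsto (fun k => x k n) atTop (𝓝 (x' n)) := fun n => by
    simp only [exk, hx']; exact (cv n).const_mul _
  have hiw : iw x' = v := by
    apply HH_ext; intro n
    have h : (w n : ℂ) ≠ 0 := by exact_mod_cast (w_ne n)
    rw [iw_apply, hx']; push_cast; field_simp
  refine ⟨x', ?_, ?_, ?_⟩
  · intro n
    have h1 := cx (-n)
    simp only [(S.re _) n] at h1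
    exact tendsto_nhds_unique h1 ((Complex.continuous_conj.tendsto _).comp (cx n))
  · apply HH_ext; intro n
    have l1 : Tendsto (fun k => P.G (x k) n) atTop (𝓝 (((τ : ℂ) • Y : HH) n)) := by
      simp only [S.eq, lp.coeFn_smul, Pi.smul_apply, smul_eq_mul]
      exact ((Complex.continuous_ofReal.tendsto τ).comp hτ).mul_const _
    refine tendsto_nhds_unique ?_ l1
    have est : ∀ x : HH, P.st (pp x) (pp x) n = ∑' m, P.sp m (n - m) * ((w m)⁻¹ * (w (n - m))⁻¹ : ℝ) * iw x m * iw x (n - m) := by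
      intro x
      rw [st, pp_eq]
      refine tsum_congr (fun m => ?_)
      push_cast; ring
    have w1 := Wk (fun m => P.sp m (n - m) * ((w m)⁻¹ * (w (n - m))⁻¹ : ℝ)) (C := 4 * P.Cs ^ 2) (by positivity) (fun m => by
      have := P.sp_le m (n - m)
      have a := w_pos m
      have b := w_pos (n - m)
      rw [norm_mul, Complex.norm_real, Real.norm_of_nonneg (by positivity)]
      calc _ ≤ 4 * P.Cs ^ 2 * (w m * w (n - m)) * ((w m)⁻¹ * (w (n - m))⁻¹) := by gcongr
        _ = _ := by field_simp) hv (z := fun k => iw (x k)) (z0 := v) (M := M)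
        (hM.mono (fun k hk => (iw_le _).trans hk)) cv n
    have l2 : Tendsto (fun k => P.st (pp (x k)) (pp (x k)) n) atTop (𝓝 (P.st (pp x') (pp x') n)) := by
      simp only [est, hiw]; exact w1
    simp only [G_apply]
    refine (Tendsto.const_mul _ ((Tendsto.const_mul _ ?_).add (l2.const_mul _))).add ((cx n).const_mul _)
    exact (cx n).const_mul _
  · have key : ∀ φ : Ix → ℂ, (∀ n, ‖φ n‖ ≤ P.Cs * w n) → ∀ z, Tendsto (fun k => (ev (fun n => φ n * pp (x k) n) z).re) atTop
        (𝓝 (ev (fun n => φ n * pp x' n) z).re) := by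
      intro φ hφ z
      refine (Complex.continuous_re.tendsto _).comp ?_
      let c : HH := mk2 (fun n => (((w n)⁻¹ : ℝ) : ℂ)) (summable_w.congr (fun n => by
        rw [Complex.norm_real, Real.norm_of_nonneg (inv_nonneg.2 (w_pos n).le)]))
      have e1 : ∀ x : HH, ev (fun n => φ n * pp x n) z = ∑' m, (φ (-m) * ((w m)⁻¹ : ℝ) * ex (-m) z) * c m * x (0 - m) := by
        intro x
        unfold ev
        rw [← (Equiv.neg Ix).tsum_eq]
        refine tsum_congr (fun m => ?_)
        simp only [Equiv.neg_apply, pp, w_neg, zero_sub, c, mk2_apply]; push_cast; ring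
      simp only [e1]
      refine Wk _ c0.le (fun m => ?_) tendsto_const_nhds hM cx 0
      have a := w_pos m
      rw [norm_mul, norm_mul, ex_norm, mul_one, Complex.norm_real, Real.norm_of_nonneg (by positivity)]
      have := hφ (-m)
      rw [w_neg] at this
      calc _ ≤ P.Cs * w m * (w m)⁻¹ := by gcongr
        _ = _ := by field_simp
    intro z s r
    have k1 := ((key _ P.s11_le z).const_add P.a)
    have k2 := ((key _ P.s12_le z).const_add P.c)
    have k3 := ((key _ P.s22_le z).const_add P.b)
    refine le_of_tendsto_of_tendsto' tendsto_const_nhds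
      (((k1.mul_const (s ^ 2)).add (((k2.const_mul (2)).mul_const s).mul_const r)).add (k3.mul_const (r ^ 2))) (fun k => ?_)
    have := S.el k z s r
    unfold U11 U12 U22 at this
    linarith

end Sq
end Par
end GMA

namespace GMA
open Filter Topology

/-! ### Part M : continuity method -/

namespace Par
variable (P : Par)

/-- uniform data bounds along the continuity path -/
structure Dat (fm N : ℝ) (Y : HH) : Prop where
  hfm : 0 < fm
  hN : 0 ≤ N
  rY : Rapid Y
  reY : Re Y
  Y0 : Y 0 = 0
  b0 : ∀ t ∈ Set.Icc (0 : ℝ) 1, ∀ z, fm ≤ R (P.hh t Y) z ∧ R (P.hh t Y) z ≤ N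
  b1 : ∀ t ∈ Set.Icc (0 : ℝ) 1, ∀ z, |R (D (1, 0) (P.hh t Y)) z| ≤ N ∧ |R (D (0, 1) (P.hh t Y)) z| ≤ N
  b2 : ∀ t ∈ Set.Icc (0 : ℝ) 1, ∀ z, |R (D (1, 0) (D (1, 0) (P.hh t Y))) z| ≤ N ∧
    |R (D (0, 1) (D (0, 1) (P.hh t Y))) z| ≤ N

def good (Y : HH) : Set ℝ := {t | ∃ x : HH, Re x ∧ P.G x = (t : ℂ) • Y ∧ ∃ lam, 0 < lam ∧ P.Ell lam (pp x)}

lemma rapid_smulY {Y : HH} (h : Rapid Y) (t : ℝ) : Rapid (((t : ℂ) • Y : HH) : Ix → ℂ) := h.smul _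

lemma good_zero (Y : HH) : (0 : ℝ) ∈ P.good Y := by
  refine ⟨0, fun n => by simp, ?_, P.lamA, P.lamA_pos, fun z => ?_⟩
  · simp [G]
  · have e : P.U11 (pp (0 : HH)) z = P.a ∧ P.U12 (pp (0 : HH)) z = P.c ∧ P.U22 (pp (0 : HH)) z = P.b := by
      simp [U11, U12, U22, pp, ev]
    rw [e.1, e.2.1, e.2.2]; exact P.lowA

lemma Dat.closed {fm N : ℝ} {Y : HH} (d : P.Dat fm N Y) : IsClosed (P.good Y ∩ Set.Icc 0 1) := by
  obtain ⟨L, lam0, hL, hlam0, hC⟩ := P.C2 d.hfm d.hN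
  apply IsSeqClosed.isClosed
  intro t τ ht hτ
  refine ⟨?_, isClosed_Icc.mem_of_tendsto hτ (Eventually.of_forall fun k => (ht k).2)⟩
  choose x hr he lam hl el using fun k => (ht k).1
  have rx : ∀ k, Rapid (x k) := fun k => P.regularity (hr k) (hl k) (el k) (by rw [he k]; exact rapid_smulY d.rY _)
  have hh := fun k => hC _ _ (P.sol_of (rx k) (hr k) d.rY d.reY d.Y0 (he k)) (lam k) (hl k) (el k)
    (d.b0 _ (ht k).2) (d.b1 _ (ht k).2) (d.b2 _ (ht k).2)
  have S : P.Sq lam0 L x t Y :=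
    { hl := hlam0, rY := d.rY, reY := d.reY, Y0 := d.Y0, rx := rx, re := hr, el := fun k => (hh k).2,
      up := fun k => (hh k).1, t1 := fun k => by rw [abs_of_nonneg (ht k).2.1]; exact (ht k).2.2,
      tc := hτ.cauchySeq, eq := he }
  obtain ⟨x', h1, h2, h3⟩ := S.closed hτ
  exact ⟨x', h1, h2, lam0, hlam0, h3⟩

lemma Dat.exist {fm N : ℝ} {Y : HH} (d : P.Dat fm N Y) :
    ∃ x : HH, Rapid x ∧ Re x ∧ P.G x = ((1 : ℝ) : ℂ) • Y ∧ ∃ lam, 0 < lam ∧ P.Ell lam (pp x) := by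
  have key : Set.Icc (0 : ℝ) 1 ⊆ P.good Y := by
    refine IsClosed.Icc_subset_of_forall_exists_gt d.closed (P.good_zero Y) ?_
    rintro t ⟨⟨x, hr, he, lam, hl, el⟩, ht⟩ y hy
    have o := P.openness hr hl el
    rw [he] at o
    have c : Tendsto (fun s : ℝ => (s : ℂ) • Y) (𝓝[>] t) (𝓝 ((t : ℂ) • Y)) := by
      have : Continuous (fun s : ℝ => (s : ℂ) • Y) := by fun_prop
      exact this.continuousAt.tendsto.mono_left nhdsWithin_le_nhds
    have h1 := c.eventually o
    have h2 : ∀ᶠ s in 𝓝[>] t, s ∈ Set.Ioc t y := Ioc_mem_nhdsGT hy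
    obtain ⟨s, hs, hs2⟩ := (h1.and h2).exists
    obtain ⟨x', a1, a2, a3⟩ := hs (Re_smul d.reY s)
    exact ⟨s, ⟨x', a1, a2, lam / 2, by positivity, a3⟩, hs2⟩
  obtain ⟨x, hr, he, lam, hl, el⟩ := key (Set.right_mem_Icc.2 zero_le_one)
  exact ⟨x, P.regularity hr hl el (by rw [he]; exact rapid_smulY d.rY _), hr, he, lam, hl, el⟩

end Par

lemma R_le_norm {a : Ix → ℂ} (ha : Sm a) (z) : |R a z| ≤ ∑' n, ‖a n‖ :=
  (Complex.abs_re_le_norm _).trans (ev_norm_le ha z)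

lemma R_hasFDerivAt {a : Ix → ℂ} (ha : Rapid a) (z : ℝ × ℝ) :
    HasFDerivAt (R a) (Complex.reCLM.comp ((ContinuousLinearMap.fst ℝ ℝ ℝ).smulRight (ev (fun n => d1 n * a n) z)
      + (ContinuousLinearMap.snd ℝ ℝ ℝ).smulRight (ev (fun n => d2 n * a n) z))) z :=
  Complex.reCLM.hasFDerivAt.comp z (hasFDerivAt_ev ha z)

lemma pdx_R {a : Ix → ℂ} (ha : Rapid a) : pdx (R a) = R (D (1, 0) a) := by
  funext z
  have e : (fun n => d1 n * a n) = D (1, 0) a := by funext n; simp [D, dE]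
  unfold pdx; rw [(R_hasFDerivAt ha z).fderiv, e]
  simp [R]

lemma pdy_R {a : Ix → ℂ} (ha : Rapid a) : pdy (R a) = R (D (0, 1) a) := by
  funext z
  have e : (fun n => d2 n * a n) = D (0, 1) a := by funext n; simp [D, dE]
  unfold pdy; rw [(R_hasFDerivAt ha z).fderiv, e]
  simp [R]

lemma R_contDiff {a : Ix → ℂ} (ha : Rapid a) : ContDiff ℝ (⊤ : ℕ∞) (R a) :=
  Complex.reCLM.contDiff.comp (contDiff_ev ha)

lemma R_biper (a : Ix → ℂ) : Biperiodic (R a) := fun x y => by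
  constructor
  · simpa using R_per a (x, y) (1, 0)
  · simpa using R_per a (x, y) (0, 1)

lemma posDef_of_low {lam A B C : ℝ} (hl : 0 < lam) (h : Low lam A B C) : (!![A, B; B, C]).PosDef := by
  apply Matrix.PosDef.of_dotProduct_mulVec_pos
  · ext i j; fin_cases i <;> fin_cases j <;> simp
  · intro x hx
    have := h (x 0) (x 1)
    have h2 : 0 < x 0 ^ 2 + x 1 ^ 2 := by
      by_contra hc
      have e0 : x 0 = 0 := by nlinarith [sq_nonneg (x 0), sq_nonneg (x 1)]
      have e1 : x 1 = 0 := by nlinarith [sq_nonneg (x 0), sq_nonneg (x 1)]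
      apply hx; ext i; fin_cases i <;> simp [e0, e1]
    have h3 := mul_pos hl h2
    simp [Matrix.mulVec, dotProduct, Fin.sum_univ_two]
    nlinarith

/-- the data for the continuity method -/
lemma Par.dat (P : Par) {f : ℝ × ℝ → ℝ} (hf : ContDiff ℝ (⊤ : ℕ∞) f) (hp : Biperiodic f) (hpos : ∀ z, 0 < f z)
    (hintg : torusInt (fun z => f z - P.a * P.b + P.c ^ 2) = 0) :
    ∃ fm N Y, P.Dat fm N Y ∧ ∀ z, R (P.hh 1 Y) z = f z := by
  obtain ⟨b, rb, reb, hb⟩ := fourier_smooth hf hp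
  set d : ℝ := P.a * P.b - P.c ^ 2 with hd
  have dpos : 0 < d := P.hd
  set v : Ix → ℂ := fun n => b n - if n = 0 then (d : ℂ) else 0 with hv
  have rv : Rapid v := by
    have := rb.add ((Par.Rapid_delta (d : ℂ)).smul (-1))
    convert this using 2
    simp only [v]; ring
  have b0 : b 0 = d := by
    have i1 := int_ev rb.Sm
    have i2 : ∫ z, f z ∂mu = d := by
      have c0 : Continuous f := hf.continuous
      have := mu_eq (f := fun z => f z - P.a * P.b + P.c ^ 2) (by fun_prop)
      unfold torusInt at hintg
      rw [hintg] at this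
      have e : (fun z => f z - P.a * P.b + P.c ^ 2) = fun z => f z - d := by funext z; simp only [hd]; ring
      have m1 : ∫ z : ℝ × ℝ, d ∂mu = d := by
        rw [mu_eq continuous_const]; simp
      rw [e, integral_sub (mu_int c0) (mu_int continuous_const), m1] at this
      linarith
    rw [← i1, show ev b = fun z => (f z : ℂ) from funext hb]
    rw [integral_complex_ofReal, i2]
  have rwv : Rapid (fun n => (w n : ℂ) * v n) := rv.mul (C := 1) (j := 1) (fun n => by
    rw [Complex.norm_real, Real.norm_of_nonneg (w_pos n).le]; simp)
  set Y : HH := rwv.toHH with hY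
  have Yn : ∀ n, Y n = (w n : ℂ) * v n := fun n => rfl
  have iwn : ∀ n, iw Y n = v n := fun n => by
    rw [iw_apply, Yn, ← mul_assoc, ← Complex.ofReal_mul, inv_mul_cancel₀ (w_ne n)]; simp
  have hhn : ∀ t n, P.hh t Y n = t * b n + ((1 - t : ℝ) : ℂ) * (if n = 0 then (d : ℂ) else 0) := by
    intro t n
    unfold Par.hh; rw [iwn]; simp only [hv, ← hd]
    push_cast; ring
  have Rb : ∀ z, R b z = f z := fun z => by unfold R; rw [hb]; simp
  have Rh : ∀ t z, R (P.hh t Y) z = t * f z + (1 - t) * d := by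
    intro t z
    rw [show P.hh t Y = _ from funext (hhn t), R_add (rb.Sm.smul _) ((Par.Sm_delta _).smul _), R_smul, R_smul, Rb]
    congr 2
    unfold R; rw [Par.ev_delta]; simp
  have Dh : ∀ t e, D e (P.hh t Y) = fun n => (t : ℂ) * D e b n := by
    intro t e; funext n
    unfold D; rw [hhn]
    by_cases h : n = 0
    · rw [h, Par.dE_zero]; simp
    · simp [h]; ring
  have DDh : ∀ t e, D e (D e (P.hh t Y)) = fun n => (t : ℂ) * D e (D e b) n := by
    intro t e; rw [Dh]; funext n; simp only [D]; ring
  obtain ⟨z0, hz0⟩ := exists_max (rb.smul (-1)).Sm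
  have hmin : ∀ z, f z0 ≤ f z := by
    intro z
    have := hz0 z
    have k := fun z => R_smul b (-1) z
    push_cast at k
    rw [k, k, Rb, Rb] at this; linarith
  obtain ⟨M0, h0⟩ : ∃ M, ∀ z, |f z| ≤ M := ⟨_, fun z => by rw [← Rb]; exact R_le_norm rb.Sm z⟩
  have hD : ∀ e, ∃ M, ∀ z, |R (D e b) z| ≤ M := fun e => ⟨_, R_le_norm (rb.D e).Sm⟩
  have hDD : ∀ e, ∃ M, ∀ z, |R (D e (D e b)) z| ≤ M := fun e => ⟨_, R_le_norm ((rb.D e).D e).Sm⟩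
  choose M1 hM1 using hD
  choose M2 hM2 using hDD
  have p0 : 0 ≤ M0 := (abs_nonneg _).trans (h0 0)
  have p1 : ∀ e, 0 ≤ M1 e := fun e => (abs_nonneg _).trans (hM1 e 0)
  have p2 : ∀ e, 0 ≤ M2 e := fun e => (abs_nonneg _).trans (hM2 e 0)
  have q1 := p1 (1, 0)
  have q2 := p1 (0, 1)
  have q3 := p2 (1, 0)
  have q4 := p2 (0, 1)
  have sc : ∀ t ∈ Set.Icc (0 : ℝ) 1, ∀ r M : ℝ, |r| ≤ M → |t * r| ≤ M := by
    intro t ht r M h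
    rw [abs_mul, abs_of_nonneg ht.1]
    exact (mul_le_of_le_one_left (abs_nonneg _) ht.2).trans h
  refine ⟨min (f z0) d, d + M0 + M1 (1, 0) + M1 (0, 1) + M2 (1, 0) + M2 (0, 1), Y, ⟨lt_min (hpos _) dpos, by positivity, rwv, ?_, ?_, ?_, ?_, ?_⟩, ?_⟩
  · intro n
    rw [Yn, Yn, w_neg, map_mul, Complex.conj_ofReal]
    simp only [hv, map_sub, reb n, neg_eq_zero]
    split_ifs <;> simp
  · rw [Yn]; simp [hv, b0]
  · intro t ht z
    rw [Rh]
    have a1 := min_le_left (f z0) d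
    have a2 := min_le_right (f z0) d
    have a3 := hmin z
    have a4 := (abs_le.1 (h0 z)).2
    constructor
    · nlinarith [mul_le_mul_of_nonneg_left (a1.trans a3) ht.1, mul_le_mul_of_nonneg_left a2 (sub_nonneg.2 ht.2)]
    · have := (abs_le.1 (sc t ht _ _ (h0 z))).2
      nlinarith [ht.1, ht.2]
  · intro t ht z
    rw [Dh, Dh, R_smul, R_smul]
    exact ⟨(sc t ht _ _ (hM1 _ z)).trans (by linarith), (sc t ht _ _ (hM1 _ z)).trans (by linarith)⟩
  · intro t ht z
    rw [DDh, DDh, R_smul, R_smul]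
    exact ⟨(sc t ht _ _ (hM2 _ z)).trans (by linarith), (sc t ht _ _ (hM2 _ z)).trans (by linarith)⟩
  · intro z; rw [Rh]; ring

end GMA

/-- Existence of solutions to the generalized Monge–Ampère equation on the 2-torus,
given the necessary normalization `∫ (e^F - ab + c²) = 0`. -/
theorem gma_existence (a b c l11 l12 l22 m11 m12 m22 : ℝ)
    (hpd : (!![a, c; c, b]).PosDef)
    (h1 : m11 * l22 = 0)
    (h2 : l11 * l22 - l12 ^ 2 = 0)
    (h3 : m11 * m22 - m12 ^ 2 = 0)
    (h4 : l11 * m22 + l22 * m11 - 2 * l12 * m12 = 0)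
    (F : ℝ × ℝ → ℝ) (hF : ContDiff ℝ (⊤ : ℕ∞) F) (hFper : Biperiodic F)
    (hnorm : torusInt (fun z => Real.exp (F z) - a * b + c ^ 2) = 0) :
    ∃ p : ℝ × ℝ → ℝ, ContDiff ℝ (⊤ : ℕ∞) p ∧ Biperiodic p ∧
      (∀ z : ℝ × ℝ,
        (a + pdx (pdx p) z - l11 * pdx p z - m11 * pdy p z) *
            (b + pdy (pdy p) z - l22 * pdx p z - m22 * pdy p z) -
          (c + pdy (pdx p) z - l12 * pdx p z - m12 * pdy p z) ^ 2 = Real.exp (F z)) ∧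
      (∀ z : ℝ × ℝ,
        (!![a + pdx (pdx p) z - l11 * pdx p z - m11 * pdy p z,
            c + pdy (pdx p) z - l12 * pdx p z - m12 * pdy p z;
            c + pdy (pdx p) z - l12 * pdx p z - m12 * pdy p z,
            b + pdy (pdy p) z - l22 * pdx p z - m22 * pdy p z]).PosDef) := by
  have ha : 0 < a := by simpa using hpd.diag_pos (i := 0)
  have hd : 0 < a * b - c ^ 2 := by
    have := hpd.det_pos
    rw [Matrix.det_fin_two] at this
    simp at this
    nlinarith
  let P : GMA.Par := ⟨a, b, c, l11, l12, l22, m11, m12, m22, ha, hd, h1, h2, h3, h4⟩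
  obtain ⟨fm, N, Y, dat, hR⟩ := P.dat (f := fun z => Real.exp (F z)) hF.exp
    (fun x y => by simp only [(hFper x y).1, (hFper x y).2, and_self]) (fun z => Real.exp_pos _) hnorm
  obtain ⟨x, rx, re, eq, lam, hl, el⟩ := dat.exist
  have S := P.sol_of rx re dat.rY dat.reY dat.Y0 eq
  have rp := S.rp
  have e11 := P.U11_eq rp
  have e12 := P.U12_eq rp
  have e22 := P.U22_eq rp
  have E := S.E0
  refine ⟨GMA.R (GMA.pp x), GMA.R_contDiff rp, GMA.R_biper _, ?_, ?_⟩
  · intro z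
    have := E z
    rw [hR, e11, e12, e22] at this
    rw [GMA.pdx_R rp, GMA.pdy_R rp, GMA.pdx_R (rp.D _), GMA.pdy_R (rp.D _), GMA.pdy_R (rp.D _)]
    exact this
  · intro z
    have := el z
    rw [e11, e12, e22] at this
    rw [GMA.pdx_R rp, GMA.pdy_R rp, GMA.pdx_R (rp.D _), GMA.pdy_R (rp.D _), GMA.pdy_R (rp.D _)]
    exact GMA.posDef_of_low hl this
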